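/- Let P be a fullerene. Then: (1) for each of the 12 pentagonal facets, the five facets surrounding it form a 5-belt, giving 12 such 5-belts; (2) if P has a 5-belt B not surrounding a pentagon, then B consists of hexagons, each meeting its two neighbors in the belt along opposite edges, and P has the following structure: it consists of two caps, each formed by a pentagonal facet together with the five pentagons surrounding it, separated by k ≥ 1 hexagonal 5-belts, each bordering the next; in this case P has exactly 12 + k five-belts; (3) conversely, if P contains a cap consisting of a pentagon surrounded by five pentagons whose outer boundary is met by each of the five surrounding pentagons in two edges, then P has the structure described in (2) for some k ≥ 0 (k = 0 giving the dodecahedron). -/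

import Mathlib

open Set

noncomputable section

/-- The ambient space `ℝ³`. -/
abbrev E3 := EuclideanSpace ℝ (Fin 3)

/-- The cyclic successor in `Fin k`. -/
def nxt {k : ℕ} (i : Fin k) : Fin k := ⟨(i.1 + 1) % k, Nat.mod_lt _ i.pos⟩

/-- The cyclic predecessor in `Fin k`. -/
def prv {k : ℕ} (i : Fin k) : Fin k := ⟨(i.1 + (k - 1)) % k, Nat.mod_lt _ i.pos⟩

/-- A convex polytope in `ℝ³`: the convex hull of a finite set of points. -/
def IsPolytope (P : Set E3) : Prop := ∃ V : Finset E3, P = convexHull ℝ (V : Set E3)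

/-- The dimension of a subset of `ℝ³` (the dimension of its affine hull). -/
def setDim (A : Set E3) : ℕ := Module.finrank ℝ ↥(vectorSpan ℝ A)

/-- A face of a polytope: a nonempty closed convex extreme subset. -/
def IsFaceOf (F P : Set E3) : Prop :=
  F.Nonempty ∧ IsClosed F ∧ Convex ℝ F ∧ IsExtreme ℝ P F

/-- A facet: a `2`-dimensional face. -/
def IsFacetOf (F P : Set E3) : Prop := IsFaceOf F P ∧ setDim F = 2

/-- An edge: a `1`-dimensional face. -/
def IsEdgeOf (F P : Set E3) : Prop := IsFaceOf F P ∧ setDim F = 1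

/-- A vertex: a point whose singleton is a face. -/
def IsVertexOf (v : E3) (P : Set E3) : Prop := IsFaceOf {v} P

/-- The set of facets of `P`. -/
def facets (P : Set E3) : Set (Set E3) := {F | IsFacetOf F P}

/-- A simple 3-polytope: a 3-dimensional convex polytope each of whose vertices
is contained in exactly 3 facets. -/
def IsSimplePolytope3 (P : Set E3) : Prop :=
  IsPolytope P ∧ setDim P = 3 ∧
    ∀ v : E3, IsVertexOf v P → {F | IsFacetOf F P ∧ v ∈ F}.ncard = 3

/-- The number of edges of a facet `F` of `P`. -/
def facetEdges (P F : Set E3) : ℕ := {e | IsEdgeOf e P ∧ e ⊆ F}.ncard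

/-- `pVec P k` is the number of `k`-gonal facets of `P`. -/
def pVec (P : Set E3) (k : ℕ) : ℕ := {F | IsFacetOf F P ∧ facetEdges P F = k}.ncard

/-- A (mathematical) fullerene: a simple 3-polytope with all facets pentagons
and hexagons. -/
def IsFullerene (P : Set E3) : Prop :=
  IsSimplePolytope3 P ∧ ∀ F, IsFacetOf F P → facetEdges P F = 5 ∨ facetEdges P F = 6

/-- A `k`-loop in `P` (`k ≥ 2`): a cyclic sequence of facets in which
(cyclically) consecutive facets intersect in an edge; a `1`-loop is a single facet. -/
def IsLoop (P : Set E3) {k : ℕ} (L : Fin k → Set E3) : Prop :=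
  0 < k ∧ (∀ i, IsFacetOf (L i) P) ∧ (2 ≤ k → ∀ i, IsEdgeOf (L i ∩ L (nxt i)) P)

/-- A simple loop: a loop with pairwise different facets. -/
def IsSimpleLoop (P : Set E3) {k : ℕ} (L : Fin k → Set E3) : Prop :=
  IsLoop P L ∧ Function.Injective L

/-- A `k`-belt (`k ≥ 3`): a `k`-loop such that for `k = 3` the three facets have empty
total intersection, and for `k ≥ 4` two facets intersect iff they are cyclically successive. -/
def IsBelt (P : Set E3) {k : ℕ} (L : Fin k → Set E3) : Prop :=
  3 ≤ k ∧ IsLoop P L ∧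
    (k = 3 → ∀ i, L i ∩ L (nxt i) ∩ L (nxt (nxt i)) = ∅) ∧
    (4 ≤ k → ∀ p q, p ≠ q → ((L p ∩ L q).Nonempty ↔ q = nxt p ∨ p = nxt q))

/-- A flag 3-polytope: a simple 3-polytope different from the tetrahedron
(i.e. not having exactly 4 facets) without 3-belts. -/
def IsFlag3Polytope (P : Set E3) : Prop :=
  IsSimplePolytope3 P ∧ (facets P).ncard ≠ 4 ∧ ∀ B : Fin 3 → Set E3, ¬ IsBelt P B

/-- `γ` is the simple edge-cycle of `P` traced by the cyclically ordered distinct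
vertices `v 0, …, v (n-1)` (`n ≥ 3`), consecutive ones joined by edges of `P`. -/
def IsSimpleEdgeCycleVia (P γ : Set E3) {n : ℕ} (v : Fin n → E3) : Prop :=
  3 ≤ n ∧ Function.Injective v ∧ (∀ i, IsVertexOf (v i) P) ∧
    (∀ i, IsEdgeOf (segment ℝ (v i) (v (nxt i))) P) ∧
    γ = ⋃ i, segment ℝ (v i) (v (nxt i))

/-- A simple edge-cycle in the graph of `P`. -/
def IsSimpleEdgeCycle (P γ : Set E3) : Prop :=
  ∃ (n : ℕ) (v : Fin n → E3), IsSimpleEdgeCycleVia P γ v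

/-- `C` is a connected component of the set `A`. -/
def IsCompOf (C A : Set E3) : Prop := ∃ x ∈ A, C = connectedComponentIn A x

/-- The loop `L` is obtained by walking round the simple edge-cycle `γ` inside the
connected component `C` of `∂P ∖ γ`: the facets of `L` lie on the side `C`, and the
edges of `γ`, in cyclic order, lie in the facets of `L` in cyclic order (the loop
index advancing exactly when the facet changes, and making exactly one turn). -/
def WalksRound (P γ C : Set E3) {k : ℕ} (L : Fin k → Set E3) : Prop :=
  IsLoop P L ∧ (∀ i, intrinsicInterior ℝ (L i) ⊆ C) ∧
    ∃ (n : ℕ) (v : Fin n → E3) (φ : Fin n → Fin k),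
      IsSimpleEdgeCycleVia P γ v ∧
      (∀ i, segment ℝ (v i) (v (nxt i)) ⊆ L (φ i)) ∧
      (∀ i, φ (nxt i) = φ i ∨ φ (nxt i) = nxt (φ i)) ∧
      Function.Surjective φ ∧
      (2 ≤ k → (Finset.univ.filter (fun i : Fin n => φ (nxt i) ≠ φ i)).card = k)

/-- Two loops border each other: they are obtained by walking round the same simple
edge-cycle `γ` in the two different connected components of `∂P ∖ γ`. -/
def Borders (P : Set E3) {k₁ k₂ : ℕ} (L₁ : Fin k₁ → Set E3) (L₂ : Fin k₂ → Set E3) : Prop :=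
  ∃ γ C₁ C₂ : Set E3, IsCompOf C₁ (frontier P \ γ) ∧ IsCompOf C₂ (frontier P \ γ) ∧
    C₁ ≠ C₂ ∧ WalksRound P γ C₁ L₁ ∧ WalksRound P γ C₂ L₂

/-- A loop surrounds the facet `F` if it borders the `1`-loop `(F)`. -/
def Surrounds (P : Set E3) {k : ℕ} (L : Fin k → Set E3) (F : Set E3) : Prop :=
  IsFacetOf F P ∧ Borders P L (fun _ : Fin 1 => F)

/-- The number of edges of `P` lying in the facet `F` and in the set `γ`. -/
def edgesInCommon (P F γ : Set E3) : ℕ := {e | IsEdgeOf e P ∧ e ⊆ F ∧ e ⊆ γ}.ncard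
/-- A simple 3-polytope all of whose facets are pentagons and hexagons except for
at most one exceptional facet, which is a quadrangle or a heptagon. -/
def IsAlmostFullerene (P : Set E3) : Prop :=
  IsSimplePolytope3 P ∧
    (∀ F, IsFacetOf F P → facetEdges P F ∈ ({4, 5, 6, 7} : Set ℕ)) ∧
    {F | IsFacetOf F P ∧ (facetEdges P F = 4 ∨ facetEdges P F = 7)}.ncard ≤ 1

/-- The (combinatorial) dodecahedron: a simple 3-polytope with all facets pentagons. -/
def IsDodecahedron (P : Set E3) : Prop :=
  IsSimplePolytope3 P ∧ ∀ F, IsFacetOf F P → facetEdges P F = 5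

/-- `e` and `e'` are opposite edges of the hexagonal facet `H`: they are disjoint and no
edge of `H` meets both of them. -/
def OppositeEdges (P H e e' : Set E3) : Prop :=
  IsEdgeOf e P ∧ IsEdgeOf e' P ∧ e ⊆ H ∧ e' ⊆ H ∧ e ∩ e' = ∅ ∧
    ∀ e'', IsEdgeOf e'' P → e'' ⊆ H → (e'' ∩ e).Nonempty → e'' ≠ e → e'' ∩ e' = ∅

/-- A cap: a pentagonal facet `F₀` together with a surrounding 5-belt of pentagons. -/
def IsCapOf (P F₀ : Set E3) (L : Fin 5 → Set E3) : Prop :=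
  IsFacetOf F₀ P ∧ facetEdges P F₀ = 5 ∧ (∀ i, facetEdges P (L i) = 5) ∧
    IsBelt P L ∧ Surrounds P L F₀

/-- The number of 5-belts of `P` (counted as sets of facets). -/
def fiveBeltCount (P : Set E3) : ℕ :=
  {S : Set (Set E3) | ∃ B : Fin 5 → Set E3, IsBelt P B ∧ S = Set.range B}.ncard

/-- The structure of the `k`-th fullerene of Family I: two caps separated by `k`
hexagonal 5-belts, each bordering the next (for `k = 0` the caps border each other,
giving the dodecahedron). -/
def FamilyI (P : Set E3) (k : ℕ) : Prop :=
  ∃ (F₀ F₀' : Set E3) (L L' : Fin 5 → Set E3) (B : ℕ → Fin 5 → Set E3),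
    IsCapOf P F₀ L ∧ IsCapOf P F₀' L' ∧
    (∀ i < k, IsBelt P (B i) ∧ ∀ j, facetEdges P (B i j) = 6) ∧
    (∀ i, i + 1 < k → Borders P (B i) (B (i + 1))) ∧
    (0 < k → Borders P L (B 0) ∧ Borders P (B (k - 1)) L') ∧
    (k = 0 → Borders P L L') ∧
    facets P = {F₀, F₀'} ∪ Set.range L ∪ Set.range L' ∪ ⋃ i ∈ Set.Iio k, Set.range (B i)

/-- `P` is obtained from `Q` by an `(s,k;t₀,t₁)`-truncation with new edge `Enew`:
`P` is cut off from `Q` by a halfspace `{f ≤ c}` whose boundary plane crosses exactly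
two edges `E₀ ≠ E₁` of a `k`-gonal facet `F` of `Q`, cutting off exactly `s` vertices,
all belonging to `F`; `G₀` and `G₁` are the facets meeting `F` along `E₀` and `E₁`, and
they are `t₀`- and `t₁`-gons; `Enew` is the new edge dividing `F`. -/
def IsTruncation (s k t₀ t₁ : ℕ) (Q P Enew : Set E3) : Prop :=
  IsSimplePolytope3 Q ∧ IsSimplePolytope3 P ∧
    ∃ (F E₀ E₁ G₀ G₁ : Set E3) (f : E3 →ₗ[ℝ] ℝ) (c : ℝ),
      IsFacetOf F Q ∧ facetEdges Q F = k ∧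
      IsEdgeOf E₀ Q ∧ IsEdgeOf E₁ Q ∧ E₀ ≠ E₁ ∧ E₀ ⊆ F ∧ E₁ ⊆ F ∧
      IsFacetOf G₀ Q ∧ IsFacetOf G₁ Q ∧ G₀ ≠ F ∧ G₁ ≠ F ∧ E₀ ⊆ G₀ ∧ E₁ ⊆ G₁ ∧
      facetEdges Q G₀ = t₀ ∧ facetEdges Q G₁ = t₁ ∧
      P = Q ∩ {x | f x ≤ c} ∧
      (∀ e, IsEdgeOf e Q → (∃ x ∈ e, c < f x) → (∃ x ∈ e, f x < c) → e = E₀ ∨ e = E₁) ∧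
      (∃ x ∈ E₀, c < f x) ∧ (∃ x ∈ E₀, f x < c) ∧
      (∃ x ∈ E₁, c < f x) ∧ (∃ x ∈ E₁, f x < c) ∧
      (∀ v, IsVertexOf v Q → f v ≠ c) ∧
      {v | IsVertexOf v Q ∧ c < f v}.ncard = s ∧
      (∀ v, IsVertexOf v Q → c < f v → v ∈ F) ∧
      Enew = F ∩ {x | f x = c}

/-- Combinatorial equivalence of polytopes: an inclusion-preserving bijection
between the sets of faces. -/
def CombEquiv (P Q : Set E3) : Prop :=
  ∃ φ : {A : Set E3 // IsFaceOf A P} ≃ {A : Set E3 // IsFaceOf A Q},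
    ∀ A B : {A : Set E3 // IsFaceOf A P}, A.1 ⊆ B.1 ↔ (φ A).1 ⊆ (φ B).1

/-- Combinatorial equivalence sending the face `Ep` of `P` to the face `Eq` of `Q`. -/
def CombEquivMapping (P Q Ep Eq : Set E3) : Prop :=
  ∃ φ : {A : Set E3 // IsFaceOf A P} ≃ {A : Set E3 // IsFaceOf A Q},
    (∀ A B : {A : Set E3 // IsFaceOf A P}, A.1 ⊆ B.1 ↔ (φ A).1 ⊆ (φ B).1) ∧
    ∀ h : IsFaceOf Ep P, ((φ ⟨Ep, h⟩) : {A : Set E3 // IsFaceOf A Q}).1 = Eq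

/-- The straightening of `P` along the edge `E` is defined: `P` is combinatorially
obtained from some simple 3-polytope `Q` by an `(s,k)`-truncation whose new edge
corresponds to `E`. -/
def StraighteningDefined (P E : Set E3) : Prop :=
  ∃ (s k t₀ t₁ : ℕ) (Q P₁ E₁ : Set E3),
    IsTruncation s k t₀ t₁ Q P₁ E₁ ∧ CombEquivMapping P P₁ E E₁

/-- `P` is obtained from `Q` by one of the truncations
`(1;4,5)`, `(1;5,5)`, `(2,6;4,5)`, `(2,6;5,5)`, `(2,6;5,6)`, `(2,7;5,5)`, `(2,7;5,6)`. -/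
def FullereneStep (Q P : Set E3) : Prop :=
  ∃ (s k t₀ t₁ : ℕ) (Enew : Set E3), IsTruncation s k t₀ t₁ Q P Enew ∧
    ((s = 1 ∧ (({t₀, t₁} : Finset ℕ) = {4, 5} ∨ ({t₀, t₁} : Finset ℕ) = {5, 5})) ∨
     (s = 2 ∧ k = 6 ∧ (({t₀, t₁} : Finset ℕ) = {4, 5} ∨ ({t₀, t₁} : Finset ℕ) = {5, 5} ∨
        ({t₀, t₁} : Finset ℕ) = {5, 6})) ∨
     (s = 2 ∧ k = 7 ∧ (({t₀, t₁} : Finset ℕ) = {5, 5} ∨ ({t₀, t₁} : Finset ℕ) = {5, 6})))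


section
/-- Abstract cubic map: darts `D`, facets `Φ`. -/
structure CMap (D Φ : Type*) where
  r : Equiv.Perm D
  a : D → D
  f : D → Φ
  N : Φ → ℕ
  aa : ∀ d, a (a d) = d
  ara : ∀ d, a (r (a d)) = r⁻¹ (a (r⁻¹ d))
  fr : ∀ d, f (r d) = f d
  per : ∀ (k : ℤ) d, (r ^ k) d = d ↔ (N (f d) : ℤ) ∣ k
  trans : ∀ d d', f d = f d' → ∃ k : ℤ, (r ^ k) d = d'
  surj : ∀ F, ∃ d, f d = F
  ne : ∀ d, f (a d) ≠ f d
  uniq : ∀ d d', f d = f d' → f (a d) = f (a d') → d = d'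
  conn : ∀ X : Set Φ, X.Nonempty → (∀ d, f d ∈ X → f (a d) ∈ X) → ∀ F, F ∈ X
  N56 : ∀ F, N F = 5 ∨ N F = 6
  pent : ∃ F, N F = 5

namespace CMap
variable {D Φ : Type*} (M : CMap D Φ)

def R (k : ℤ) (x : D) : D := (M.r ^ k) x

lemma R_zero (x : D) : M.R 0 x = x := by simp [R]
lemma R_add (i j : ℤ) (x : D) : M.R i (M.R j x) = M.R (i + j) x := by
  simp [R, zpow_add]
lemma R_one (x : D) : M.R 1 x = M.r x := by simp [R]
lemma f_rinv (x : D) : M.f (M.r⁻¹ x) = M.f x := by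
  conv_rhs => rw [show x = M.r (M.r⁻¹ x) by simp]
  rw [M.fr]
lemma fR (k : ℤ) (x : D) : M.f (M.R k x) = M.f x := by
  unfold R
  induction k using Int.induction_on generalizing x with
  | zero => simp
  | succ i ih => rw [zpow_add_one, Equiv.Perm.mul_apply, ih, M.fr]
  | pred i ih => rw [zpow_sub_one, Equiv.Perm.mul_apply, ih, M.f_rinv]
lemma a_inj {x y : D} (h : M.a x = M.a y) : x = y := by rw [← M.aa x, h, M.aa]
lemma R_eq_iff (i j : ℤ) (x : D) : M.R i x = M.R j x ↔ (M.N (M.f x) : ℤ) ∣ i - j := by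
  rw [← M.per]
  constructor
  · intro h
    have := congrArg (M.R (-j)) h
    rw [R_add, R_add] at this
    simp only [neg_add_cancel, R_zero] at this
    rw [show i - j = -j + i by ring]; exact this
  · intro h
    have : M.R (i - j) x = x := h
    conv_rhs => rw [← this]
    rw [R_add]; congr 1; ring
lemma R_cong {i j : ℤ} {x : D} (h : (M.N (M.f x) : ℤ) ∣ i - j) : M.R i x = M.R j x :=
  (M.R_eq_iff i j x).2 h
lemma R_self {i : ℤ} {x : D} : M.R i x = x ↔ (M.N (M.f x) : ℤ) ∣ i := M.per i x
lemma R_inj {i : ℤ} {x y : D} (h : M.R i x = M.R i y) : x = y := (M.r ^ i).injective h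
lemma ara1 (x : D) : M.a (M.R 1 (M.a x)) = M.R (-1) (M.a (M.R (-1) x)) := by
  simpa [R] using M.ara x
lemma aran1 (x : D) : M.a (M.R (-1) (M.a x)) = M.R 1 (M.a (M.R 1 x)) := by
  have h := M.ara1 (M.R 1 x)
  rw [R_add] at h
  norm_num [R_zero] at h
  have h2 := congrArg (fun z => M.R 1 z) h
  simp only [R_add] at h2
  norm_num [R_zero] at h2
  have h3 := M.ara1 (M.a (M.R 1 (M.a x)))
  rw [M.aa] at h3
  -- direct derivation
  apply M.a_inj
  rw [M.aa]
  have h4 := M.ara1 (M.R 1 x)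
  have h5 : M.a (M.R 1 (M.a (M.R 1 x))) = M.R (-1) (M.a x) := by
    rw [h4, R_add]; norm_num [R_zero]
  exact h5.symm

/-- mirror image -/
def mirror : CMap D Φ where
  r := M.r⁻¹
  a := M.a
  f := M.f
  N := M.N
  aa := M.aa
  ara d := by
    have := M.aran1 d
    simpa [R] using this
  fr := M.f_rinv
  per k d := by
    have := M.per (-k) d
    rw [dvd_neg] at this
    rw [← this]; simp
  trans d d' h := by
    obtain ⟨k, hk⟩ := M.trans d d' h
    exact ⟨-k, by simpa using hk⟩
  surj := M.surj
  ne := M.ne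
  uniq := M.uniq
  conn := M.conn
  N56 := M.N56
  pent := M.pent

lemma mirror_R (k : ℤ) (x : D) : M.mirror.R k x = M.R (-k) x := by simp [R, mirror]
@[simp] lemma mirror_a : M.mirror.a = M.a := rfl
@[simp] lemma mirror_f : M.mirror.f = M.f := rfl
@[simp] lemma mirror_N : M.mirror.N = M.N := rfl
lemma mirror_mirror : M.mirror.mirror = M := by
  cases M; simp [mirror]

/-- reduced turn -/
def rd (x : D) (t : ℤ) : Prop :=
  ¬ (M.N (M.f x) : ℤ) ∣ t ∧ ¬ (M.N (M.f x) : ℤ) ∣ t - 1 ∧ ¬ (M.N (M.f x) : ℤ) ∣ t + 1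

lemma C1 {x : D} {t : ℤ} (h : M.a (M.R t x) = x) : False := by
  have := M.ne (M.R t x)
  rw [h, fR] at this
  exact this rfl

lemma C2' {x1 x2 : D} {t1 t2 : ℤ} (h1 : x2 = M.a (M.R t1 x1)) (h2 : x1 = M.a (M.R t2 x2)) :
    (M.N (M.f x1) : ℤ) ∣ t1 := by
  rw [← R_self]
  apply M.uniq
  · rw [fR]
  · rw [← h1]
    conv_rhs => rw [h2, M.aa, fR]

lemma C2 {x1 x2 : D} {t1 t2 : ℤ} (h1 : x2 = M.a (M.R t1 x1)) (h2 : x1 = M.a (M.R t2 x2)) :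
    (M.N (M.f x1) : ℤ) ∣ t1 ∧ (M.N (M.f x2) : ℤ) ∣ t2 := ⟨M.C2' h1 h2, M.C2' h2 h1⟩

lemma short0 {x1 x2 x3 : D} {t1 t2 : ℤ} (h1 : x2 = M.a (M.R t1 x1)) (h2 : x3 = M.a (M.R t2 x2))
    (h : (M.N (M.f x2) : ℤ) ∣ t2) : x3 = M.R t1 x1 := by
  rw [h2, M.R_self.2 h, h1, M.aa]

lemma short1 {x1 x2 x3 : D} {t1 t2 : ℤ} (h1 : x2 = M.a (M.R t1 x1)) (h2 : x3 = M.a (M.R t2 x2))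
    (h : (M.N (M.f x2) : ℤ) ∣ t2 - 1) : M.R 1 x3 = M.a (M.R (t1 - 1) x1) := by
  rw [h2, M.R_cong h, h1, ara1, R_add, R_add]
  norm_num [R_zero]
  congr 2; ring

lemma short2 {x1 x2 x3 : D} {t1 t2 : ℤ} (h1 : x2 = M.a (M.R t1 x1)) (h2 : x3 = M.a (M.R t2 x2))
    (h : (M.N (M.f x2) : ℤ) ∣ t2 + 1) : M.R (-1) x3 = M.a (M.R (t1 + 1) x1) := by
  rw [h2, M.R_cong (i := t2) (j := -1) (by simpa using h), h1, aran1, R_add, R_add]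
  norm_num [R_zero]
  congr 2; ring

lemma C3 {x1 x2 x3 : D} {t1 t2 t3 : ℤ} (h1 : x2 = M.a (M.R t1 x1)) (h2 : x3 = M.a (M.R t2 x2))
    (h3 : x1 = M.a (M.R t3 x3)) :
    ((M.N (M.f x1) : ℤ) ∣ t1 - 1 ∧ (M.N (M.f x2) : ℤ) ∣ t2 - 1 ∧ (M.N (M.f x3) : ℤ) ∣ t3 - 1) ∨
    ((M.N (M.f x1) : ℤ) ∣ t1 + 1 ∧ (M.N (M.f x2) : ℤ) ∣ t2 + 1 ∧ (M.N (M.f x3) : ℤ) ∣ t3 + 1) ∨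
    (M.rd x1 t1 ∧ M.rd x2 t2 ∧ M.rd x3 t3) := by
  have z : ∀ {x1 x2 x3 : D} {t1 t2 t3 : ℤ} (h1 : x2 = M.a (M.R t1 x1)) (h2 : x3 = M.a (M.R t2 x2))
    (h3 : x1 = M.a (M.R t3 x3)), ¬ (M.N (M.f x2) : ℤ) ∣ t2 := by
    intro x1 x2 x3 t1 t2 t3 h1 h2 h3 h
    have := M.short0 h1 h2 h
    apply M.ne (M.R t3 x3)
    rw [← h3, fR, this, fR]
  have p : ∀ {x1 x2 x3 : D} {t1 t2 t3 : ℤ} (h1 : x2 = M.a (M.R t1 x1)) (h2 : x3 = M.a (M.R t2 x2))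
    (h3 : x1 = M.a (M.R t3 x3)), (M.N (M.f x2) : ℤ) ∣ t2 - 1 → 
      (M.N (M.f x1) : ℤ) ∣ t1 - 1 ∧ (M.N (M.f x3) : ℤ) ∣ t3 - 1 := by
    intro x1 x2 x3 t1 t2 t3 h1 h2 h3 h
    have e := M.short1 h1 h2 h
    have := M.C2 e (t2 := t3 - 1) (by rw [R_add]; convert h3 using 3; ring)
    simpa [fR] using this
  have q : ∀ {x1 x2 x3 : D} {t1 t2 t3 : ℤ} (h1 : x2 = M.a (M.R t1 x1)) (h2 : x3 = M.a (M.R t2 x2))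
    (h3 : x1 = M.a (M.R t3 x3)), (M.N (M.f x2) : ℤ) ∣ t2 + 1 → 
      (M.N (M.f x1) : ℤ) ∣ t1 + 1 ∧ (M.N (M.f x3) : ℤ) ∣ t3 + 1 := by
    intro x1 x2 x3 t1 t2 t3 h1 h2 h3 h
    have e := M.short2 h1 h2 h
    have := M.C2 e (t2 := t3 + 1) (by rw [R_add]; convert h3 using 3; ring)
    simpa [fR] using this
  have z1 := z h1 h2 h3
  have z2 := z h2 h3 h1
  have z3 := z h3 h1 h2
  have p1 := p h1 h2 h3
  have p2 := p h2 h3 h1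
  have p3 := p h3 h1 h2
  have q1 := q h1 h2 h3
  have q2 := q h2 h3 h1
  have q3 := q h3 h1 h2
  unfold rd
  tauto

/-- no closed reduced walk of length 3 -/
def No3 : Prop := ∀ {x1 x2 x3 : D} {t1 t2 t3 : ℤ}, x2 = M.a (M.R t1 x1) → x3 = M.a (M.R t2 x2) →
    x1 = M.a (M.R t3 x3) → ¬ (M.rd x1 t1 ∧ M.rd x2 t2 ∧ M.rd x3 t3)

def No4 : Prop := ∀ {x1 x2 x3 x4 : D} {t1 t2 t3 t4 : ℤ}, x2 = M.a (M.R t1 x1) → 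
    x3 = M.a (M.R t2 x2) → x4 = M.a (M.R t3 x3) →
    x1 = M.a (M.R t4 x4) → ¬ (M.rd x1 t1 ∧ M.rd x2 t2 ∧ M.rd x3 t3 ∧ M.rd x4 t4)

/-- Bad patterns of length 4. -/
def pat4 (n1 n2 n3 n4 t1 t2 t3 t4 : ℤ) : Prop :=
  (n1 ∣ t1 ∧ n3 ∣ t3) ∨ (n2 ∣ t2 ∧ n4 ∣ t4) ∨
  (n1 ∣ t1 - 1 ∧ n2 ∣ t2 - 2 ∧ n3 ∣ t3 - 1 ∧ n4 ∣ t4 - 2) ∨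
  (n1 ∣ t1 - 2 ∧ n2 ∣ t2 - 1 ∧ n3 ∣ t3 - 2 ∧ n4 ∣ t4 - 1) ∨
  (n1 ∣ t1 + 1 ∧ n2 ∣ t2 + 2 ∧ n3 ∣ t3 + 1 ∧ n4 ∣ t4 + 2) ∨
  (n1 ∣ t1 + 2 ∧ n2 ∣ t2 + 1 ∧ n3 ∣ t3 + 2 ∧ n4 ∣ t4 + 1)

lemma pat4_rot {n1 n2 n3 n4 t1 t2 t3 t4 : ℤ} (h : pat4 n2 n3 n4 n1 t2 t3 t4 t1) :
    pat4 n1 n2 n3 n4 t1 t2 t3 t4 := by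
  unfold pat4 at *
  rcases h with ⟨a, b⟩ | ⟨a, b⟩ | ⟨a, b, c, d⟩ | ⟨a, b, c, d⟩ | ⟨a, b, c, d⟩ | ⟨a, b, c, d⟩
  · exact Or.inr (Or.inl ⟨a, b⟩)
  · exact Or.inl ⟨b, a⟩
  · exact Or.inr (Or.inr (Or.inr (Or.inl ⟨d, a, b, c⟩)))
  · exact Or.inr (Or.inr (Or.inl ⟨d, a, b, c⟩))
  · exact Or.inr (Or.inr (Or.inr (Or.inr (Or.inr ⟨d, a, b, c⟩))))
  · exact Or.inr (Or.inr (Or.inr (Or.inr (Or.inl ⟨d, a, b, c⟩))))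

lemma C4 (hN : M.No3) {x1 x2 x3 x4 : D} {t1 t2 t3 t4 : ℤ} (h1 : x2 = M.a (M.R t1 x1))
    (h2 : x3 = M.a (M.R t2 x2)) (h3 : x4 = M.a (M.R t3 x3)) (h4 : x1 = M.a (M.R t4 x4)) :
    pat4 (M.N (M.f x1)) (M.N (M.f x2)) (M.N (M.f x3)) (M.N (M.f x4)) t1 t2 t3 t4 ∨
    (M.rd x1 t1 ∧ M.rd x2 t2 ∧ M.rd x3 t3 ∧ M.rd x4 t4) := by
  have k : ∀ {x1 x2 x3 x4 : D} {t1 t2 t3 t4 : ℤ} (h1 : x2 = M.a (M.R t1 x1))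
    (h2 : x3 = M.a (M.R t2 x2)) (h3 : x4 = M.a (M.R t3 x3)) (h4 : x1 = M.a (M.R t4 x4)),
    pat4 (M.N (M.f x1)) (M.N (M.f x2)) (M.N (M.f x3)) (M.N (M.f x4)) t1 t2 t3 t4 ∨ M.rd x2 t2 := by
    intro x1 x2 x3 x4 t1 t2 t3 t4 h1 h2 h3 h4
    by_cases c0 : (M.N (M.f x2) : ℤ) ∣ t2
    · have e := M.short0 h1 h2 c0
      have := M.C2 (x1 := x1) (x2 := x4) (t1 := t3 + t1) (by rw [h3, e, R_add]) h4
      left; right; left; exact ⟨c0, this.2⟩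
    by_cases c1 : (M.N (M.f x2) : ℤ) ∣ t2 - 1
    · have e := M.short1 h1 h2 c1
      have e2 : x4 = M.a (M.R (t3 - 1) (M.R 1 x3)) := by
        rw [R_add]; convert h3 using 3; ring
      have := M.C3 e e2 h4
      have hn := hN e e2 h4
      simp only [fR] at this
      left; unfold pat4
      rcases this with ⟨a, b, c⟩ | ⟨a, b, c⟩ | h
      · right; right; right; left
        exact ⟨by convert a using 1; ring, c1, by convert b using 1; ring, c⟩
      · left; exact ⟨by convert a using 1; ring, by convert b using 1; ring⟩
      · exact absurd h hn
    by_cases c2 : (M.N (M.f x2) : ℤ) ∣ t2 + 1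
    · have e := M.short2 h1 h2 c2
      have e2 : x4 = M.a (M.R (t3 + 1) (M.R (-1) x3)) := by
        rw [R_add]; convert h3 using 3; ring
      have := M.C3 e e2 h4
      have hn := hN e e2 h4
      simp only [fR] at this
      left; unfold pat4
      rcases this with ⟨a, b, c⟩ | ⟨a, b, c⟩ | h
      · left; exact ⟨by convert a using 1; ring, by convert b using 1; ring⟩
      · right; right; right; right; right
        exact ⟨by convert a using 1; ring, c2, by convert b using 1; ring, c⟩
      · exact absurd h hn
    exact Or.inr ⟨c0, c1, c2⟩
  rcases k h1 h2 h3 h4 with k1 | k1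
  · exact Or.inl k1
  rcases k h2 h3 h4 h1 with k2 | k2
  · exact Or.inl (pat4_rot k2)
  rcases k h3 h4 h1 h2 with k3 | k3
  · exact Or.inl (pat4_rot (pat4_rot k3))
  rcases k h4 h1 h2 h3 with k4 | k4
  · exact Or.inl (pat4_rot (pat4_rot (pat4_rot k4)))
  exact Or.inr ⟨k4, k1, k2, k3⟩

/-- sum version of C5 with nonnegative turns -/
lemma C5 (hN : M.No3) (hN4 : M.No4) {x1 x2 x3 x4 x5 : D} {t1 t2 t3 t4 t5 : ℤ}
    (h1 : x2 = M.a (M.R t1 x1))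
    (h2 : x3 = M.a (M.R t2 x2)) (h3 : x4 = M.a (M.R t3 x3)) (h4 : x5 = M.a (M.R t4 x4))
    (h5 : x1 = M.a (M.R t5 x5)) (p1 : 2 ≤ t1) (p2 : 2 ≤ t2) (p3 : 2 ≤ t3) (p4 : 2 ≤ t4) (p5 : 2 ≤ t5)
    (hs : t1 + t2 + t3 + t4 + t5 ≤ 15) : M.rd x2 t2 := by
  have n1 := M.N56 (M.f x1)
  have n2 := M.N56 (M.f x2)
  have n3 := M.N56 (M.f x3)
  have n4 := M.N56 (M.f x4)
  have n5 := M.N56 (M.f x5)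
  refine ⟨?_, ?_, ?_⟩
  · intro c
    have e := M.short0 h1 h2 c
    have e2 : x4 = M.a (M.R (t3 + t1) x1) := by rw [h3, e, R_add]
    have := M.C3 e2 h4 h5
    have hn := hN e2 h4 h5
    rcases this with ⟨-, b, d⟩ | ⟨-, b, d⟩ | h
    · rcases n2 with n2 | n2 <;> rcases n4 with n4 | n4 <;> rcases n5 with n5 | n5 <;>
        rw [n2] at c <;> rw [n4] at b <;> rw [n5] at d <;> push_cast at b c d <;> omega
    · rcases n2 with n2 | n2 <;> rcases n4 with n4 | n4 <;> rcases n5 with n5 | n5 <;>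
        rw [n2] at c <;> rw [n4] at b <;> rw [n5] at d <;> push_cast at b c d <;> omega
    · exact absurd h hn
  · intro c
    have e := M.short1 h1 h2 c
    have e2 : x4 = M.a (M.R (t3 - 1) (M.R 1 x3)) := by
        rw [R_add]; convert h3 using 3; ring
    have := (M.C4 hN e e2 h4 h5).resolve_right (hN4 e e2 h4 h5)
    simp only [fR, pat4] at this
    rcases n1 with n1 | n1 <;> rcases n2 with n2 | n2 <;> rcases n3 with n3 | n3 <;> 
      rcases n4 with n4 | n4 <;> rcases n5 with n5 | n5 <;> 
      simp only [n1, n2, n3, n4, n5] at c this <;> push_cast at c this <;> omega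
  · intro c
    have e := M.short2 h1 h2 c
    have e2 : x4 = M.a (M.R (t3 + 1) (M.R (-1) x3)) := by
        rw [R_add]; convert h3 using 3; ring
    have := (M.C4 hN e e2 h4 h5).resolve_right (hN4 e e2 h4 h5)
    simp only [fR, pat4] at this
    rcases n1 with n1 | n1 <;> rcases n2 with n2 | n2 <;> rcases n3 with n3 | n3 <;> 
      rcases n4 with n4 | n4 <;> rcases n5 with n5 | n5 <;> 
      simp only [n1, n2, n3, n4, n5] at c this <;> push_cast at c this <;> omega

end CMap
end

section
namespace CMap
variable {D Φ : Type*} (M : CMap D Φ)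

def wk : List ℕ → D → D
  | [], x => x
  | t :: ts, x => wk ts (M.a (M.R t x))

def Red : List ℕ → D → Prop
  | [], _ => True
  | t :: ts, x => (2 ≤ t ∧ t + 2 ≤ M.N (M.f x)) ∧ Red ts (M.a (M.R t x))

def pl : ℕ → List ℕ → List ℕ × ℕ
  | acc, [] => ([], acc)
  | acc, c :: cs => if c = 0 then pl (acc + 1) cs else
      ((acc + 1) :: (List.replicate (c - 1) 2 ++ (pl 2 cs).1), (pl 2 cs).2)

def mg (cs : List ℕ) : List ℕ :=
  match pl 0 cs with
  | ([], _) => []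
  | (u :: us, q) => (u + q) :: us

lemma wk_append (l1 l2 : List ℕ) (x : D) : M.wk (l1 ++ l2) x = M.wk l2 (M.wk l1 x) := by
  induction l1 generalizing x with
  | nil => rfl
  | cons t l ih => simp [wk, ih]

lemma Red_append (l1 l2 : List ℕ) (x : D) :
    M.Red (l1 ++ l2) x ↔ M.Red l1 x ∧ M.Red l2 (M.wk l1 x) := by
  induction l1 generalizing x with
  | nil => simp [Red, wk]
  | cons t l ih => simp [Red, wk, ih, and_assoc]

lemma wk_rep (c : ℕ) (j : ℤ) (x : D) : 
    M.mirror.wk (List.replicate c 2) (M.R 1 (M.a (M.R j x))) = M.R 1 (M.a (M.R (j + c) x)) := by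
  induction c generalizing j with
  | zero => simp [wk]
  | succ c ih =>
    simp only [List.replicate_succ, wk, mirror_R, mirror_a, R_add]
    rw [show (-((2:ℕ):ℤ) + 1) = -1 by norm_num, aran1, R_add, ih]
    congr 3; push_cast; ring

lemma pl_spec (cs : List ℕ) (acc : ℕ) (x w : D) (h : M.a (M.R 1 x) = M.R (-acc) w) :
    M.a (M.R 1 (M.wk (cs.map (· + 2)) x)) = M.R (-(pl acc cs).2) (M.mirror.wk (pl acc cs).1 w) := by
  induction cs generalizing acc x w with
  | nil => simpa [wk, pl] using h
  | cons c cs ih =>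
    simp only [List.map_cons, wk]
    by_cases hc : c = 0
    · subst hc
      simp only [pl, if_true]
      apply ih
      rw [ara1, R_add]
      rw [show (-1 + ((0 + 2 : ℕ) : ℤ)) = 1 by norm_num, h, R_add]
      congr 1; push_cast; ring
    · obtain ⟨c, rfl⟩ : ∃ c', c = c' + 1 := ⟨c - 1, by omega⟩
      simp only [pl, if_neg hc]
      simp only [wk, wk_append, mirror_R, mirror_a]
      have e : M.a (M.R (-((acc + 1 : ℕ) : ℤ)) w) = M.R 1 (M.a (M.R 2 x)) := by
        have : M.R (-((acc + 1 : ℕ) : ℤ)) w = M.R (-1) (M.a (M.R 1 x)) := by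
          rw [h, R_add]; congr 1; push_cast; ring
        rw [this, aran1, R_add]; norm_num
      rw [e]
      have := M.wk_rep c 2 x
      rw [show c + 1 - 1 = c by omega, this]
      apply ih
      rw [ara1, R_add, R_add]
      congr 3; push_cast; ring

lemma peel (cs : List ℕ) (x : D) (h : M.wk (cs.map (· + 2)) x = x) {v : ℕ} {vs : List ℕ}
    (hm : mg cs = v :: vs) : ∃ (y : D) (q u : ℕ), M.mirror.wk (v :: vs) y = y ∧ 
      y = M.R q (M.a (M.R 1 x)) ∧ v = u + q ∧ (pl 0 cs).1 = u :: vs := by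
  have sp := M.pl_spec cs 0 x (M.a (M.R 1 x)) (by simp [R_zero])
  rw [h] at sp
  unfold mg at hm
  rcases hp : pl 0 cs with ⟨us, q⟩
  rw [hp] at hm sp
  cases us with
  | nil => simp at hm
  | cons u us =>
    simp only [List.cons.injEq] at hm
    obtain ⟨rfl, rfl⟩ := hm
    refine ⟨_, q, u, ?_, rfl, rfl, rfl⟩
    simp only [wk, mirror_R, mirror_a] at sp ⊢
    rw [R_add]
    have : -((u + q : ℕ) : ℤ) + q = -u := by push_cast; ring
    rw [this]
    conv_rhs => rw [sp]
    rw [R_add]; simp [R_zero]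

lemma peel0 (cs : List ℕ) (x : D) (h : M.wk (cs.map (· + 2)) x = x) 
    (hm : pl 0 cs = ([], cs.length)) : (M.N (M.f (M.a (M.R 1 x))) : ℤ) ∣ cs.length := by
  have sp := M.pl_spec cs 0 x (M.a (M.R 1 x)) (by simp [R_zero])
  rw [h, hm] at sp
  simp only [wk] at sp
  have := (M.R_self).1 sp.symm
  simpa using this

/-- closed reduced walk -/
def RedC (m : ℕ) (ts : List ℕ) (x : D) : Prop :=
  ts.length = m ∧ M.wk ts x = x ∧ M.Red ts x

lemma RedC.rot {m : ℕ} {t : ℕ} {ts : List ℕ} {x : D} (h : M.RedC m (t :: ts) x) :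
    M.RedC m (ts ++ [t]) (M.a (M.R t x)) := by
  obtain ⟨h1, h2, h3⟩ := h
  simp only [wk, Red] at h2 h3
  refine ⟨by simpa using h1, ?_, ?_⟩
  · rw [wk_append, h2]; rfl
  · rw [Red_append, h2]; exact ⟨h3.2, h3.1, trivial⟩

lemma RedC.rot' {m : ℕ} {t : ℕ} {ts : List ℕ} {x : D} (h : M.RedC m (ts ++ [t]) x) :
    M.RedC m (t :: ts) (M.wk ts x) ∧ x = M.a (M.R t (M.wk ts x)) := by
  obtain ⟨h1, h2, h3⟩ := h
  rw [wk_append] at h2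
  rw [Red_append] at h3
  simp only [wk, Red] at h2 h3
  refine ⟨⟨by simpa using h1, ?_, ?_⟩, h2.symm⟩
  · simp only [wk]; rw [h2]
  · simp only [Red]; rw [h2]; exact ⟨h3.2.1, h3.1⟩

/-- lists of facet sizes along a walk -/
def ns : List ℕ → D → List ℕ
  | [], _ => []
  | t :: ts, x => M.N (M.f x) :: ns ts (M.a (M.R t x))

/-- mirrored turns N - t -/
def mir : List ℕ → D → List ℕ
  | [], _ => []
  | t :: ts, x => (M.N (M.f x) - t) :: mir ts (M.a (M.R t x))

lemma mir_step {t : ℕ} {x : D} (h : t ≤ M.N (M.f x)) :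
    M.mirror.R ((M.N (M.f x) - t : ℕ) : ℤ) x = M.R t x := by
  rw [mirror_R]
  apply M.R_cong
  rw [Nat.cast_sub h]
  exact ⟨-1, by ring⟩

lemma mir_wk (ts : List ℕ) (x : D) (h : M.Red ts x) : M.mirror.wk (M.mir ts x) x = M.wk ts x ∧
    M.mirror.Red (M.mir ts x) x := by
  induction ts generalizing x with
  | nil => exact ⟨rfl, trivial⟩
  | cons t ts ih =>
    obtain ⟨⟨h1, h2⟩, h3⟩ := h
    simp only [mir, wk, Red, mirror_a, mirror_f, mirror_N]
    rw [M.mir_step (by omega)]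
    refine ⟨(ih _ h3).1, ⟨⟨by omega, by omega⟩, (ih _ h3).2⟩⟩

lemma mir_len (ts : List ℕ) (x : D) : (M.mir ts x).length = ts.length := by
  induction ts generalizing x with
  | nil => rfl
  | cons t ts ih => simp [mir, ih]

lemma ns_len (ts : List ℕ) (x : D) : (M.ns ts x).length = ts.length := by
  induction ts generalizing x with
  | nil => rfl
  | cons t ts ih => simp [ns, ih]

lemma mir_sum (ts : List ℕ) (x : D) (h : M.Red ts x) :
    (M.mir ts x).sum + ts.sum = (M.ns ts x).sum := by
  induction ts generalizing x with
  | nil => rfl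
  | cons t ts ih =>
    obtain ⟨⟨h1, h2⟩, h3⟩ := h
    have := ih _ h3
    simp [mir, ns]; omega

lemma RedC.mir {m : ℕ} {ts : List ℕ} {x : D} (h : M.RedC m ts x) :
    M.mirror.RedC m (M.mir ts x) x := 
  ⟨by rw [mir_len]; exact h.1, by rw [(M.mir_wk _ _ h.2.2).1]; exact h.2.1, (M.mir_wk _ _ h.2.2).2⟩

lemma Red_ge (ts : List ℕ) (x : D) (h : M.Red ts x) : ∀ t ∈ ts, 2 ≤ t ∧ t ≤ 4 := by
  induction ts generalizing x with
  | nil => simp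
  | cons t ts ih =>
    obtain ⟨⟨h1, h2⟩, h3⟩ := h
    have := M.N56 (M.f x)
    intro u hu
    rcases List.mem_cons.1 hu with rfl | hu
    · omega
    · exact ih _ h3 u hu

lemma exists_cs (ts : List ℕ) (h : ∀ t ∈ ts, 2 ≤ t ∧ t ≤ 4) : 
    ∃ cs : List ℕ, ts = cs.map (· + 2) ∧ ∀ c ∈ cs, c ≤ 2 := by
  refine ⟨ts.map (· - 2), ?_, ?_⟩
  · rw [List.map_map]
    conv_lhs => rw [← List.map_id ts]
    apply List.map_congr_left
    intro t ht; have := h t ht; simp; omega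
  · intro c hc
    obtain ⟨t, ht, rfl⟩ := List.mem_map.1 hc
    have := h t ht; simp; omega

def okc (cs : List ℕ) : Prop :=
  (mg cs).length = cs.sum ∧ (1 ≤ cs.sum → (mg cs).sum = cs.length + 2 * cs.sum) ∧
  (∀ u ∈ mg cs, 2 ≤ u) ∧ (3 ≤ cs.sum → ∀ u ∈ mg cs, u ≤ 6) ∧ (cs.sum = 0 → pl 0 cs = ([], cs.length))
  ∧ (cs.sum = cs.length → (∀ u ∈ mg cs, u = 3) → ∀ c ∈ cs, c = 1)

instance (cs : List ℕ) : Decidable (okc cs) := by unfold okc; infer_instance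

set_option maxRecDepth 100000 in
lemma okc3 : ∀ a b c : Fin 3, okc [a.1, b.1, c.1] := by decide
set_option maxRecDepth 100000 in
lemma okc4 : ∀ a b c d : Fin 3, okc [a.1, b.1, c.1, d.1] := by decide
set_option maxRecDepth 100000 in
set_option maxHeartbeats 2000000 in
lemma okc5 : ∀ a b c d e : Fin 3, okc [a.1, b.1, c.1, d.1, e.1] := by decide

lemma okc_all (cs : List ℕ) (h : ∀ c ∈ cs, c ≤ 2) (hl : cs.length = 3 ∨ cs.length = 4 ∨ cs.length = 5) :
    okc cs := by
  rcases hl with hl | hl | hl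
  · match cs, hl with
    | [a, b, c], _ =>
      simp at h
      exact okc3 ⟨a, by omega⟩ ⟨b, by omega⟩ ⟨c, by omega⟩
  · match cs, hl with
    | [a, b, c, d], _ =>
      simp at h
      exact okc4 ⟨a, by omega⟩ ⟨b, by omega⟩ ⟨c, by omega⟩ ⟨d, by omega⟩
  · match cs, hl with
    | [a, b, c, d, e], _ =>
      simp at h
      exact okc5 ⟨a, by omega⟩ ⟨b, by omega⟩ ⟨c, by omega⟩ ⟨d, by omega⟩ ⟨e, by omega⟩

end CMap
end

section
namespace CMap
variable {D Φ : Type*} (M : CMap D Φ)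

def Nn (m : ℕ) : Prop := ∀ ts x, ¬ M.RedC m ts x

lemma Nn_mirror {m : ℕ} (h : M.Nn m) : M.mirror.Nn m := by
  intro ts x hr
  have := RedC.mir _ hr
  rw [mirror_mirror] at this
  exact h _ _ this

lemma rd_nat {x : D} {t : ℤ} (h : M.rd x t) : 
    ∃ u : ℕ, 2 ≤ u ∧ u + 2 ≤ M.N (M.f x) ∧ M.R u x = M.R t x := by
  obtain ⟨h0, h1, h2⟩ := h
  have hn := M.N56 (M.f x)
  refine ⟨(t % (M.N (M.f x))).toNat, ?_, ?_, ?_⟩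
  · rcases hn with hn | hn <;> simp only [hn] at h0 h1 h2 ⊢ <;> push_cast at * <;> omega
  · rcases hn with hn | hn <;> simp only [hn] at h0 h1 h2 ⊢ <;> push_cast at * <;> omega
  · apply M.R_cong
    rcases hn with hn | hn <;> simp only [hn] at h0 h1 h2 ⊢ <;> push_cast at * <;> omega

lemma No3_of (h : M.Nn 3) : M.No3 := by
  intro x1 x2 x3 t1 t2 t3 h1 h2 h3 ⟨r1, r2, r3⟩
  obtain ⟨u1, a1, b1, c1⟩ := M.rd_nat r1
  obtain ⟨u2, a2, b2, c2⟩ := M.rd_nat r2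
  obtain ⟨u3, a3, b3, c3⟩ := M.rd_nat r3
  apply h [u1, u2, u3] x1
  refine ⟨rfl, ?_, ?_⟩
  · simp only [wk]; rw [c1, ← h1, c2, ← h2, c3, ← h3]
  · simp only [Red]; rw [c1, ← h1, c2, ← h2]; exact ⟨⟨a1, b1⟩, ⟨a2, b2⟩, ⟨a3, b3⟩, trivial⟩

lemma No4_of (h : M.Nn 4) : M.No4 := by
  intro x1 x2 x3 x4 t1 t2 t3 t4 h1 h2 h3 h4 ⟨r1, r2, r3, r4⟩
  obtain ⟨u1, a1, b1, c1⟩ := M.rd_nat r1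
  obtain ⟨u2, a2, b2, c2⟩ := M.rd_nat r2
  obtain ⟨u3, a3, b3, c3⟩ := M.rd_nat r3
  obtain ⟨u4, a4, b4, c4⟩ := M.rd_nat r4
  apply h [u1, u2, u3, u4] x1
  refine ⟨rfl, ?_, ?_⟩
  · simp only [wk]; rw [c1, ← h1, c2, ← h2, c3, ← h3, c4, ← h4]
  · simp only [Red]; rw [c1, ← h1, c2, ← h2, c3, ← h3]
    exact ⟨⟨a1, b1⟩, ⟨a2, b2⟩, ⟨a3, b3⟩, ⟨a4, b4⟩, trivial⟩

lemma rd_le {x : D} {u : ℕ} (h : M.rd x u) (h2 : 2 ≤ u) (h6 : u ≤ 6) : 2 ≤ u ∧ u + 2 ≤ M.N (M.f x) := by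
  obtain ⟨h0, h1, h3⟩ := h
  have hn := M.N56 (M.f x)
  rcases hn with hn | hn <;> simp only [hn] at h0 h1 h3 ⊢ <;> push_cast at * <;> omega

lemma red_of_closed (L : List ℕ) (y : D) (hw : M.wk L y = y) (hl : L.length = 3 ∨ L.length = 4 ∨ L.length = 5)
    (h2 : ∀ u ∈ L, 2 ≤ u) (h6 : ∀ u ∈ L, u ≤ 6) (hs : L.sum ≤ 2 * L.length + 5)
    (n3 : 4 ≤ L.length → M.Nn 3) (n4 : 5 ≤ L.length → M.Nn 4) : M.Red L y := by
  rcases hl with hl | hl | hl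
  · match L, hl with
    | [a, b, c], _ =>
      simp only [wk] at hw
      simp at hs h2 h6
      obtain ⟨a2, b2, c2⟩ := h2
      obtain ⟨a6, b6, c6⟩ := h6
      have n1 := M.N56 (M.f y)
      have n2 := M.N56 (M.f (M.a (M.R a y)))
      have := M.C3 rfl rfl hw.symm
      rcases this with ⟨p1, p2, p3⟩ | ⟨p1, p2, p3⟩ | ⟨p1, p2, p3⟩
      · exfalso
        rcases n1 with n1 | n1 <;> rcases n2 with n2 | n2 <;> rw [n1] at p1 <;> rw [n2] at p2 <;>
          push_cast at * <;> omega
      · exfalso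
        have n3 := M.N56 (M.f (M.a (M.R b (M.a (M.R a y)))))
        rcases n1 with n1 | n1 <;> rcases n2 with n2 | n2 <;> rcases n3 with n3 | n3 <;> rw [n1] at p1 <;> rw [n2] at p2 <;> rw [n3] at p3 <;>
          push_cast at * <;> omega
      · exact ⟨M.rd_le p1 a2 a6, M.rd_le p2 b2 b6, M.rd_le p3 c2 c6, trivial⟩
  · match L, hl with
    | [a, b, c, d], _ =>
      simp only [wk] at hw
      simp at hs h2 h6 n3
      obtain ⟨a2, b2, c2, d2⟩ := h2
      obtain ⟨a6, b6, c6, d6⟩ := h6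
      have := M.C4 (M.No3_of n3) rfl rfl rfl hw.symm
      rcases this with p | ⟨p1, p2, p3, p4⟩
      · exfalso
        have n1 := M.N56 (M.f y)
        have n2 := M.N56 (M.f (M.a (M.R a y)))
        have n3 := M.N56 (M.f (M.a (M.R b (M.a (M.R a y)))))
        have n4 := M.N56 (M.f (M.a (M.R c (M.a (M.R b (M.a (M.R a y)))))))
        unfold pat4 at p
        rcases n1 with n1 | n1 <;> rcases n2 with n2 | n2 <;> rcases n3 with n3 | n3 <;> 
          rcases n4 with n4 | n4 <;> 
          simp only [n1, n2, n3, n4] at p <;> push_cast at p <;> omega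
      · exact ⟨M.rd_le p1 a2 a6, M.rd_le p2 b2 b6, M.rd_le p3 c2 c6, M.rd_le p4 d2 d6, trivial⟩
  · match L, hl with
    | [a, b, c, d, e], _ =>
      simp only [wk] at hw
      simp at hs h2 h6 n3 n4
      obtain ⟨a2, b2, c2, d2, e2⟩ := h2
      obtain ⟨a6, b6, c6, d6, e6⟩ := h6
      have m3 : M.No3 := M.No3_of n3
      have m4 : M.No4 := M.No4_of n4
      have p2 := M.C5 m3 m4 rfl rfl rfl rfl hw.symm (by omega) (by omega) (by omega) (by omega) (by omega) (by omega)
      have p3 := M.C5 m3 m4 rfl rfl rfl hw.symm rfl (by omega) (by omega) (by omega) (by omega) (by omega) (by omega)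
      have p4 := M.C5 m3 m4 rfl rfl hw.symm rfl rfl (by omega) (by omega) (by omega) (by omega) (by omega) (by omega)
      have p5 := M.C5 m3 m4 rfl hw.symm rfl rfl rfl (by omega) (by omega) (by omega) (by omega) (by omega) (by omega)
      have p1 := M.C5 m3 m4 hw.symm rfl rfl rfl rfl (by omega) (by omega) (by omega) (by omega) (by omega) (by omega)
      exact ⟨M.rd_le p1 a2 a6, M.rd_le p2 b2 b6, M.rd_le p3 c2 c6, M.rd_le p4 d2 d6, 
        M.rd_le p5 e2 e6, trivial⟩

/-- Key peeling lemma. -/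
lemma key (m : ℕ) (hm : m = 3 ∨ m = 4 ∨ m = 5) (n3 : 4 ≤ m → M.Nn 3) (n4 : 5 ≤ m → M.Nn 4)
    (cs : List ℕ) (x : D) (h : M.RedC m (cs.map (· + 2)) x) :
    (cs.sum = 0 ∧ m = 5 ∧ M.N (M.f (M.a (M.R 1 x))) = 5 ∧ ∀ c ∈ cs, c = 0) ∨
    (m ≤ cs.sum ∧ (cs.sum = m → ∀ v vs, mg cs = v :: vs → 
      ∀ y, M.mirror.wk (v :: vs) y = y → M.mirror.RedC m (v :: vs) y)) := by
  have hc : ∀ c ∈ cs, c ≤ 2 := by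
    intro c hc
    have := M.Red_ge _ _ h.2.2 (c + 2) (List.mem_map.2 ⟨c, hc, rfl⟩)
    omega
  have hlen : cs.length = m := by simpa using h.1
  obtain ⟨o1, o2, o3, o4, o5, o6⟩ := okc_all cs hc (by omega)
  have hred : 3 ≤ cs.sum → cs.sum ≤ m → ∀ v vs, mg cs = v :: vs → 
      ∀ y, M.mirror.wk (v :: vs) y = y → M.mirror.RedC cs.sum (v :: vs) y := by
    intro s3 sm v vs hv y hy
    refine ⟨by rw [← hv]; exact o1, hy, ?_⟩
    rw [← hv] at hy ⊢
    have := o2 (by omega)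
    apply M.mirror.red_of_closed _ _ hy (by omega) o3 (o4 s3) (by omega)
    · intro _; exact M.Nn_mirror (n3 (by omega))
    · intro _; exact M.Nn_mirror (n4 (by omega))
  by_cases s0 : cs.sum = 0
  · left
    have := M.peel0 cs x h.2.1 (o5 s0)
    have hn := M.N56 (M.f (M.a (M.R 1 x)))
    refine ⟨s0, ?_, ?_, ?_⟩
    · rw [hlen] at this
      rcases hn with hn | hn <;> rw [hn] at this <;> push_cast at this <;> omega
    · rw [hlen] at this
      rcases hn with hn | hn <;> rw [hn] at this <;> push_cast at this <;> omega
    · exact List.sum_eq_zero_iff.1 s0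
  right
  obtain ⟨v, vs, hv⟩ : ∃ v vs, mg cs = v :: vs := by
    cases hmg : mg cs with
    | nil => rw [hmg] at o1; simp at o1; omega
    | cons v vs => exact ⟨v, vs, rfl⟩
  obtain ⟨y, q, u, hy, -⟩ := M.peel cs x h.2.1 hv
  refine ⟨?_, fun hs v vs hv y hy => ?_⟩
  · by_contra hlt
    push Not at hlt
    have o2' := o2 (by omega)
    by_cases s1 : cs.sum = 1
    · rw [hv] at o1
      match vs, o1 with
      | [], _ => exact M.mirror.C1 (x := y) hy
      | _ :: _, o => simp at o; omega
    by_cases s2 : cs.sum = 2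
    · rw [hv] at o1
      match vs, o1, hv, hy with
      | [], o, _, _ => simp at o; omega
      | [w], _, hv, hy =>
        simp only [wk] at hy
        have := M.mirror.C2 rfl hy.symm
        have q1 := M.N56 (M.f y)
        have q2 := M.N56 (M.mirror.f (M.mirror.a (M.mirror.R v y)))
        rw [hv] at o2' o3
        simp at o2' o3
        rcases q1 with q1 | q1 <;> rcases q2 with q2 | q2 <;> rw [mirror_N, mirror_f, q1] at this <;> 
          rw [← mirror_f, q2] at this <;> omega
      | _ :: _ :: _, o, _, _ => simp at o; omega
    have := hred (by omega) (by omega) v vs hv y hy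
    by_cases s3 : cs.sum = 3
    · rw [s3] at this; exact M.Nn_mirror (n3 (by omega)) _ _ this
    · have s4 : cs.sum = 4 := by omega
      rw [s4] at this; exact M.Nn_mirror (n4 (by omega)) _ _ this
  · have := hred (by omega) (by omega) v vs hv y hy
    rwa [hs] at this

end CMap
end

section
namespace CMap
variable {D Φ : Type*} (M : CMap D Φ)

lemma ns_append (l1 l2 : List ℕ) (x : D) : M.ns (l1 ++ l2) x = M.ns l1 x ++ M.ns l2 (M.wk l1 x) := by
  induction l1 generalizing x with
  | nil => rfl
  | cons t l ih => simp [ns, wk, ih]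

lemma ns_mem (ts : List ℕ) (x : D) : ∀ n ∈ M.ns ts x, n = 5 ∨ n = 6 := by
  induction ts generalizing x with
  | nil => simp [ns]
  | cons t ts ih =>
    intro n hn
    rcases List.mem_cons.1 hn with rfl | hn
    · exact M.N56 _
    · exact ih _ n hn

lemma ns_mirror (ts : List ℕ) (x : D) (h : M.Red ts x) : M.mirror.ns (M.mir ts x) x = M.ns ts x := by
  induction ts generalizing x with
  | nil => rfl
  | cons t ts ih =>
    obtain ⟨⟨h1, h2⟩, h3⟩ := h
    simp only [ns, mir, mirror_a]
    rw [M.mir_step (by omega), ih _ h3]; rfl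

lemma mir_all (ts : List ℕ) (x : D) (h : M.Red ts x) (n k : ℕ) (hn : ∀ u ∈ M.ns ts x, u = n)
    (hm : ∀ u ∈ M.mir ts x, u = k) : ∀ t ∈ ts, t = n - k := by
  induction ts generalizing x with
  | nil => simp
  | cons t ts ih =>
    obtain ⟨⟨h1, h2⟩, h3⟩ := h
    simp only [ns, mir, List.mem_cons, forall_eq_or_imp] at hn hm ⊢
    exact ⟨by omega, ih _ h3 hn.2 hm.2⟩

lemma sum_le_all (l : List ℕ) (b : ℕ) (h : ∀ u ∈ l, u ≤ b) (hs : b * l.length ≤ l.sum) : ∀ u ∈ l, u = b := by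
  induction l with
  | nil => simp
  | cons a l ih =>
    have hl : l.sum ≤ b * l.length := by
      have := List.sum_le_card_nsmul l b (fun u hu => h u (by simp [hu]))
      simpa [mul_comm] using this
    have ha := h a (by simp)
    simp only [List.sum_cons, List.length_cons, mul_add, mul_one] at hs
    intro u hu
    rcases List.mem_cons.1 hu with rfl | hu
    · omega
    · exact ih (fun u hu => h u (by simp [hu])) (by omega) u hu

lemma sum_ge_all (l : List ℕ) (b : ℕ) (h : ∀ u ∈ l, b ≤ u) (hs : l.sum ≤ b * l.length) : ∀ u ∈ l, u = b := by
  induction l with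
  | nil => simp
  | cons a l ih =>
    have hl : b * l.length ≤ l.sum := by
      have := List.card_nsmul_le_sum l b (fun u hu => h u (by simp [hu]))
      simpa [mul_comm] using this
    have ha := h a (by simp)
    simp only [List.sum_cons, List.length_cons, mul_add, mul_one] at hs
    intro u hu
    rcases List.mem_cons.1 hu with rfl | hu
    · omega
    · exact ih (fun u hu => h u (by simp [hu])) (by omega) u hu

lemma sum_const (l : List ℕ) (b : ℕ) (h : ∀ u ∈ l, u = b) : l.sum = b * l.length := by
  have := List.sum_eq_card_nsmul l b h
  simpa [mul_comm] using this

lemma key' (m : ℕ) (hm : m = 3 ∨ m = 4 ∨ m = 5) (n3 : 4 ≤ m → M.Nn 3) (n4 : 5 ≤ m → M.Nn 4)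
    (ts : List ℕ) (x : D) (h : M.RedC m ts x) :
    (m = 5 ∧ M.N (M.f (M.a (M.R 1 x))) = 5 ∧ ∀ t ∈ ts, t = 2) ∨ 3 * m ≤ ts.sum := by
  obtain ⟨cs, rfl, hc⟩ := exists_cs ts (M.Red_ge _ _ h.2.2)
  rcases M.key m hm n3 n4 cs x h with ⟨-, b, c, d⟩ | ⟨h1, -⟩
  · left; refine ⟨b, c, ?_⟩
    intro t ht
    obtain ⟨c, hc, rfl⟩ := List.mem_map.1 ht
    simp [d c hc]
  · right
    have hl : cs.length = m := by simpa using h.1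
    have : (cs.map (· + 2)).sum = cs.sum + 2 * cs.length := by
      rw [List.sum_map_add]; simp [mul_comm]
    omega

lemma tri (m : ℕ) (hm : m = 3 ∨ m = 4 ∨ m = 5) (n3 : 4 ≤ m → M.Nn 3) (n4 : 5 ≤ m → M.Nn 4)
    (ts : List ℕ) (x : D) (h : M.RedC m ts x) :
    (m = 5 ∧ M.N (M.f (M.a (M.R 1 x))) = 5 ∧ ∀ t ∈ ts, t = 2) ∨ 
    (m = 5 ∧ M.N (M.f (M.a (M.R (-1) x))) = 5 ∧ ∀ t ∈ M.mir ts x, t = 2) ∨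
    ((∀ n ∈ M.ns ts x, n = 6) ∧ ts.sum = 3 * m ∧ (M.mir ts x).sum = 3 * m) := by
  rcases M.key' m hm n3 n4 ts x h with h1 | h1
  · exact Or.inl h1
  have h' := RedC.mir _ h
  rcases M.mirror.key' m hm (fun a => M.Nn_mirror (n3 a)) (fun a => M.Nn_mirror (n4 a)) _ x h' with h2 | h2
  · right; left
    simpa [mirror_R] using h2
  right; right
  have hs := M.mir_sum ts x h.2.2
  have hl := M.ns_len ts x
  rw [h.1] at hl
  have h6 : ∀ n ∈ M.ns ts x, n ≤ 6 := fun n hn => by have := M.ns_mem ts x n hn; omega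
  have h6' := sum_le_all _ _ h6 (by omega)
  have := sum_const _ _ h6'
  exact ⟨h6', by omega, by omega⟩

def Good (m : ℕ) (ts : List ℕ) (x : D) : Prop := M.RedC m ts x ∧ (∀ n ∈ M.ns ts x, n = 6) ∧
  ts.sum = 3 * m ∧ (m = 5 → ¬ ∀ t ∈ ts, t = 3)

lemma Good.mir {m : ℕ} {ts : List ℕ} {x : D} (h : M.Good m ts x) : M.mirror.Good m (M.mir ts x) x := by
  obtain ⟨h1, h2, h3, h4⟩ := h
  refine ⟨RedC.mir _ h1, by rw [M.ns_mirror _ _ h1.2.2]; exact h2, ?_, ?_⟩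
  · have := M.mir_sum _ _ h1.2.2
    have e := sum_const _ _ h2
    rw [M.ns_len, h1.1] at e
    omega
  · intro m5 h
    exact h4 m5 (M.mir_all _ _ h1.2.2 6 3 h2 h)

lemma Good.rot {m t : ℕ} {ts : List ℕ} {x : D} (h : M.Good m (t :: ts) x) :
    M.Good m (ts ++ [t]) (M.a (M.R t x)) := by
  obtain ⟨h1, h2, h3, h4⟩ := h
  refine ⟨RedC.rot _ h1, ?_, ?_, ?_⟩
  · rw [ns_append]
    have := h1.2.1
    simp only [wk] at this
    rw [this]
    simp only [ns, List.mem_append, List.mem_cons, List.not_mem_nil, or_false] at h2 ⊢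
    intro n hn
    exact h2 n hn.symm
  · rw [← h3]; simp; ring
  · intro h5 h; apply h4 h5
    simp only [List.mem_append, List.mem_cons, List.not_mem_nil, or_false] at h ⊢
    exact fun t ht => h t ht.symm

lemma Good.rot' {m t : ℕ} {ts : List ℕ} {x : D} (h : M.Good m (ts ++ [t]) x) :
    M.Good m (t :: ts) (M.wk ts x) ∧ x = M.a (M.R t (M.wk ts x)) := by
  obtain ⟨h1, h2, h3, h4⟩ := h
  obtain ⟨g1, g2⟩ := RedC.rot' _ h1
  refine ⟨⟨g1, ?_, ?_, ?_⟩, g2⟩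
  · rw [ns_append] at h2
    simp only [ns, List.mem_append, List.mem_cons, List.not_mem_nil, or_false] at h2 ⊢
    rw [← g2]
    exact fun n hn => h2 n hn.symm
  · rw [← h3]; simp; ring
  · intro h5 h; apply h4 h5
    simp only [List.mem_append, List.mem_cons, List.not_mem_nil, or_false] at h ⊢
    exact fun t ht => h t ht.symm

lemma Good.peel {m : ℕ} (hm : m = 3 ∨ m = 4 ∨ m = 5) (n3 : 4 ≤ m → M.Nn 3) (n4 : 5 ≤ m → M.Nn 4)
    {cs : List ℕ} {x : D} (h : M.Good m (cs.map (· + 2)) x) :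
    ∃ v vs y, ∃ q u : ℕ, M.mirror.Good m (v :: vs) y ∧ 
      y = M.R q (M.a (M.R 1 x)) ∧ v = u + q ∧ (pl 0 cs).1 = u :: vs := by
  obtain ⟨h1, h2, h3, h4⟩ := h
  have hc : ∀ c ∈ cs, c ≤ 2 := by
    intro c hc
    have := M.Red_ge _ _ h1.2.2 (c + 2) (List.mem_map.2 ⟨c, hc, rfl⟩)
    omega
  have hlen : cs.length = m := by simpa using h1.1
  have hsum : (cs.map (· + 2)).sum = cs.sum + 2 * cs.length := by
      rw [List.sum_map_add]; simp [mul_comm]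
  obtain ⟨o1, o2, o3, o4, o5, o6⟩ := okc_all cs hc (by omega)
  obtain ⟨v, vs, hv⟩ : ∃ v vs, mg cs = v :: vs := by
    cases hmg : mg cs with
    | nil => rw [hmg] at o1; simp at o1; omega
    | cons v vs => exact ⟨v, vs, rfl⟩
  obtain ⟨y, q, u, hy, hy2, hy3, hy4⟩ := M.peel cs x h1.2.1 hv
  refine ⟨v, vs, y, q, u, ?_, hy2, hy3, hy4⟩
  rcases M.key m hm n3 n4 cs x h1 with h | ⟨-, hk⟩
  · omega
  have hr := hk (by omega) v vs hv y hy
  have s' := o2 (by omega)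
  rw [hv] at s'
  have n33 : m = 5 → ¬ ∀ t ∈ v :: vs, t = 3 := by
    intro h5 h33
    apply h4 h5
    intro t ht
    obtain ⟨c, hc, rfl⟩ := List.mem_map.1 ht
    have := o6 (by omega) (by rw [hv]; exact h33) c hc
    simp [this]
  rcases M.mirror.tri m hm (fun a => M.Nn_mirror (n3 a)) (fun a => M.Nn_mirror (n4 a)) _ _ hr with h | h | h
  · have := sum_const _ _ h.2.2
    rw [hr.1] at this
    omega
  · exfalso
    apply n33 h.1
    have e1 := sum_const _ _ h.2.2
    rw [mir_len, hr.1] at e1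
    have e2 := M.mirror.mir_sum _ _ hr.2.2
    have e3 : ∀ n ∈ M.mirror.ns (v :: vs) y, n = 5 := by
      apply sum_ge_all _ _ (fun n hn => by have := M.mirror.ns_mem _ _ n hn; omega)
      rw [ns_len, hr.1]; omega
    exact M.mirror.mir_all _ _ hr.2.2 5 2 e3 h.2.2
  · exact ⟨hr, h.1, h.2.1, n33⟩

lemma noGood {m : ℕ} (hm : m = 3 ∨ m = 4 ∨ m = 5) (n3 : 4 ≤ m → M.Nn 3) (n4 : 5 ≤ m → M.Nn 4)
    {ts : List ℕ} {x : D} (h : M.Good m ts x) : False := by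
  -- left closure
  have left : ∀ (M : CMap D Φ), (4 ≤ m → M.Nn 3) → (5 ≤ m → M.Nn 4) → ∀ ts x, M.Good m ts x → 
      ∃ t ts', ts = t :: ts' ∧ t ≤ 4 ∧
      (∃ ts' x', M.f x' = M.f (M.a x) ∧ M.Good m ts' x') ∧
      ∀ j : ℕ, 0 < j → j ≤ t → ∃ ts' x', M.f x' = M.f (M.a (M.R j x)) ∧ M.Good m ts' x' := by
    intro M n3 n4 ts x h
    have hl := h.1.1
    cases ts with
    | nil => simp at hl; omega
    | cons t ts =>
      have ht := M.Red_ge _ _ h.1.2.2 t (by simp)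
      refine ⟨t, ts, rfl, ht.2, ?_, ?_⟩
      · rcases List.eq_nil_or_concat (t :: ts) with h0 | ⟨l, u, hlu⟩
        · simp at h0
        · rw [hlu, List.concat_eq_append] at h
          obtain ⟨g1, g2⟩ := Good.rot' _ h
          refine ⟨_, _, ?_, g1⟩
          conv_rhs => rw [g2]
          rw [M.aa, fR]
      intro j j0 jt
      by_cases hjt : j = t
      · subst hjt
        exact ⟨_, _, rfl, Good.rot _ h⟩
      obtain ⟨cs, hcs, hc⟩ := exists_cs _ (M.Red_ge _ _ h.1.2.2)
      rw [hcs] at h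
      obtain ⟨v, vs, y, q, u, hg, hy, hv, hp⟩ := Good.peel _ hm n3 n4 h
      have mm : ∀ {ts y}, M.mirror.Good m ts y → ∃ ts', M.Good m ts' y := by
        intro ts y h
        have := Good.mir _ h
        rw [mirror_mirror] at this
        exact ⟨_, this⟩
      by_cases j1 : j = 1
      · subst j1
        obtain ⟨ts', h'⟩ := mm hg
        exact ⟨ts', y, by rw [hy, fR]; rfl, h'⟩
      cases cs with
      | nil => simp at hcs
      | cons c cs =>
        simp only [List.map_cons, List.cons.injEq] at hcs
        have hc0 : c ≠ 0 := by omega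
        simp only [pl, if_neg hc0, List.cons.injEq] at hp
        have hg1 := Good.rot _ hg
        have e : M.mirror.a (M.mirror.R v y) = M.R 1 (M.a (M.R 2 x)) := by
          rw [hy, mirror_R, mirror_a, R_add, show -(v:ℤ) + q = -1 by rw [hv, ← hp.1]; push_cast; ring,
            aran1, R_add]; norm_num
        rw [e] at hg1
        by_cases j2 : j = 2
        · subst j2
          obtain ⟨ts', h'⟩ := mm hg1
          exact ⟨ts', _, by rw [fR]; rfl, h'⟩
        have j3 : j = 3 := by omega
        subst j3
        have c2 : c = 2 := by omega
        subst c2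
        simp at hp
        rw [← hp.2] at hg1
        simp only [List.cons_append] at hg1
        have hg2 := Good.rot _ hg1
        obtain ⟨ts', h'⟩ := mm hg2
        refine ⟨ts', _, ?_, h'⟩
        rw [mirror_R, mirror_a, R_add, show -((2:ℕ):ℤ) + 1 = -1 by norm_num, aran1, R_add, fR]
        norm_num
  have hall := M.conn {F | ∃ ts x, M.f x = F ∧ M.Good m ts x} ⟨_, ts, x, rfl, h⟩ (by
    rintro d ⟨ts, x, hx, hg⟩
    obtain ⟨t, ts', rfl, ht4, hl0, hlj⟩ := left M n3 n4 ts x hg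
    have hN : M.N (M.f x) = 6 := hg.2.1 _ (by simp [ns])
    have hr := hg.1.2.2
    simp only [Red] at hr
    obtain ⟨k, hk⟩ := M.trans x d hx
    have hd : d = M.R (k % 6).toNat x := by
      rw [← hk]; apply M.R_cong; rw [hN]; push_cast; omega
    set j := (k % 6).toNat with hj
    have j6 : j < 6 := by omega
    by_cases j0 : j = 0
    · rw [j0] at hd
      simp [R_zero] at hd
      obtain ⟨ts, x', h1, h2⟩ := hl0
      exact ⟨ts, x', by rw [h1, hd], h2⟩
    by_cases jt : j ≤ t
    · obtain ⟨ts, x', h1, h2⟩ := hlj j (by omega) jt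
      exact ⟨ts, x', by rw [h1, hd], h2⟩
    -- mirror
    have hg' := Good.mir _ hg
    obtain ⟨t', ts'', e, -, -, hlj'⟩ := left M.mirror (fun a => M.Nn_mirror (n3 a)) (fun a => M.Nn_mirror (n4 a)) _ x hg'
    simp only [mir, List.cons.injEq, hN] at e
    obtain ⟨ts, x', h1, h2⟩ := hlj' (6 - j) (by omega) (by omega)
    have h3 := Good.mir _ h2
    rw [mirror_mirror] at h3
    refine ⟨_, x', ?_, h3⟩
    have h1' : M.f x' = M.f (M.a (M.R (-((6 - j : ℕ) : ℤ)) x)) := by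
      rw [← mirror_R]; exact h1
    rw [h1', hd]
    congr 2
    apply M.R_cong; rw [hN]; push_cast; omega)
  obtain ⟨F, hF⟩ := M.pent
  obtain ⟨ts, x, rfl, hg⟩ := hall F
  have hl := hg.1.1
  cases ts with
  | nil => simp at hl; omega
  | cons t ts =>
    have : M.N (M.f x) = 6 := hg.2.1 _ (by simp [ns])
    omega

lemma Nn3 : M.Nn 3 := by
  intro ts x h
  have n3 : 4 ≤ 3 → M.Nn 3 := by omega
  have n4 : 5 ≤ 3 → M.Nn 4 := by omega
  rcases M.tri 3 (by omega) n3 n4 ts x h with h1 | h1 | h1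
  · omega
  · omega
  · exact M.noGood (by omega) n3 n4 ⟨h, h1.1, h1.2.1, by omega⟩

lemma Nn4 : M.Nn 4 := by
  intro ts x h
  have n3 : 4 ≤ 4 → M.Nn 3 := fun _ => M.Nn3
  have n4 : 5 ≤ 4 → M.Nn 4 := by omega
  rcases M.tri 4 (by omega) n3 n4 ts x h with h1 | h1 | h1
  · omega
  · omega
  · exact M.noGood (by omega) n3 n4 ⟨h, h1.1, h1.2.1, by omega⟩

lemma five (ts : List ℕ) (x : D) (h : M.RedC 5 ts x) :
    (M.N (M.f (M.a (M.R 1 x))) = 5 ∧ ∀ t ∈ ts, t = 2) ∨ 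
    (M.N (M.f (M.a (M.R (-1) x))) = 5 ∧ ∀ t ∈ M.mir ts x, t = 2) ∨
    ((∀ n ∈ M.ns ts x, n = 6) ∧ ∀ t ∈ ts, t = 3) := by
  have n3 : 4 ≤ 5 → M.Nn 3 := fun _ => M.Nn3
  have n4 : 5 ≤ 5 → M.Nn 4 := fun _ => M.Nn4
  rcases M.tri 5 (by omega) n3 n4 ts x h with h1 | h1 | h1
  · exact Or.inl h1.2
  · exact Or.inr (Or.inl h1.2)
  · right; right
    refine ⟨h1.1, ?_⟩
    by_contra hc
    exact M.noGood (by omega) n3 n4 ⟨h, h1.1, h1.2.1, fun _ => hc⟩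

end CMap
end

section
namespace CMap
variable {D Φ : Type*} (M : CMap D Φ)

def Adj (F G : Φ) : Prop := ∃ d, M.f d = F ∧ M.f (M.a d) = G

lemma Adj.symm {F G : Φ} (h : M.Adj F G) : M.Adj G F := by
  obtain ⟨d, h1, h2⟩ := h
  exact ⟨M.a d, h2, by rw [M.aa, h1]⟩

lemma Adj.ne {F G : Φ} (h : M.Adj F G) : F ≠ G := by
  obtain ⟨d, rfl, rfl⟩ := h
  exact (M.ne d).symm

lemma adj3 {d : D} {t : ℤ} (h : M.Adj (M.f (M.a d)) (M.f (M.a (M.R t d)))) :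
    (M.N (M.f d) : ℤ) ∣ t - 1 ∨ (M.N (M.f d) : ℤ) ∣ t + 1 := by
  obtain ⟨e, h1, h2⟩ := h
  obtain ⟨t2, ht2⟩ := M.trans (M.a (M.R t d)) (M.a e) h2.symm
  obtain ⟨t3, ht3⟩ := M.trans e (M.a d) h1
  have e2 : e = M.a (M.R t2 (M.a (M.R t d))) := by
    have : M.R t2 (M.a (M.R t d)) = M.a e := ht2
    rw [this, M.aa]
  have e3 : d = M.a (M.R t3 e) := by
    have : M.R t3 e = M.a d := ht3
    rw [this, M.aa]
  have := (M.C3 rfl e2 e3)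
  have hn := M.No3_of M.Nn3 rfl e2 e3
  tauto

lemma adj_one (d : D) : M.Adj (M.f (M.a d)) (M.f (M.a (M.R 1 d))) :=
  ⟨M.R (-1) (M.a d), by rw [fR], by rw [aran1, fR]⟩

lemma eq_iff {d : D} {t : ℤ} (h : M.f (M.a d) = M.f (M.a (M.R t d))) : (M.N (M.f d) : ℤ) ∣ t := by
  have := M.uniq d (M.R t d) (by rw [fR]) h
  exact M.R_self.1 this.symm

def AbsBelt (B : Fin 5 → Φ) : Prop :=
  ∀ j, M.Adj (B j) (B (j + 1)) ∧ B j ≠ B (j + 2) ∧ ¬ M.Adj (B j) (B (j + 2))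

/-- Reduced pieces of walks. -/
lemma rd_piece {x1 x2 x3 : D} {t1 t2 : ℤ} (h1 : x2 = M.a (M.R t1 x1)) (h2 : x3 = M.a (M.R t2 x2))
    (h : M.rd x2 t2) : M.Adj (M.f x1) (M.f x2) ∧ M.f x1 ≠ M.f x3 ∧ ¬ M.Adj (M.f x1) (M.f x3) := by
  have e1 : M.f x1 = M.f (M.a x2) := by rw [h1, M.aa, fR]
  refine ⟨⟨M.a x2, e1.symm, by rw [M.aa]⟩, ?_, ?_⟩
  · intro h3
    rw [e1, h2] at h3
    exact h.1 (M.eq_iff h3)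
  · intro h3
    rw [e1, h2] at h3
    rcases M.adj3 h3 with h4 | h4
    · exact h.2.1 h4
    · exact h.2.2 h4

lemma belt_of_walk (x : Fin 5 → D) (t : Fin 5 → ℤ) (h : ∀ j, x (j + 1) = M.a (M.R (t j) (x j)))
    (hr : ∀ j, M.rd (x j) (t j)) : M.AbsBelt (fun j => M.f (x j)) := by
  intro j
  have h2 := h (j + 1)
  have := M.rd_piece (h j) h2 (hr _)
  rwa [show j + 1 + 1 = j + 2 by rw [add_assoc]; rfl] at this

lemma belt_walk {B : Fin 5 → Φ} (hB : M.AbsBelt B) : ∃ (x : Fin 5 → D) (t : Fin 5 → ℕ),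
    (∀ j, M.f (x j) = B j) ∧ (∀ j, x (j + 1) = M.a (M.R (t j) (x j))) ∧ 
    (∀ j, 2 ≤ t j ∧ t j + 2 ≤ M.N (B j)) := by
  have hx : ∀ j : Fin 5, ∃ x, M.f x = B j ∧ M.f (M.a x) = B (j - 1) := by
    intro j
    have := (hB (j - 1)).1
    rw [sub_add_cancel] at this
    exact this.symm
  choose x hx1 hx2 using hx
  have ht : ∀ j : Fin 5, ∃ t : ℕ, M.R t (x j) = M.a (x (j + 1)) ∧ 2 ≤ t ∧ t + 2 ≤ M.N (B j) := by
    intro j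
    have e : M.f (x j) = M.f (M.a (x (j + 1))) := by
      rw [hx1, hx2, add_sub_cancel_right]
    obtain ⟨t, ht⟩ := M.trans _ _ e
    have ht : M.R t (x j) = M.a (x (j + 1)) := ht
    have b := hB (j - 1)
    rw [show j - 1 + 2 = j + 1 by clear * -; revert j; decide, ← hx2 j, ← hx1 (j + 1), ← M.aa (x (j + 1)), ← ht] at b
    have hrd : M.rd (x j) t := by
      refine ⟨fun h => b.2.1 ?_, fun h => b.2.2 ?_, fun h => b.2.2 ?_⟩
      · rw [M.R_self.2 h]
      · rw [M.R_cong h]; exact M.adj_one _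
      · rw [M.R_cong (i := t) (j := -1) (by simpa using h)]
        have := M.adj_one (M.R (-1) (x j))
        rw [R_add] at this; norm_num [R_zero] at this
        exact this.symm
    obtain ⟨u, h1, h2, h3⟩ := M.rd_nat hrd
    exact ⟨u, by rw [h3, ht], h1, by rwa [← hx1]⟩
  choose t ht1 ht2 using ht
  exact ⟨x, t, hx1, fun j => by rw [ht1, M.aa], ht2⟩

lemma belt_class {B : Fin 5 → Φ} (hB : M.AbsBelt B) : 
    (∃ d, M.N (M.f d) = 5 ∧ ((∀ j : Fin 5, B j = M.f (M.a (M.R ((j : ℕ) : ℤ) d))) ∨ 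
      (∀ j : Fin 5, B j = M.f (M.a (M.R (-((j : ℕ) : ℤ)) d))))) ∨
    (∃ x : Fin 5 → D, ∀ j, M.f (x j) = B j ∧ x (j + 1) = M.a (M.R 3 (x j)) ∧ M.N (B j) = 6) := by
  obtain ⟨x, t, hx, hw, ht⟩ := M.belt_walk hB
  have e1 : x 1 = _ := hw 0
  have e2 : x 2 = _ := hw 1
  have e3 : x 3 = _ := hw 2
  have e4 : x 4 = _ := hw 3
  have e5 : x 0 = _ := hw 4
  have hr : M.RedC 5 [t 0, t 1, t 2, t 3, t 4] (x 0) := by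
    refine ⟨rfl, ?_, ?_⟩
    · simp only [wk]; rw [← e1, ← e2, ← e3, ← e4, ← e5]
    · simp only [Red]; rw [← e1, ← e2, ← e3, ← e4]
      simp only [hx]
      exact ⟨ht 0, ht 1, ht 2, ht 3, ht 4, trivial⟩
  rcases M.five _ _ hr with ⟨h1, h2⟩ | ⟨h1, h2⟩ | ⟨h1, h2⟩
  · left
    refine ⟨_, h1, Or.inr ?_⟩
    simp only [List.mem_cons, List.not_mem_nil, or_false, forall_eq_or_imp, forall_eq] at h2
    obtain ⟨t0, t1, t2, t3, t4⟩ := h2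
    rw [t0] at e1; rw [t1] at e2; rw [t2] at e3; rw [t3] at e4; 
    have st : ∀ y z, z = M.a (M.R ((2:ℕ):ℤ) y) → M.a (M.R 1 z) = M.R (-1) (M.a (M.R 1 y)) := by
      rintro y z rfl
      rw [ara1, R_add]; norm_num
    have s1 := st _ _ e1
    have s2 := st _ _ e2
    have s3 := st _ _ e3
    have s4 := st _ _ e4
    rw [s1, R_add] at s2
    rw [s2, R_add] at s3
    rw [s3, R_add] at s4
    norm_num at s2 s3 s4
    have k : ∀ j, B j = M.f (M.a (M.a (M.R 1 (x j)))) := by intro j; rw [M.aa, fR, hx]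
    intro j
    rw [k j]
    fin_cases j
    · simp [R_zero]
    · simp [s1]
    · simp [s2]
    · simp [s3]
    · simp [s4]
  · left
    refine ⟨_, h1, Or.inl ?_⟩
    simp only [mir, List.mem_cons, List.not_mem_nil, or_false, forall_eq_or_imp, forall_eq] at h2
    rw [← e1, ← e2, ← e3, ← e4] at h2
    simp only [hx] at h2
    obtain ⟨t0, t1, t2, t3, t4⟩ := h2
    have st : ∀ j, M.N (B j) - t j = 2 → M.a (M.R (-1) (x (j + 1))) = M.R 1 (M.a (M.R (-1) (x j))) := by
      intro j h
      have := ht j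
      rw [hw j, aran1, R_add]
      rw [M.R_cong (j := -1) (x := x j)]
      rw [hx, show M.N (B j) = t j + 2 by omega]; push_cast
      exact ⟨1, by ring⟩
    have s1 := st _ t0
    have s2 := st _ t1
    have s3 := st _ t2
    have s4 := st _ t3
    norm_num at s1 s2 s3 s4
    rw [s1, R_add] at s2
    rw [show (1 : Fin 5) + 1 = 2 by rfl] at s2
    rw [show (2 : Fin 5) + 1 = 3 by rfl, s2, R_add] at s3
    rw [show (3 : Fin 5) + 1 = 4 by rfl, s3, R_add] at s4
    norm_num at s2 s3 s4
    have k : ∀ j, B j = M.f (M.a (M.a (M.R (-1) (x j)))) := by intro j; rw [M.aa, fR, hx]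
    intro j
    rw [k j]
    fin_cases j
    · simp [R_zero]
    · simp [s1]
    · simp [s2]
    · simp [s3]
    · simp [s4]
  · right
    refine ⟨x, fun j => ⟨hx j, ?_, ?_⟩⟩
    · have : t j = 3 := by apply h2; fin_cases j <;> simp
      rw [hw j, this]; rfl
    · apply h1; simp only [ns]; rw [← e1, ← e2, ← e3, ← e4]; simp only [hx]; fin_cases j <;> simp

lemma pent_belt {d : D} (h : M.N (M.f d) = 5) : 
    M.AbsBelt (fun j : Fin 5 => M.f (M.a (M.R ((j : ℕ) : ℤ) d))) := by
  intro j
  have h1 : M.Adj (M.f (M.a (M.R ((j : ℕ) : ℤ) d))) (M.f (M.a (M.R (((j + 1 : Fin 5) : ℕ) : ℤ) d))) := by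
    have := M.adj_one (M.R ((j : ℕ) : ℤ) d)
    rw [R_add] at this
    rwa [M.R_cong (i := 1 + ((j : ℕ) : ℤ)) (j := (((j + 1 : Fin 5) : ℕ) : ℤ))] at this
    rw [h]; fin_cases j <;> norm_num [Fin.val_add]
  have e : M.R (((j + 2 : Fin 5) : ℕ) : ℤ) d = M.R 2 (M.R ((j : ℕ) : ℤ) d) := by
    rw [R_add]; apply M.R_cong
    rw [h]; fin_cases j <;> norm_num [Fin.val_add]
  refine ⟨h1, ?_, ?_⟩
  · simp only [e]
    intro h2
    have := M.eq_iff h2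
    rw [fR, h] at this; norm_num at this
  · simp only [e]
    intro h2
    have := M.adj3 h2
    rw [fR, h] at this; norm_num at this

end CMap
end

section
namespace CMap
variable {D Φ : Type*} (M : CMap D Φ)

def aP : Equiv.Perm D := ⟨M.a, M.a, M.aa, M.aa⟩
def lam : Equiv.Perm D := M.r * M.aP * M.r ^ 2
def rho : Equiv.Perm D := M.aP * M.r ^ 3

lemma lam_apply (x : D) : M.lam x = M.R 1 (M.a (M.R 2 x)) := by
  simp [lam, R, aP]
lemma rho_apply (x : D) : M.rho x = M.a (M.R 3 x) := by
  simp [rho, R, aP]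

lemma lam_rho {x y z : D} (hy : y = M.a (M.R 3 x)) (hz : z = M.R 1 (M.a (M.R 2 x))) :
    M.R 1 (M.a (M.R 2 y)) = M.a (M.R (-3) z) := by
  subst hy hz
  have e1 : M.R 2 (M.a (M.R 3 x)) = M.R 1 (M.R 1 (M.a (M.R 3 x))) := by rw [R_add]; norm_num
  have e2 : M.R 1 (M.a (M.R 3 x)) = M.a (M.R (-1) (M.a (M.R 2 x))) := by
    rw [aran1, R_add]; norm_num
  rw [e1, e2, ara1, R_add, R_add, R_add]; norm_num [R_zero]

lemma nb_prev {z w : D} (t : ℤ) (h : z = M.a (M.R t w)) : M.f (M.a z) = M.f w := by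
  rw [h, M.aa, fR]
lemma nb_up {z w : D} (h : z = M.a (M.R 3 w)) : M.f (M.a (M.R 1 z)) = M.f (M.a (M.R 2 w)) := by
  rw [h, ara1, R_add, fR]; norm_num
lemma nb_down {z w : D} (h : z = M.R 1 (M.a (M.R 2 w))) : M.f (M.a (M.R (-1) z)) = M.f w := by
  rw [h, R_add]; norm_num [R_zero, M.aa, fR]
lemma nb_down2 {z w : D} (h : z = M.R 1 (M.a (M.R 2 w))) :
    M.f (M.a (M.R (-2) z)) = M.f (M.a (M.R 3 w)) := by
  rw [h, R_add]; norm_num; rw [aran1, R_add, fR]; norm_num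

lemma per5 {y : ℤ → D} (hp : ∀ j, y (j + 5) = y j) (k j : ℤ) : y (j + 5 * k) = y j := by
  induction k using Int.induction_on with
  | zero => simp
  | succ i ih => rw [show j + 5*((i:ℤ)+1) = (j+5*i)+5 by ring, hp, ih]
  | pred i ih =>
    have := hp (j + 5*(-(i:ℤ)-1))
    rw [show j + 5*(-(i:ℤ)-1) + 5 = j+5*(-i) by ring] at this
    rw [← this, ih]

lemma per5' {y : ℤ → D} (hp : ∀ j, y (j + 5) = y j) {i j : ℤ} (h : (5 : ℤ) ∣ i - j) : y i = y j := by
  obtain ⟨k, hk⟩ := h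
  rw [show i = j + 5 * k by omega, per5 hp]

lemma dich {y : ℤ → D} (hw : ∀ j, y (j + 1) = M.a (M.R (-3) (y j))) (hp : ∀ j, y (j + 5) = y j) :
    (∀ j, M.N (M.f (y j)) = 6) ∨ (∀ j, M.N (M.f (y j)) = 5 ∧ 
      M.a (M.R 1 (y j)) = M.R (-j) (M.a (M.R 1 (y 0))) ∧ M.N (M.f (M.a (M.R 1 (y 0)))) = 5) := by
  have e1 := hw 0
  have e2 := hw 1
  have e3 := hw 2
  have e4 := hw 3
  have e5 := hw 4
  norm_num at e1 e2 e3 e4 e5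
  have e6 := hp 0
  norm_num at e6
  rw [e6] at e5
  have k : ∀ z, M.mirror.R ((3 : ℕ) : ℤ) z = M.R (-3) z := by intro z; rw [mirror_R]; norm_num
  have hr : M.mirror.RedC 5 [3, 3, 3, 3, 3] (y 0) := by
    refine ⟨rfl, ?_, ?_⟩
    · simp only [wk, mirror_a, k]; rw [← e1, ← e2, ← e3, ← e4, ← e5]
    · simp only [Red, mirror_a, k, mirror_N, mirror_f]
      have := fun z => M.N56 (M.f z)
      refine ⟨⟨by norm_num, ?_⟩, ⟨by norm_num, ?_⟩, ⟨by norm_num, ?_⟩, ⟨by norm_num, ?_⟩, ⟨by norm_num, ?_⟩, trivial⟩ <;>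
      · clear * - this
        rcases this _ with h | h <;> rw [h] <;> norm_num
  have cyc : ∀ Q : ℤ → Prop, Q 0 → Q 1 → Q 2 → Q 3 → Q 4 → (∀ i j, (5:ℤ) ∣ i - j → Q i → Q j) → ∀ j, Q j := by
    intro Q q0 q1 q2 q3 q4 hq j
    have : j % 5 = 0 ∨ j % 5 = 1 ∨ j % 5 = 2 ∨ j % 5 = 3 ∨ j % 5 = 4 := by omega
    rcases this with h | h | h | h | h
    · exact hq 0 j (by omega) q0
    · exact hq 1 j (by omega) q1
    · exact hq 2 j (by omega) q2
    · exact hq 3 j (by omega) q3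
    · exact hq 4 j (by omega) q4
  rcases M.mirror.five _ _ hr with ⟨h1, h2⟩ | ⟨h1, h2⟩ | ⟨h1, h2⟩
  · simp at h2
  · right
    simp only [mir, List.mem_cons, List.not_mem_nil, or_false, forall_eq_or_imp, forall_eq, mirror_a, k, mirror_N, mirror_f] at h2
    rw [← e1, ← e2, ← e3, ← e4] at h2
    obtain ⟨a0, a1, a2, a3, a4⟩ := h2
    have h5 : ∀ j, M.N (M.f (y j)) = 5 := by
      apply cyc (fun j => M.N (M.f (y j)) = 5) (by omega) (by omega) (by omega) (by omega) (by omega)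
      intro i j hij h
      rwa [← per5' hp hij]
    have st : ∀ j, M.a (M.R 1 (y (j + 1))) = M.R (-1) (M.a (M.R 1 (y j))) := by
      intro j
      rw [hw j, ara1, R_add]
      congr 2; apply M.R_cong; rw [h5]; norm_num
    rw [mirror_R] at h1
    norm_num at h1
    intro j
    refine ⟨h5 j, ?_, h1⟩
    induction j using Int.induction_on with
    | zero => simp [R_zero]
    | succ i ih => rw [st, ih, R_add]; congr 1; ring
    | pred i ih =>
      have := st (-(i:ℤ) - 1)
      rw [sub_add_cancel, ih] at this
      apply M.R_inj (i := -1)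
      rw [← this, R_add]; congr 1; ring
  · left
    simp only [ns, List.mem_cons, List.not_mem_nil, or_false, forall_eq_or_imp, forall_eq, mirror_a, k, mirror_N, mirror_f] at h1
    rw [← e1, ← e2, ← e3, ← e4] at h1
    obtain ⟨a0, a1, a2, a3, a4⟩ := h1
    apply cyc (fun j => M.N (M.f (y j)) = 6) a0 a1 a2 a3 a4
    intro i j hij h
    rwa [← per5' hp hij]

lemma step {x y : ℤ → D} (hw : ∀ j, x (j + 1) = M.a (M.R 3 (x j))) (hp : ∀ j, x (j + 5) = x j)
    (hy : ∀ j, y j = M.R 1 (M.a (M.R 2 (x j)))) : 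
    (∀ j, y (j + 1) = M.a (M.R (-3) (y j))) ∧ (∀ j, y (j + 5) = y j) := by
  refine ⟨fun j => ?_, fun j => ?_⟩
  · rw [hy (j + 1)]
    exact M.lam_rho (hw j) (hy j)
  · rw [hy, hy, hp]

/-- A pentagon all of whose neighbours are pentagons. -/
def IsCap (F : Φ) : Prop := M.N F = 5 ∧ ∀ G, M.Adj F G → M.N G = 5

lemma cap_of_tube [Finite D] {x0 : ℤ → D} (hw : ∀ j, x0 (j + 1) = M.a (M.R 3 (x0 j)))
    (hp : ∀ j, x0 (j + 5) = x0 j) (h6 : ∀ j, M.N (M.f (x0 j)) = 6) : ∃ F, M.IsCap F := by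
  by_contra hno
  let y : ℕ → ℤ → D := fun i j => (M.lam ^ i) (x0 j)
  have hl : ∀ i j, y (i + 1) j = M.R 1 (M.a (M.R 2 (y i j))) := by
    intro i j
    simp only [y]
    rw [pow_succ', Equiv.Perm.mul_apply, lam_apply]
  have P : ∀ i, (∀ j, y i (j + 1) = M.a (M.R 3 (y i j))) ∧ (∀ j, y i (j + 5) = y i j) ∧ 
      ∀ j, M.N (M.f (y i j)) = 6 := by
    intro i
    induction i with
    | zero => exact ⟨hw, hp, h6⟩
    | succ i ih =>
      obtain ⟨s1, s2⟩ := M.step ih.1 ih.2.1 (hl i)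
      rcases M.dich s1 s2 with h | h
      · refine ⟨fun j => ?_, s2, h⟩
        rw [s1]; congr 1; apply M.R_cong; rw [h]; norm_num
      · exfalso
        apply hno
        refine ⟨M.f (M.a (M.R 1 (y (i + 1) 0))), (h 0).2.2, ?_⟩
        rintro G ⟨d, hd, rfl⟩
        obtain ⟨k, hk⟩ := M.trans _ _ hd.symm
        have hk : M.R k _ = d := hk
        have := (h (-k)).2.1
        rw [neg_neg, hk] at this
        rw [← this, M.aa, fR]
        exact (h _).1
  obtain ⟨n, hn0, hn⟩ : ∃ n, 0 < n ∧ M.lam ^ n = 1 := ⟨orderOf M.lam, orderOf_pos _, pow_orderOf_eq_one _⟩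
  have hinv : ∀ i j, y i j = M.R 1 (M.a (M.R 2 (y (i + n - 1) j))) := by
    intro i j
    rw [← hl, show i + n - 1 + 1 = i + n by omega]
    simp only [y, pow_add, hn, mul_one]
  have := M.conn {F | ∃ i j, M.f (y i j) = F} ⟨_, 0, 0, rfl⟩ (by
    rintro d ⟨i, j, hd⟩
    obtain ⟨k, hk⟩ := M.trans _ _ hd
    have hk : M.R k (y i j) = d := hk
    have hN := (P i).2.2 j
    have hz := (P i).1 (j - 1)
    rw [sub_add_cancel] at hz
    have hm : k % 6 = 0 ∨ k % 6 = 1 ∨ k % 6 = 2 ∨ k % 6 = 3 ∨ k % 6 = 4 ∨ k % 6 = 5 := by omega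
    have cg : ∀ l : ℤ, (6 : ℤ) ∣ k - l → d = M.R l (y i j) := by
      intro l hl; rw [← hk]; apply M.R_cong; rw [hN]; exact_mod_cast hl
    rcases hm with h | h | h | h | h | h
    · rw [cg 0 (by omega), R_zero]; exact ⟨i, j - 1, (M.nb_prev 3 hz).symm⟩
    · rw [cg 1 (by omega)]; exact ⟨i + 1, j - 1, by rw [M.nb_up hz, hl, fR]⟩
    · rw [cg 2 (by omega)]; exact ⟨i + 1, j, by rw [hl, fR]⟩
    · rw [cg 3 (by omega)]; exact ⟨i, j + 1, by rw [(P i).1]⟩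
    · rw [cg (-2) (by omega)]
      refine ⟨i + n - 1, j + 1, ?_⟩
      rw [(P _).1, M.nb_down2 (hinv i j)]
    · rw [cg (-1) (by omega)]
      refine ⟨i + n - 1, j, ?_⟩
      rw [M.nb_down (hinv i j)])
  obtain ⟨F, hF⟩ := M.pent
  obtain ⟨i, j, rfl⟩ := this F
  rw [(P i).2.2] at hF; omega

structure Tube where
  x : ℕ → ℤ → D
  K : ℕ
  e0 : D
  e1 : D
  hK : 1 ≤ K
  n0 : M.N (M.f e0) = 5
  n1 : M.N (M.f e1) = 5
  per : ∀ i ≤ K, ∀ j, x i (j + 5) = x i j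
  rho : ∀ i < K, ∀ j, x i (j + 1) = M.a (M.R 3 (x i j))
  rho' : ∀ j, x K (j + 1) = M.a (M.R (-3) (x K j))
  lam : ∀ i j, x (i + 1) j = M.R 1 (M.a (M.R 2 (x i j)))
  N0 : ∀ j, M.N (M.f (x 0 j)) = 5
  NK : ∀ j, M.N (M.f (x K j)) = 5
  N6 : ∀ i, 1 ≤ i → i < K → ∀ j, M.N (M.f (x i j)) = 6
  cap0 : ∀ j, x 0 j = M.R 1 (M.a (M.R j e0))
  capK : ∀ j, M.a (M.R 1 (x K j)) = M.R (-j) e1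

lemma tube_of_cap [Finite D] {F : Φ} (h : M.IsCap F) : ∃ T : M.Tube, M.f T.e0 = F := by
  obtain ⟨e, rfl⟩ := M.surj F
  obtain ⟨hN, hA⟩ := h
  let x : ℕ → ℤ → D := fun i j => (M.lam ^ i) (M.R 1 (M.a (M.R j e)))
  have hl : ∀ i j, x (i + 1) j = M.R 1 (M.a (M.R 2 (x i j))) := by
    intro i j
    simp only [x]
    rw [pow_succ', Equiv.Perm.mul_apply, lam_apply]
  have h0 : ∀ j, x 0 j = M.R 1 (M.a (M.R j e)) := fun j => rfl
  have hN0 : ∀ j, M.N (M.f (x 0 j)) = 5 := by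
    intro j; rw [h0, fR]; exact hA _ ⟨M.R j e, by rw [fR], rfl⟩
  have hp0 : ∀ j, x 0 (j + 5) = x 0 j := by
    intro j; rw [h0, h0, M.R_cong (i := j + 5) (j := j)]; rw [hN]; norm_num
  have hw0 : ∀ j, x 0 (j + 1) = M.a (M.R 3 (x 0 j)) := by
    intro j
    have e1 : M.R 3 (x 0 j) = M.R (-2) (x 0 j) := by
      apply M.R_cong; rw [hN0]; norm_num
    rw [e1, h0 j, R_add, h0]; norm_num; rw [aran1, R_add, add_comm]
  have hex : ∃ i, 1 ≤ i ∧ M.N (M.f (x i 0)) = 5 := by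
    refine ⟨orderOf M.lam, orderOf_pos _, ?_⟩
    simp only [x, pow_orderOf_eq_one]
    exact hN0 0
  classical
  set K := Nat.find hex with hKdef
  obtain ⟨hK1, hK2⟩ := Nat.find_spec hex
  have hlt : ∀ i, 1 ≤ i → i < K → M.N (M.f (x i 0)) ≠ 5 := by
    intro i h1 h2 h3
    exact Nat.find_min hex h2 ⟨h1, h3⟩
  have P : ∀ i, i < K → (∀ j, x i (j + 1) = M.a (M.R 3 (x i j))) ∧ (∀ j, x i (j + 5) = x i j) ∧ 
      (1 ≤ i → ∀ j, M.N (M.f (x i j)) = 6) := by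
    intro i
    induction i with
    | zero => intro _; exact ⟨hw0, hp0, by omega⟩
    | succ i ih =>
      intro hi
      have ih := ih (by omega)
      obtain ⟨s1, s2⟩ := M.step ih.1 ih.2.1 (hl i)
      rcases M.dich s1 s2 with h | h
      · refine ⟨fun j => ?_, s2, fun _ => h⟩
        rw [s1]; congr 1; apply M.R_cong; rw [h]; norm_num
      · exact absurd (h 0).1 (hlt _ (by omega) hi)
  have ih := P (K - 1) (by omega)
  have hl' := hl (K - 1)
  rw [show K - 1 + 1 = K by omega] at hl'
  obtain ⟨s1, s2⟩ := M.step ih.1 ih.2.1 hl'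
  rcases M.dich s1 s2 with h | h
  · exact absurd hK2 (by rw [← hKdef, h 0]; norm_num)
  refine ⟨{ x := x, K := K, e0 := e, e1 := M.a (M.R 1 (x K 0)), hK := hK1, n0 := hN, n1 := (h 0).2.2,
            per := ?_, rho := fun i hi => (P i hi).1, rho' := s1, lam := hl, N0 := hN0, 
            NK := fun j => (h j).1, N6 := fun i h1 h2 => (P i h2).2.2 h1, cap0 := h0, 
            capK := fun j => (h j).2.1 }, rfl⟩
  intro i hi
  rcases hi.lt_or_eq with h1 | h1
  · exact (P i h1).2.1
  · rw [h1]; exact s2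

end CMap
end

section
namespace CMap
variable {D Φ : Type*} (M : CMap D Φ)

/-- Two neighbours of the same facet coincide only when the turning numbers agree. -/
lemma eq_iff' {d : D} {s t : ℤ} (h : M.f (M.a (M.R s d)) = M.f (M.a (M.R t d))) :
    (M.N (M.f d) : ℤ) ∣ t - s := by
  have := M.eq_iff (d := M.R s d) (t := t - s) (by rw [R_add, show t - s + s = t by ring]; exact h)
  rwa [fR] at this

lemma adj3' {d : D} {s t : ℤ} (h : M.Adj (M.f (M.a (M.R s d))) (M.f (M.a (M.R t d)))) :
    (M.N (M.f d) : ℤ) ∣ t - s - 1 ∨ (M.N (M.f d) : ℤ) ∣ t - s + 1 := by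
  have := M.adj3 (d := M.R s d) (t := t - s) (by rw [R_add, show t - s + s = t by ring]; exact h)
  rwa [fR] at this

lemma adj_dart {d : D} {G : Φ} (h : M.Adj (M.f d) G) : ∃ t, G = M.f (M.a (M.R t d)) := by
  obtain ⟨e, h1, h2⟩ := h
  obtain ⟨k, hk⟩ := M.trans d e h1.symm
  exact ⟨k, by rw [← h2]; congr 2; exact hk.symm⟩

lemma adj_R (d : D) (t : ℤ) : M.Adj (M.f d) (M.f (M.a (M.R t d))) := ⟨M.R t d, by rw [fR], rfl⟩

namespace Tube
variable {M} (T : M.Tube)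

/-- The facet number `j` of the ring number `i`. -/
def Q (i : ℕ) (j : ℤ) : Φ := M.f (T.x i j)
def F0 : Φ := M.f T.e0
def F1 : Φ := M.f T.e1
def u (i : ℕ) : ℤ := if i < T.K then 3 else -3

lemma rhoU {i : ℕ} (hi : i ≤ T.K) (j : ℤ) : T.x i (j + 1) = M.a (M.R (T.u i) (T.x i j)) := by
  unfold u
  split_ifs with h
  · exact T.rho i h j
  · have : i = T.K := by omega
    subst this; exact T.rho' j

lemma NN {i : ℕ} (hi : i ≤ T.K) (j : ℤ) : (M.N (T.Q i j) = 5 ∧ (i = 0 ∨ i = T.K)) ∨ 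
    (M.N (T.Q i j) = 6 ∧ 1 ≤ i ∧ i < T.K) := by
  rcases Nat.eq_zero_or_pos i with h | h
  · subst h; exact Or.inl ⟨T.N0 j, Or.inl rfl⟩
  · rcases hi.lt_or_eq with h1 | h1
    · exact Or.inr ⟨T.N6 i h h1 j, h, h1⟩
    · subst h1; exact Or.inl ⟨T.NK j, Or.inr rfl⟩

lemma rdU {i : ℕ} (hi : i ≤ T.K) (j : ℤ) : M.rd (T.x i j) (T.u i) := by
  have : M.N (M.f (T.x i j)) = 5 ∨ M.N (M.f (T.x i j)) = 6 := M.N56 _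
  unfold rd u
  rcases this with h | h <;> rw [h] <;> split_ifs <;> norm_num

lemma piece {i : ℕ} (hi : i ≤ T.K) (j : ℤ) : M.Adj (T.Q i j) (T.Q i (j + 1)) ∧ 
    T.Q i j ≠ T.Q i (j + 2) ∧ ¬ M.Adj (T.Q i j) (T.Q i (j + 2)) := by
  have := M.rd_piece (T.rhoU hi j) (T.rhoU hi (j + 1)) (T.rdU hi _)
  rwa [show j + 1 + 1 = j + 2 by ring] at this

lemma Qper {i : ℕ} (hi : i ≤ T.K) {j j' : ℤ} (h : (5 : ℤ) ∣ j - j') : T.Q i j = T.Q i j' := by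
  unfold Q; rw [per5' (T.per i hi) h]

lemma xper {i : ℕ} (hi : i ≤ T.K) {j j' : ℤ} (h : (5 : ℤ) ∣ j - j') : T.x i j = T.x i j' :=
  per5' (T.per i hi) h

lemma Qinj {i : ℕ} (hi : i ≤ T.K) {j j' : ℤ} (h : T.Q i j = T.Q i j') : (5 : ℤ) ∣ j - j' := by
  by_contra hn
  have : (j - j') % 5 = 1 ∨ (j - j') % 5 = 2 ∨ (j - j') % 5 = 3 ∨ (j - j') % 5 = 4 := by omega
  rcases this with h1 | h1 | h1 | h1
  · rw [T.Qper hi (j := j) (j' := j' + 1) (by omega)] at h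
    exact Adj.ne _ (T.piece hi j').1 h.symm
  · rw [T.Qper hi (j := j) (j' := j' + 2) (by omega)] at h
    exact (T.piece hi j').2.1 h.symm
  · rw [T.Qper hi (j := j') (j' := j + 2) (by omega)] at h
    exact (T.piece hi j).2.1 h
  · rw [T.Qper hi (j := j') (j' := j + 1) (by omega)] at h
    exact Adj.ne _ (T.piece hi j).1 h

lemma Qadj {i : ℕ} (hi : i ≤ T.K) {j j' : ℤ} (h : M.Adj (T.Q i j) (T.Q i j')) : 
    (5 : ℤ) ∣ j' - j - 1 ∨ (5 : ℤ) ∣ j' - j + 1 := by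
  have h0 := h.ne
  by_contra hn
  have : (j - j') % 5 = 0 ∨ (j - j') % 5 = 2 ∨ (j - j') % 5 = 3 := by omega
  rcases this with h1 | h1 | h1
  · exact h0 (T.Qper hi (by omega))
  · rw [T.Qper hi (j := j) (j' := j' + 2) (by omega)] at h
    exact (T.piece hi j').2.2 (Adj.symm _ h)
  · rw [T.Qper hi (j := j') (j' := j + 2) (by omega)] at h
    exact (T.piece hi j).2.2 h

/- Neighbours of ring facets. -/
lemma nb0 {i : ℕ} (hi : i ≤ T.K) (j : ℤ) : M.f (M.a (M.R 0 (T.x i j))) = T.Q i (j - 1) := by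
  have := T.rhoU hi (j - 1)
  rw [sub_add_cancel] at this
  rw [R_zero, M.nb_prev _ this]; rfl
lemma nbu {i : ℕ} (hi : i ≤ T.K) (j : ℤ) : M.f (M.a (M.R (T.u i) (T.x i j))) = T.Q i (j + 1) := by
  rw [← T.rhoU hi]; rfl
lemma nb1 {i : ℕ} (hi : i < T.K) (j : ℤ) : M.f (M.a (M.R 1 (T.x i j))) = T.Q (i + 1) (j - 1) := by
  have := T.rho i hi (j - 1)
  rw [sub_add_cancel] at this
  rw [M.nb_up this, Q, T.lam, fR]
lemma nb2 (i : ℕ) (j : ℤ) : M.f (M.a (M.R 2 (T.x i j))) = T.Q (i + 1) j := by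
  rw [Q, T.lam, fR]
lemma nb3 {i : ℕ} (hi : i < T.K) (j : ℤ) : M.f (M.a (M.R 3 (T.x i j))) = T.Q i (j + 1) := by
  rw [← T.rho i hi]; rfl
lemma nbm1 (i : ℕ) (j : ℤ) : M.f (M.a (M.R (-1) (T.x (i + 1) j))) = T.Q i j := M.nb_down (T.lam i j)
lemma nbm2 {i : ℕ} (hi : i < T.K) (j : ℤ) : M.f (M.a (M.R (-2) (T.x (i + 1) j))) = T.Q i (j + 1) := by
  rw [M.nb_down2 (T.lam i j), T.nb3 hi]
lemma nbc0 (j : ℤ) : M.f (M.a (M.R (-1) (T.x 0 j))) = T.F0 := by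
  rw [T.cap0, R_add]; norm_num [R_zero, M.aa, fR]; rfl
lemma nbc1 (j : ℤ) : M.f (M.a (M.R 1 (T.x T.K j))) = T.F1 := by
  rw [T.capK, fR]; rfl
lemma nbF0 (j : ℤ) : M.f (M.a (M.R j T.e0)) = T.Q 0 j := by
  rw [Q, T.cap0, fR]
lemma nbF1 (j : ℤ) : M.f (M.a (M.R (-j) T.e1)) = T.Q T.K j := by
  rw [← T.capK, M.aa, fR]; rfl

/-- All the neighbours of a ring facet. -/
lemma nbs {i : ℕ} (hi : i ≤ T.K) {j : ℤ} {G : Φ} (h : M.Adj (T.Q i j) G) : 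
    G = T.Q i (j - 1) ∨ G = T.Q i (j + 1) ∨ 
    (i < T.K ∧ (G = T.Q (i + 1) j ∨ G = T.Q (i + 1) (j - 1))) ∨ 
    (i = T.K ∧ G = T.F1) ∨ (i = 0 ∧ G = T.F0) ∨ 
    (∃ m, i = m + 1 ∧ (G = T.Q m j ∨ G = T.Q m (j + 1))) := by
  obtain ⟨t, rfl⟩ := M.adj_dart h
  have cg : ∀ l : ℤ, (M.N (T.Q i j) : ℤ) ∣ t - l → M.R t (T.x i j) = M.R l (T.x i j) := 
    fun l hl => M.R_cong hl
  rcases T.NN hi j with ⟨hN, h0 | h0⟩ | ⟨hN, h1, h2⟩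
  · rw [hN] at cg
    push_cast at cg
    subst h0
    have hk := T.hK
    have : t % 5 = 0 ∨ t % 5 = 1 ∨ t % 5 = 2 ∨ t % 5 = 3 ∨ t % 5 = 4 := by omega
    rcases this with h | h | h | h | h
    · rw [cg 0 (by omega), T.nb0 hi]; tauto
    · rw [cg 1 (by omega), T.nb1 hk]; tauto
    · rw [cg 2 (by omega), T.nb2]; tauto
    · rw [cg 3 (by omega), T.nb3 hk]; tauto
    · rw [cg (-1) (by omega), T.nbc0]; tauto
  · rw [hN] at cg
    push_cast at cg
    obtain ⟨m, hm⟩ : ∃ m, i = m + 1 := ⟨i - 1, by have := T.hK; omega⟩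
    have hu : T.u i = -3 := by unfold u; rw [if_neg (by omega)]
    have : t % 5 = 0 ∨ t % 5 = 1 ∨ t % 5 = 2 ∨ t % 5 = 3 ∨ t % 5 = 4 := by omega
    rcases this with h | h | h | h | h
    · rw [cg 0 (by omega), T.nb0 hi]; tauto
    · rw [cg 1 (by omega), h0, T.nbc1]; tauto
    · rw [cg (-3) (by omega), ← hu, T.nbu hi]; tauto
    · rw [cg (-2) (by omega), hm, T.nbm2 (by omega)]
      exact Or.inr (Or.inr (Or.inr (Or.inr (Or.inr ⟨m, rfl, Or.inr rfl⟩))))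
    · rw [cg (-1) (by omega), hm, T.nbm1]
      exact Or.inr (Or.inr (Or.inr (Or.inr (Or.inr ⟨m, rfl, Or.inl rfl⟩))))
  · rw [hN] at cg
    push_cast at cg
    obtain ⟨m, hm⟩ : ∃ m, i = m + 1 := ⟨i - 1, by omega⟩
    have : t % 6 = 0 ∨ t % 6 = 1 ∨ t % 6 = 2 ∨ t % 6 = 3 ∨ t % 6 = 4 ∨ t % 6 = 5 := by omega
    rcases this with h | h | h | h | h | h
    · rw [cg 0 (by omega), T.nb0 hi]; tauto
    · rw [cg 1 (by omega), T.nb1 h2]; tauto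
    · rw [cg 2 (by omega), T.nb2]; tauto
    · rw [cg 3 (by omega), T.nb3 h2]; tauto
    · rw [cg (-2) (by omega), hm, T.nbm2 (by omega)]
      exact Or.inr (Or.inr (Or.inr (Or.inr (Or.inr ⟨m, rfl, Or.inr rfl⟩))))
    · rw [cg (-1) (by omega), hm, T.nbm1]
      exact Or.inr (Or.inr (Or.inr (Or.inr (Or.inr ⟨m, rfl, Or.inl rfl⟩))))

lemma nbsF0 {G : Φ} (h : M.Adj T.F0 G) : ∃ j, G = T.Q 0 j := by
  obtain ⟨t, rfl⟩ := M.adj_dart h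
  exact ⟨t, T.nbF0 t⟩
lemma nbsF1 {G : Φ} (h : M.Adj T.F1 G) : ∃ j, G = T.Q T.K j := by
  obtain ⟨t, rfl⟩ := M.adj_dart h
  exact ⟨-t, by rw [← T.nbF1, neg_neg]⟩

lemma exh (F : Φ) : F = T.F0 ∨ F = T.F1 ∨ ∃ i ≤ T.K, ∃ j, F = T.Q i j := by
  refine M.conn {F | F = T.F0 ∨ F = T.F1 ∨ ∃ i ≤ T.K, ∃ j, F = T.Q i j} ⟨T.F0, Or.inl rfl⟩ ?_ F
  intro d hd
  have ha : M.Adj (M.f d) (M.f (M.a d)) := ⟨d, rfl, rfl⟩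
  rcases hd with h | h | ⟨i, hi, j, h⟩
  · rw [h] at ha
    obtain ⟨j, hj⟩ := T.nbsF0 ha
    exact Or.inr (Or.inr ⟨0, by omega, j, hj⟩)
  · rw [h] at ha
    obtain ⟨j, hj⟩ := T.nbsF1 ha
    exact Or.inr (Or.inr ⟨T.K, le_rfl, j, hj⟩)
  · rw [h] at ha
    rcases T.nbs hi ha with h | h | ⟨h', h | h⟩ | ⟨h', h⟩ | ⟨h', h⟩ | ⟨m, h', h | h⟩
    · exact Or.inr (Or.inr ⟨i, hi, _, h⟩)
    · exact Or.inr (Or.inr ⟨i, hi, _, h⟩)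
    · exact Or.inr (Or.inr ⟨i + 1, h', _, h⟩)
    · exact Or.inr (Or.inr ⟨i + 1, h', _, h⟩)
    · exact Or.inr (Or.inl h)
    · exact Or.inl h
    · exact Or.inr (Or.inr ⟨m, by omega, _, h⟩)
    · exact Or.inr (Or.inr ⟨m, by omega, _, h⟩)

/-- Key step of disjointness. -/
lemma fresh {n : ℕ} (hn : n ≤ T.K) (hd : ∀ i < n, ∀ j j', T.Q n j ≠ T.Q i j')
    (hF : ∀ j, T.Q n j ≠ T.F0) (j s : ℤ) (hs : (n < T.K ∧ s = 2) ∨ (n = T.K ∧ s = 1)) : 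
    (M.f (M.a (M.R s (T.x n j))) ≠ T.F0) ∧ 
    ∀ i ≤ n, ∀ j', M.f (M.a (M.R s (T.x n j))) ≠ T.Q i j' := by
  have hN := T.NN hn j
  have ne : ∀ l, M.f (M.a (M.R s (T.x n j))) = M.f (M.a (M.R l (T.x n j))) → 
      ((M.N (T.Q n j) : ℕ) : ℤ) ∣ l - s := fun l hl => M.eq_iff' hl
  have hadj := M.adj_R (T.x n j) s
  have hk := T.hK
  constructor
  · intro h
    have h1 := hadj
    rw [h] at h1
    obtain ⟨j', hj'⟩ := T.nbsF0 (Adj.symm _ h1)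
    have hn0 : n = 0 := by
      by_contra h2
      exact hd 0 (by omega) j j' hj'
    subst hn0
    rw [← T.nbc0 j] at h
    have := ne _ h
    rcases hN with ⟨h5, -⟩ | ⟨h5, -⟩ <;> rw [h5] at this <;> omega
  · intro i hi j' h
    have h1 := Adj.symm _ hadj
    rw [h] at h1
    rcases hi.lt_or_eq with hlt | rfl
    · have hlev : i + 1 = n ∧ (T.Q n j = T.Q n j' ∨ T.Q n j = T.Q n (j' - 1)) := by
        rcases T.nbs (by omega) h1 with h | h | ⟨h', h⟩ | ⟨h', h⟩ | ⟨h', h⟩ | ⟨m, h', h | h⟩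
        · exact absurd h (hd i hlt _ _)
        · exact absurd h (hd i hlt _ _)
        · by_cases h2 : i + 1 = n
          · subst h2; exact ⟨rfl, h⟩
          · rcases h with h | h <;> exact absurd h (hd (i + 1) (by omega) _ _)
        · omega
        · exact absurd h (hF _)
        · exact absurd h (hd m (by omega) _ _)
        · exact absurd h (hd m (by omega) _ _)
      obtain ⟨rfl, h2⟩ := hlev
      rcases h2 with h2 | h2
      · have h3 := T.Qinj hn h2
        rw [T.Qper (by omega) (j := j') (j' := j) (by omega), ← T.nbm1] at h
        have := ne _ h
        rcases hN with ⟨h5, -⟩ | ⟨h5, -⟩ <;> rw [h5] at this <;> omega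
      · have h3 := T.Qinj hn h2
        rw [T.Qper (by omega) (j := j') (j' := j + 1) (by omega), ← T.nbm2 (by omega)] at h
        have := ne _ h
        rcases hN with ⟨h5, -⟩ | ⟨h5, -⟩ <;> rw [h5] at this <;> omega
    · have h1' : M.Adj (T.Q i j') (T.Q i j) := h1
      rcases T.Qadj hn h1' with h3 | h3
      · rw [T.Qper hn (j := j') (j' := j - 1) (by omega), ← T.nb0 hn] at h
        have := ne _ h
        rcases hN with ⟨h5, -⟩ | ⟨h5, -⟩ <;> rw [h5] at this <;> omega
      · rw [T.Qper hn (j := j') (j' := j + 1) (by omega), ← T.nbu hn] at h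
        have := ne _ h
        have hu : T.u i = 3 ∧ i < T.K ∨ T.u i = -3 ∧ i = T.K := by
          unfold u; split_ifs <;> omega
        rcases hN with ⟨h5, -⟩ | ⟨h5, -⟩ <;> rw [h5] at this <;> omega

lemma disj0 (n : ℕ) (hn : n ≤ T.K) : (∀ i < n, ∀ j j', T.Q n j ≠ T.Q i j') ∧ (∀ j, T.Q n j ≠ T.F0) := by
  induction n with
  | zero =>
    refine ⟨by omega, fun j => ?_⟩
    rw [← T.nbF0]
    intro h
    apply M.ne (M.R j T.e0)
    rw [h, fR]; rfl
  | succ n ih =>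
    obtain ⟨h1, h2⟩ := ih (by omega)
    have := fun j => T.fresh (by omega) h1 h2 j 2 (Or.inl ⟨hn, rfl⟩)
    refine ⟨fun i hi j j' h => ?_, fun j h => ?_⟩
    · rw [← T.nb2] at h
      exact (this j).2 i (by omega) j' h
    · rw [← T.nb2] at h
      exact (this j).1 h

lemma F1_ne : T.F1 ≠ T.F0 ∧ ∀ i ≤ T.K, ∀ j, T.F1 ≠ T.Q i j := by
  obtain ⟨h1, h2⟩ := T.disj0 T.K le_rfl
  have := T.fresh le_rfl h1 h2 0 1 (Or.inr ⟨rfl, rfl⟩)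
  rwa [T.nbc1] at this

lemma Qeq {i i' : ℕ} (hi : i ≤ T.K) (hi' : i' ≤ T.K) {j j' : ℤ} (h : T.Q i j = T.Q i' j') : 
    i = i' ∧ (5 : ℤ) ∣ j - j' := by
  have : i = i' := by
    rcases lt_trichotomy i i' with h1 | h1 | h1
    · exact absurd h.symm ((T.disj0 i' hi').1 i h1 _ _)
    · exact h1
    · exact absurd h ((T.disj0 i hi).1 i' h1 _ _)
  subst this
  exact ⟨rfl, T.Qinj hi h⟩

end Tube
end CMap
end

section
namespace CMap
variable {D Φ : Type*} (M : CMap D Φ)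

/-- The set of neighbours of a facet. -/
def nb (F : Φ) : Set Φ := {G | M.Adj F G}

/-- The family of five-belts, as sets. -/
def BS : Set (Set Φ) := {S | ∃ B : Fin 5 → Φ, M.AbsBelt B ∧ S = range B}

lemma nb_inj {F F' : Φ} (h5 : M.N F = 5) (h : M.nb F = M.nb F') : F = F' := by
  obtain ⟨d, rfl⟩ := M.surj F
  have hG : ∀ t : ℤ, M.Adj F' (M.f (M.a (M.R t d))) := by
    intro t
    have : M.f (M.a (M.R t d)) ∈ M.nb (M.f d) := M.adj_R d t
    rw [h] at this; exact this
  have h1 := Adj.symm _ (hG 1)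
  obtain ⟨t, ht⟩ := M.adj_dart h1
  set y := M.a (M.R 1 d) with hy
  have y0 : M.f (M.a y) = M.f d := by rw [hy, M.aa, fR]
  have y1 : M.f (M.a (M.R 1 y)) = M.f (M.a (M.R 0 d)) := by
    rw [hy, ara1, R_add, fR]; norm_num
  have y2 : M.f (M.a (M.R (-1) y)) = M.f (M.a (M.R 2 d)) := by
    rw [hy, aran1, R_add, fR]; norm_num
  have a0 := hG 0
  have a2 := hG 2
  rw [← y1, ht] at a0
  rw [← y2, ht] at a2
  have b0 := M.adj3' a0
  have b2 := M.adj3' a2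
  have hz : ((M.N (M.f y) : ℕ) : ℤ) ∣ t := by
    rcases M.N56 (M.f y) with hN | hN <;> rw [hN] at b0 b2 ⊢ <;> push_cast at * <;> omega
  rw [ht, M.R_self.2 hz, y0]

lemma nb_eq_range {d : D} (h : M.N (M.f d) = 5) : 
    M.nb (M.f d) = range (fun j : Fin 5 => M.f (M.a (M.R ((j : ℕ) : ℤ) d))) := by
  ext G
  constructor
  · intro hG
    obtain ⟨t, rfl⟩ := M.adj_dart hG
    refine ⟨⟨(t % 5).toNat, by omega⟩, ?_⟩
    simp only
    rw [M.R_cong]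
    rw [h]; push_cast; omega
  · rintro ⟨j, rfl⟩
    exact M.adj_R d _

lemma nb_eq_range' {d : D} (h : M.N (M.f d) = 5) : 
    M.nb (M.f d) = range (fun j : Fin 5 => M.f (M.a (M.R (-((j : ℕ) : ℤ)) d))) := by
  ext G
  constructor
  · intro hG
    obtain ⟨t, rfl⟩ := M.adj_dart hG
    refine ⟨⟨((-t) % 5).toNat, by omega⟩, ?_⟩
    simp only
    rw [M.R_cong]
    rw [h]; push_cast; omega
  · rintro ⟨j, rfl⟩
    exact M.adj_R d _

namespace Tube
variable {M} (T : M.Tube)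

def ring (i : ℕ) : Set Φ := {F | ∃ j, F = T.Q i j}

lemma ring_eq_range {i : ℕ} (hi : i ≤ T.K) : 
    T.ring i = range (fun j : Fin 5 => T.Q i ((j : ℕ) : ℤ)) := by
  ext G
  constructor
  · rintro ⟨t, rfl⟩
    refine ⟨⟨(t % 5).toNat, by omega⟩, ?_⟩
    simp only
    apply T.Qper hi
    push_cast; omega
  · rintro ⟨j, rfl⟩
    exact ⟨_, rfl⟩

lemma ring_belt {i : ℕ} (hi : i ≤ T.K) : M.AbsBelt (fun j : Fin 5 => T.Q i ((j : ℕ) : ℤ)) := by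
  intro j
  have := T.piece hi ((j : ℕ) : ℤ)
  simp only
  rw [T.Qper hi (j := (((j + 1 : Fin 5) : ℕ) : ℤ)) (j' := ((j : ℕ) : ℤ) + 1), 
    T.Qper hi (j := (((j + 2 : Fin 5) : ℕ) : ℤ)) (j' := ((j : ℕ) : ℤ) + 2)]
  · exact this
  · clear this; revert j; decide
  · clear this; revert j; decide

lemma NF0 : M.N T.F0 = 5 := T.n0
lemma NF1 : M.N T.F1 = 5 := T.n1

lemma hex_ring {F : Φ} (h : M.N F = 6) : ∃ i, 1 ≤ i ∧ i < T.K ∧ ∃ j, F = T.Q i j := by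
  rcases T.exh F with rfl | rfl | ⟨i, hi, j, rfl⟩
  · rw [T.NF0] at h; omega
  · rw [T.NF1] at h; omega
  · rcases T.NN hi j with ⟨h5, -⟩ | ⟨-, h1, h2⟩
    · omega
    · exact ⟨i, h1, h2, j, rfl⟩

lemma straight {x : Fin 5 → D} (h6 : ∀ j, M.N (M.f (x j)) = 6)
    (hx : ∀ j, x (j + 1) = M.a (M.R 3 (x j))) : 
    ∃ i, 1 ≤ i ∧ i < T.K ∧ range (fun j => M.f (x j)) = T.ring i := by
  choose lev h1 h2 c hc using fun j => T.hex_ring (h6 j)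
  obtain ⟨j, hj⟩ := Finite.exists_max lev
  have hi := h1 j
  have hK := h2 j
  have he := hc j
  set i := lev j
  have hNo : ∀ j' c', M.f (x j') ≠ T.Q (i + 1) c' := by
    intro j' c' h
    rw [hc j'] at h
    have := (T.Qeq (by have := h2 j'; omega) (by omega) h).1
    have := hj j'
    omega
  obtain ⟨l, hl⟩ := M.trans _ _ he.symm
  have hl : M.R l (T.x i (c j)) = x j := hl
  have hN : M.N (M.f (T.x i (c j))) = 6 := T.N6 i hi hK _
  have cg : ∀ m : ℤ, (6 : ℤ) ∣ l - m → x j = M.R m (T.x i (c j)) := by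
    intro m hm; rw [← hl]; apply M.R_cong; rw [hN]; exact_mod_cast hm
  have all : ∀ (P : Fin 5 → Prop) , P j → (∀ j, P j → P (j + 1)) → ∀ j, P j := by
    intro P h0 hs
    have a1 := hs _ h0
    have a2 := hs _ a1
    have a3 := hs _ a2
    have a4 := hs _ a3
    intro j'
    have : j' = j ∨ j' = j + 1 ∨ j' = j + 1 + 1 ∨ j' = j + 1 + 1 + 1 ∨ j' = j + 1 + 1 + 1 + 1 := by
      clear * -; revert j j'; decide
    rcases this with h | h | h | h | h <;> rw [h] <;> assumption
  have inj : Function.Injective (fun j => M.f (x j)) := by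
    have hb := M.belt_of_walk x (fun _ => 3) hx (fun j => by
      unfold rd; rw [h6]; norm_num)
    intro a b hab
    by_contra hne
    have : b = a + 1 ∨ b = a + 2 ∨ a = b + 1 ∨ a = b + 2 := by
      clear * - hne; revert a b; decide
    rcases this with h | h | h | h <;> subst h
    · exact Adj.ne _ (hb _).1 hab
    · exact (hb _).2.1 hab
    · exact Adj.ne _ (hb _).1 hab.symm
    · exact (hb _).2.1 hab.symm
  have fin : (∀ j, ∃ c, M.f (x j) = T.Q i c) → 
      ∃ i, 1 ≤ i ∧ i < T.K ∧ range (fun j => M.f (x j)) = T.ring i := by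
    intro h
    refine ⟨i, hi, hK, ?_⟩
    apply Set.eq_of_subset_of_ncard_le
    · rintro _ ⟨j, rfl⟩; exact h j
    · rw [T.ring_eq_range (by omega)]
      rw [Set.ncard_range_of_injective inj]
      have := Set.ncard_image_le (f := fun j : Fin 5 => T.Q i ((j : ℕ) : ℤ)) (s := Set.univ)
      rw [Set.image_univ, Set.ncard_univ] at this
      exact this
    · rw [T.ring_eq_range (by omega)]; exact Set.finite_range _
  have hm : l % 6 = 0 ∨ l % 6 = 1 ∨ l % 6 = 2 ∨ l % 6 = 3 ∨ l % 6 = 4 ∨ l % 6 = 5 := by omega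
  have hprev : M.f (M.a (x j)) = M.f (x (j - 1)) := by
    have := hx (j - 1)
    rw [sub_add_cancel] at this
    rw [this, M.aa, fR]
  rcases hm with h | h | h | h | h | h
  · apply fin
    have : ∀ j, ∃ c, x j = T.x i c := by
      apply all
      · exact ⟨c j, by rw [cg 0 (by omega), R_zero]⟩
      · rintro j ⟨c, h⟩
        exact ⟨c + 1, by rw [hx, h, T.rho i hK]⟩
    intro j
    obtain ⟨c, h⟩ := this j
    exact ⟨c, by rw [h]; rfl⟩
  · exfalso
    rw [cg 1 (by omega), T.nb1 hK] at hprev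
    exact hNo _ _ hprev.symm
  · exfalso
    rw [cg 2 (by omega), T.nb2] at hprev
    exact hNo _ _ hprev.symm
  · apply fin
    have : ∀ j, ∃ c, x j = M.R 3 (T.x i c) := by
      apply all
      · exact ⟨c j, by rw [cg 3 (by omega)]⟩
      · rintro j ⟨c, h⟩
        refine ⟨c - 1, ?_⟩
        have e := T.rho i hK (c - 1)
        rw [sub_add_cancel] at e
        rw [hx, h, R_add, M.R_self.2, e, M.aa]
        rw [T.N6 i hi hK]; norm_num
    intro j
    obtain ⟨c, h⟩ := this j
    exact ⟨c, by rw [h, fR]; rfl⟩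
  · exfalso
    apply hNo (j + 1) (c j - 1)
    rw [hx, cg (-2) (by omega), R_add, ← T.nb1 hK]; norm_num
  · exfalso
    apply hNo (j + 1) (c j)
    rw [hx, cg (-1) (by omega), R_add, ← T.nb2]; norm_num

lemma nb_ne_ring {F : Φ} {i : ℕ} (hi : 1 ≤ i) (hK : i < T.K) : M.nb F ≠ T.ring i := by
  intro h
  have hG : ∀ t, M.Adj (T.Q i t) F := by
    intro t
    have : T.Q i t ∈ M.nb F := by rw [h]; exact ⟨t, rfl⟩
    exact Adj.symm _ this
  obtain ⟨t, ht⟩ := M.adj_dart (hG 1)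
  have a0 := hG 0
  have a2 := hG 2
  have e0 := T.nb0 hK.le 1
  have e2 := T.nb3 hK 1
  norm_num at e0 e2
  rw [ht, ← e0, M.R_zero] at a0
  rw [ht, ← e2] at a2
  have b0 := M.adj3 a0
  have b2 := M.adj3' a2
  rw [T.N6 i hi hK] at b0 b2
  push_cast at *; omega

lemma ring_inj {i i' : ℕ} (hi : i ≤ T.K) (hi' : i' ≤ T.K) (h : T.ring i = T.ring i') : i = i' := by
  have : T.Q i 0 ∈ T.ring i := ⟨0, rfl⟩
  rw [h] at this
  obtain ⟨j, hj⟩ := this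
  exact (T.Qeq hi hi' hj).1

lemma BS_eq : M.BS = M.nb '' {F | M.N F = 5} ∪ T.ring '' (Ico 1 T.K) := by
  ext S
  constructor
  · rintro ⟨B, hB, rfl⟩
    rcases M.belt_class hB with ⟨d, h5, h | h⟩ | ⟨x, hx⟩
    · left
      refine ⟨M.f d, h5, ?_⟩
      rw [M.nb_eq_range h5]; congr 1; funext j; exact (h j).symm
    · left
      refine ⟨M.f d, h5, ?_⟩
      rw [M.nb_eq_range' h5]; congr 1; funext j; exact (h j).symm
    · right
      obtain ⟨i, h1, h2, h3⟩ := T.straight (x := x) (fun j => by rw [(hx j).1]; exact (hx j).2.2) 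
        (fun j => (hx j).2.1)
      refine ⟨i, ⟨h1, h2⟩, ?_⟩
      rw [← h3]; congr 1; funext j; exact (hx j).1
  · rintro (⟨F, h5, rfl⟩ | ⟨i, ⟨h1, h2⟩, rfl⟩)
    · obtain ⟨d, rfl⟩ := M.surj F
      exact ⟨_, M.pent_belt h5, M.nb_eq_range h5⟩
    · exact ⟨_, T.ring_belt h2.le, T.ring_eq_range h2.le⟩

lemma count [Finite Φ] : M.BS.ncard = {F | M.N F = 5}.ncard + (T.K - 1) := by
  rw [T.BS_eq, Set.ncard_union_eq]
  · congr 1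
    · apply Set.ncard_image_of_injOn
      intro F hF F' hF' h
      exact M.nb_inj hF h
    · rw [Set.ncard_image_of_injOn]
      · rw [← Finset.coe_Ico, Set.ncard_coe_finset, Nat.card_Ico]
      · intro i hi i' hi' h
        exact T.ring_inj hi.2.le hi'.2.le h
  · rw [Set.disjoint_left]
    rintro _ ⟨F, h5, rfl⟩ ⟨i, ⟨h1, h2⟩, h⟩
    exact T.nb_ne_ring h1 h2 h.symm

/-- The facets on the lower side. -/
def low (i : ℕ) : Set Φ := {F | F = T.F0 ∨ ∃ m ≤ i, ∃ j, F = T.Q m j}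

lemma Q_not_low {i m : ℕ} (hm : m ≤ T.K) (h : i < m) (j : ℤ) : T.Q m j ∉ T.low i := by
  rintro (h1 | ⟨m', hm', j', h1⟩)
  · exact (T.disj0 m hm).2 j h1
  · have := (T.Qeq hm (by omega) h1).1
    omega

lemma cross {i : ℕ} (hi : i < T.K) {F G : Φ} (h : M.Adj F G) (hF : F ∈ T.low i) (hG : G ∉ T.low i) :
    ∃ j, (F = T.Q i j ∧ G = T.Q (i + 1) j) ∨ (F = T.Q i (j + 1) ∧ G = T.Q (i + 1) j) := by
  rcases hF with rfl | ⟨m, hm, j, rfl⟩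
  · obtain ⟨j, rfl⟩ := T.nbsF0 h
    exact absurd (Or.inr ⟨0, by omega, j, rfl⟩) hG
  · rcases T.nbs (by omega) h with h | h | ⟨h', h⟩ | ⟨h', h⟩ | ⟨h', h⟩ | ⟨m', h', h | h⟩
    · exact absurd (Or.inr ⟨m, hm, _, h⟩) hG
    · exact absurd (Or.inr ⟨m, hm, _, h⟩) hG
    · by_cases hmi : m = i
      · subst hmi
        rcases h with h | h
        · exact ⟨j, Or.inl ⟨rfl, h⟩⟩
        · exact ⟨j - 1, Or.inr ⟨by rw [sub_add_cancel], h⟩⟩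
      · rcases h with h | h <;> exact absurd (Or.inr ⟨m + 1, by omega, _, h⟩) hG
    · omega
    · exact absurd (Or.inl h) hG
    · exact absurd (Or.inr ⟨m', by omega, _, h⟩) hG
    · exact absurd (Or.inr ⟨m', by omega, _, h⟩) hG

end Tube
end CMap
end

section
lemma intr_extend {s : Set E3} {x y : E3} (hx : x ∈ intrinsicInterior ℝ s) (hy : y ∈ affineSpan ℝ s) :
    ∃ t : ℝ, 0 < t ∧ x + t • (x - y) ∈ s := by
  obtain ⟨x', hx', rfl⟩ := mem_intrinsicInterior.1 hx
  have hm : ∀ t : ℝ, (x' : E3) + t • ((x' : E3) - y) ∈ affineSpan ℝ s := by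
    intro t
    have := AffineMap.lineMap_mem (-t) x'.2 hy
    convert this using 1
    simp [AffineMap.lineMap_apply]; module
  let g : ℝ → affineSpan ℝ s := fun t => ⟨(x' : E3) + t • ((x' : E3) - y), hm t⟩
  have hg : Continuous g := by
    apply Continuous.subtype_mk
    fun_prop
  have ho : IsOpen (g ⁻¹' interior ((↑) ⁻¹' s : Set <| affineSpan ℝ s)) := isOpen_interior.preimage hg
  have h0 : (0:ℝ) ∈ g ⁻¹' interior ((↑) ⁻¹' s : Set <| affineSpan ℝ s) := by
    have : g 0 = x' := by simp [g]
    rw [mem_preimage, this]; exact hx'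
  obtain ⟨ε, hε, hb⟩ := Metric.isOpen_iff.1 ho 0 h0
  refine ⟨ε / 2, by positivity, ?_⟩
  have : ε / 2 ∈ Metric.ball (0:ℝ) ε := by
    simp [abs_of_pos hε]; linarith
  have h := hb this
  rw [mem_preimage] at h
  have h' := interior_subset h
  exact h'

lemma mem_openSeg_extend {x y : E3} {t : ℝ} (ht : 0 < t) : x ∈ openSegment ℝ y (x + t • (x - y)) := by
  refine ⟨t / (1 + t), 1 / (1 + t), by positivity, by positivity, by field_simp; ring, ?_⟩
  have : (1 + t) ≠ 0 := by positivity
  have e : x + t • (x - y) = (1 + t) • x - t • y := by module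
  rw [e, smul_sub, smul_smul, smul_smul, one_div_mul_cancel this, ← mul_comm t, mul_one_div]
  module

lemma exposed_hull {V : Set E3} {f : E3 →L[ℝ] ℝ} {c : ℝ} (h : ∀ v ∈ V, f v ≤ c) :
    convexHull ℝ V ∩ {x | f x = c} = convexHull ℝ (V ∩ {x | f x = c}) := by
  apply Subset.antisymm
  · have hK : Convex ℝ {x | f x < c ∨ (f x = c ∧ x ∈ convexHull ℝ (V ∩ {x | f x = c}))} := by
      rw [convex_iff_forall_pos]
      intro x hx y hy a b ha hb hab
      have e : f (a • x + b • y) = a * f x + b * f y := by simp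
      have ec : c = a * c + b * c := by rw [← add_mul, hab, one_mul]
      simp only [mem_ofPred_eq, e]
      rcases hx with hx | ⟨hx, hx'⟩ <;> rcases hy with hy | ⟨hy, hy'⟩
      · left; nlinarith
      · left; nlinarith
      · left; nlinarith
      · right
        exact ⟨by rw [hx, hy, ← ec], convex_convexHull ℝ _ hx' hy' ha.le hb.le hab⟩
    have hV : V ⊆ {x | f x < c ∨ (f x = c ∧ x ∈ convexHull ℝ (V ∩ {x | f x = c}))} := by
      intro v hv
      rcases (h v hv).lt_or_eq with h1 | h1
      · exact Or.inl h1
      · exact Or.inr ⟨h1, subset_convexHull ℝ _ ⟨hv, h1⟩⟩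
    rintro x ⟨hx, hx'⟩
    rcases convexHull_min hV hK hx with h1 | h1
    · exact absurd hx' (ne_of_lt h1)
    · exact h1.2
  · intro x hx
    refine ⟨convexHull_mono inter_subset_left hx, ?_⟩
    have : Convex ℝ {x | f x = c} := convex_hyperplane f.toLinearMap.isLinear c
    exact convexHull_min inter_subset_right this hx

lemma finrank_ker_le {f : E3 →L[ℝ] ℝ} (hf : f ≠ 0) : Module.finrank ℝ (LinearMap.ker f.toLinearMap) = 2 := by
  have h1 := LinearMap.finrank_range_add_finrank_ker f.toLinearMap
  have h2 : LinearMap.range f.toLinearMap = ⊤ := by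
    apply LinearMap.range_eq_top.2
    apply LinearMap.surjective
    intro h; apply hf; ext x; exact congrArg (fun g => g x) h
  rw [h2] at h1
  simp at h1
  omega

lemma vspan_le_ker {f : E3 →L[ℝ] ℝ} {c : ℝ} {F : Set E3} (h : ∀ x ∈ F, f x = c) :
    vectorSpan ℝ F ≤ LinearMap.ker f.toLinearMap := by
  rw [vectorSpan_def, Submodule.span_le]
  rintro _ ⟨x, hx, y, hy, rfl⟩
  simp [h x hx, h y hy]

lemma extreme_int {P F : Set E3} (hF : IsExtreme ℝ P F) {x : E3} (hx : x ∈ F) (hi : x ∈ interior P) :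
    F = P := by
  apply Subset.antisymm hF.subset
  intro y hy
  have hc : Continuous (fun t : ℝ => x + t • (x - y)) := by fun_prop
  have ho := (isOpen_interior (s := P)).preimage hc
  obtain ⟨ε, hε, hb⟩ := Metric.isOpen_iff.1 ho 0 (by simpa using hi)
  have : ε / 2 ∈ Metric.ball (0:ℝ) ε := by
    simp [abs_of_pos hε]; linarith
  exact hF.2 hy (interior_subset (hb this)) hx (mem_openSeg_extend (by positivity))

lemma extreme_exposed {P : Set E3} {f : E3 →L[ℝ] ℝ} {c : ℝ} (h : ∀ x ∈ P, f x ≤ c) :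
    IsExtreme ℝ P (P ∩ {x | f x = c}) := by
  refine ⟨inter_subset_left, ?_⟩
  rintro x hx y hy z ⟨hz, hz'⟩ ⟨a, b, ha, hb, hab, rfl⟩
  refine ⟨hx, ?_⟩
  have e : f (a • x + b • y) = a * f x + b * f y := by simp
  simp only [mem_ofPred_eq, e] at hz' ⊢
  have h1 := h x hx
  have h2 := h y hy
  by_contra h3
  have h4 := lt_of_le_of_ne h1 h3
  have ec : c = a * c + b * c := by rw [← add_mul, hab, one_mul]
  nlinarith

lemma P_cvx {P : Set E3} {V : Finset E3} (hV : P = convexHull ℝ (V : Set E3)) : Convex ℝ P := by rw [hV]; exact convex_convexHull _ _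
lemma P_cpt {P : Set E3} {V : Finset E3} (hV : P = convexHull ℝ (V : Set E3)) : IsCompact P := by rw [hV]; exact V.finite_toSet.isCompact_convexHull ℝ

lemma P_int {P : Set E3} {V : Finset E3} (hV : P = convexHull ℝ (V : Set E3)) (hd : setDim P = 3) : (interior P).Nonempty := by
  have : P.Nonempty := by
    rw [nonempty_iff_ne_empty]; rintro rfl
    rw [setDim, vectorSpan_empty, finrank_bot] at hd; omega
  rw [(P_cvx hV).interior_nonempty_iff_affineSpan_eq_top,
    AffineSubspace.affineSpan_eq_top_iff_vectorSpan_eq_top_of_nonempty ℝ _ _ this]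
  apply Submodule.eq_top_of_finrank_eq
  unfold setDim at hd; rw [hd]; simp

lemma facet_exposed {P : Set E3} {V : Finset E3} (hV : P = convexHull ℝ (V : Set E3)) (hd : setDim P = 3) {F : Set E3} (hF : IsFacetOf F P) : ∃ (f : E3 →L[ℝ] ℝ) (c : ℝ), f ≠ 0 ∧
    (∀ x ∈ P, f x ≤ c) ∧ F = P ∩ {x | f x = c} ∧ ∀ x ∈ interior P, f x < c := by
  obtain ⟨⟨hne, hcl, hcv, hex⟩, h2⟩ := hF
  have hdisj : Disjoint (interior P) F := by
    rw [Set.disjoint_left]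
    intro x hx hx'
    have := extreme_int hex hx' hx
    rw [this] at h2; omega
  obtain ⟨f, c, h1, h3⟩ := geometric_hahn_banach_open (P_cvx hV).interior isOpen_interior hcv hdisj
  have hle : ∀ x ∈ P, f x ≤ c := by
    intro x hx
    have hx : x ∈ closure (interior P) := by
      rw [(P_cvx hV).closure_interior_eq_closure_of_nonempty_interior (P_int hV hd)]
      exact subset_closure hx
    have : IsClosed {x | f x ≤ c} := isClosed_le f.continuous continuous_const
    exact closure_minimal (fun y hy => (h1 y hy).le) this hx
  have hf : f ≠ 0 := by
    rintro rfl
    obtain ⟨x, hx⟩ := P_int hV hd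
    obtain ⟨y, hy⟩ := hne
    have a1 := h1 x hx
    have a2 := h3 y hy
    simp at a1 a2; linarith
  have hFc : ∀ x ∈ F, f x = c := fun x hx => le_antisymm (hle x (hex.subset hx)) (h3 x hx)
  refine ⟨f, c, hf, hle, ?_, h1⟩
  apply Subset.antisymm
  · exact fun x hx => ⟨hex.subset hx, hFc x hx⟩
  · rintro y ⟨hy, hyc⟩
    obtain ⟨x, hx⟩ := Set.Nonempty.intrinsicInterior hcv hne
    have hxF := intrinsicInterior_subset hx
    have hker : vectorSpan ℝ F = LinearMap.ker f.toLinearMap := by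
      apply Submodule.eq_of_le_of_finrank_eq (vspan_le_ker hFc)
      rw [finrank_ker_le hf]; exact h2
    have hya : y ∈ affineSpan ℝ F := by
      have : y -ᵥ x ∈ (affineSpan ℝ F).direction := by
        rw [direction_affineSpan, hker]
        simp only [mem_ofPred_eq] at hyc
        simp [hyc, hFc x hxF]
      have := AffineSubspace.vadd_mem_of_mem_direction this (subset_affineSpan ℝ F hxF)
      simpa using this
    obtain ⟨t, ht, hz⟩ := intr_extend hx hya
    exact hex.2 hy (hex.subset hz) hxF (mem_openSeg_extend ht)

lemma facets_finite {P : Set E3} {V : Finset E3} (hV : P = convexHull ℝ (V : Set E3)) (hd : setDim P = 3) : (facets P).Finite := by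
  have hb : ∀ F ∈ facets P, ∃ W ⊆ (V : Set E3), F = convexHull ℝ W := by
    intro F hF
    obtain ⟨f, c, hf, hle, he, -⟩ := facet_exposed hV hd hF
    refine ⟨(V : Set E3) ∩ {x | f x = c}, inter_subset_left, ?_⟩
    have := exposed_hull (V := (V : Set E3)) (f := f) (c := c) 
      (fun v hv => hle v (by rw [hV]; exact subset_convexHull _ _ hv))
    rw [he, hV, this]
  apply Set.Finite.subset ((V.finite_toSet.powerset).image (convexHull ℝ))
  intro F hF
  obtain ⟨W, h1, h2⟩ := hb F hF
  exact ⟨W, h1, h2.symm⟩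

lemma facet_sep {P : Set E3} {V : Finset E3} (hV : P = convexHull ℝ (V : Set E3)) (hd : setDim P = 3)
    {q : E3} (hq : q ∉ P) : ∃ (F : Set E3) (f : E3 →L[ℝ] ℝ) (c : ℝ), IsFacetOf F P ∧
    (∀ x ∈ P, f x ≤ c) ∧ F = P ∩ {x | f x = c} ∧ c < f q := by
  -- generic interior point
  have hgen : ∃ p ∈ interior P, ∀ a ∈ V, ∀ b ∈ V, p ∉ affineSpan ℝ {q, a, b} := by
    by_contra hcon
    push Not at hcon
    have hsub : interior P ⊆ ⋃ a ∈ V, ⋃ b ∈ V, (affineSpan ℝ {q, a, b} : Set E3) := by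
      intro p hp
      obtain ⟨a, ha, b, hb, h⟩ := hcon p hp
      simp only [mem_iUnion]
      exact ⟨a, ha, b, hb, h⟩
    have hz : MeasureTheory.volume (⋃ a ∈ V, ⋃ b ∈ V, (affineSpan ℝ {q, a, b} : Set E3)) = 0 := by
      refine (MeasureTheory.measure_biUnion_null_iff (I := (V : Set E3)) V.countable_toSet).2 ?_
      intro a _
      refine (MeasureTheory.measure_biUnion_null_iff (I := (V : Set E3)) V.countable_toSet).2 ?_
      intro b _
      apply MeasureTheory.Measure.addHaar_affineSubspace
      intro htop
      have h1 : Module.finrank ℝ (vectorSpan ℝ ({q, a, b} : Set E3)) = 3 := by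
        rw [← direction_affineSpan, htop, AffineSubspace.direction_top, finrank_top]; simp
      have h2 := finrank_vectorSpan_insert_le_set ℝ ({a, b} : Set E3) q
      have h3 := (collinear_pair ℝ a b).finrank_le_one
      omega
    have := isOpen_interior.measure_pos MeasureTheory.volume (P_int hV hd)
    have := MeasureTheory.measure_mono_null hsub hz
    simp_all
  obtain ⟨p, hp, hgen⟩ := hgen
  have hpP := interior_subset hp
  let l : ℝ → E3 := fun t => AffineMap.lineMap p q t
  have hl : Continuous l := by
    exact AffineMap.lineMap_continuous
  have hcl : IsClosed P := (P_cpt hV).isClosed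
  have hK : IsCompact (Icc (0:ℝ) 1 ∩ l ⁻¹' P) := isCompact_Icc.inter_right (hcl.preimage hl)
  obtain ⟨t, ⟨⟨ht0, ht1⟩, htP⟩, htmax⟩ := hK.exists_isMaxOn ⟨0, ⟨by simp, by simpa [l] using hpP⟩⟩ continuousOn_id
  have htlt : t < 1 := by
    rcases ht1.lt_or_eq with h | h
    · exact h
    · subst h; exact absurd (by simpa [l] using htP) hq
  have hnint : l t ∉ interior P := by
    intro hi
    have ho := (isOpen_interior (s := P)).preimage hl
    obtain ⟨ε, hε, hb⟩ := Metric.isOpen_iff.1 ho t hi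
    have hm : 0 < min (ε / 2) (1 - t) := by
      apply lt_min <;> linarith
    have hm1 := min_le_left (ε / 2) (1 - t)
    have hm2 := min_le_right (ε / 2) (1 - t)
    have : t + min (ε / 2) (1 - t) ∈ Metric.ball t ε := by
      rw [Metric.mem_ball, Real.dist_eq, abs_lt]; constructor <;> linarith
    have h1 := interior_subset (hb this)
    have h2 := htmax (a := t + min (ε / 2) (1 - t)) ⟨⟨by linarith, by linarith⟩, h1⟩
    simp only [id, mem_ofPred_eq] at h2
    linarith
  obtain ⟨f, hf⟩ := geometric_hahn_banach_open_point (P_cvx hV).interior isOpen_interior hnint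
  set c := f (l t) with hc
  have hle : ∀ x ∈ P, f x ≤ c := by
    intro x hx
    have hx : x ∈ closure (interior P) := by
      rw [(P_cvx hV).closure_interior_eq_closure_of_nonempty_interior (P_int hV hd)]
      exact subset_closure hx
    have : IsClosed {x | f x ≤ c} := isClosed_le f.continuous continuous_const
    exact closure_minimal (fun y hy => (hf y hy).le) this hx
  have hfp := hf p hp
  have hlt : c = f p + t * (f q - f p) := by
    simp [hc, l, AffineMap.lineMap_apply]; ring
  have hf0 : f ≠ 0 := by
    intro h0
    rw [hc, h0] at hfp; simp at hfp
  have hcq : c < f q := by nlinarith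
  refine ⟨P ∩ {x | f x = c}, f, c, ?_, hle, rfl, hcq⟩
  have hface : IsFaceOf (P ∩ {x | f x = c}) P := 
    ⟨⟨l t, htP, rfl⟩, hcl.inter (isClosed_eq f.continuous continuous_const), 
      (P_cvx hV).inter (convex_hyperplane f.toLinearMap.isLinear c), extreme_exposed hle⟩
  refine ⟨hface, ?_⟩
  have hup : setDim (P ∩ {x | f x = c}) ≤ 2 := by
    rw [← finrank_ker_le hf0]
    exact Submodule.finrank_mono (vspan_le_ker (fun x hx => hx.2))
  by_contra hne
  have hle1 : setDim (P ∩ {x | f x = c}) ≤ 1 := by omega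
  have hcol : Collinear ℝ (P ∩ {x | f x = c}) := collinear_iff_finrank_le_one.2 hle1
  have hhull := exposed_hull (V := (V : Set E3)) (f := f) (c := c) 
      (fun v hv => hle v (by rw [hV]; exact subset_convexHull _ _ hv))
  rw [← hV] at hhull
  have hx : l t ∈ convexHull ℝ ((V : Set E3) ∩ {x | f x = c}) := by
    rw [← hhull]; exact ⟨htP, rfl⟩
  have hcol' : Collinear ℝ ((V : Set E3) ∩ {x | f x = c}) := by
    apply hcol.subset
    rw [hhull]; exact subset_convexHull _ _
  have hab : ∃ a ∈ V, ∃ b ∈ V, l t ∈ affineSpan ℝ ({a, b} : Set E3) := by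
    have hxs := convexHull_subset_affineSpan _ hx
    obtain ⟨a, ha⟩ := convexHull_nonempty_iff.1 ⟨_, hx⟩
    by_cases h : ∃ b ∈ (V : Set E3) ∩ {x | f x = c}, a ≠ b
    · obtain ⟨b, hb, hne⟩ := h
      refine ⟨a, ha.1, b, hb.1, ?_⟩
      rw [hcol'.affineSpan_eq_of_ne ha hb hne]; exact hxs
    · push Not at h
      refine ⟨a, ha.1, a, ha.1, ?_⟩
      refine affineSpan_mono ℝ ?_ hxs
      intro b hb; simp [h b hb]
  obtain ⟨a, ha, b, hb, hxab⟩ := hab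
  apply hgen a ha b hb
  have h1 : l t ∈ affineSpan ℝ ({q, a, b} : Set E3) := affineSpan_mono ℝ (by simp) hxab
  have h2 : q ∈ affineSpan ℝ ({q, a, b} : Set E3) := subset_affineSpan ℝ _ (by simp)
  have := AffineMap.lineMap_mem (1 / (1 - t)) h2 h1
  convert this using 1
  have h3 : 1 - t ≠ 0 := by linarith
  simp only [l, AffineMap.lineMap_apply, vsub_eq_sub, vadd_eq_add]
  rw [← smul_right_injective E3 h3 |>.eq_iff]
  simp only [smul_add, smul_smul]
  rw [mul_div_cancel₀ _ h3]
  module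
end

section
/-- Scalar product of a covector with a point, in coordinates. -/
def dt (a : Fin 3 → ℝ) (x : E3) : ℝ := a 0 * x 0 + a 1 * x 1 + a 2 * x 2

lemma dt_add (a : Fin 3 → ℝ) (x y : E3) : dt a (x + y) = dt a x + dt a y := by simp [dt]; ring
lemma dt_sub (a : Fin 3 → ℝ) (x y : E3) : dt a (x - y) = dt a x - dt a y := by simp [dt]; ring
lemma dt_smul (a : Fin 3 → ℝ) (t : ℝ) (x : E3) : dt a (t • x) = t * dt a x := by simp [dt]; ring
lemma dt_zero (a : Fin 3 → ℝ) : dt a 0 = 0 := by simp [dt]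
lemma dt_addl (a b : Fin 3 → ℝ) (x : E3) : dt (a + b) x = dt a x + dt b x := by simp [dt]; ring
lemma dt_cont (a : Fin 3 → ℝ) : Continuous (dt a) := by unfold dt; fun_prop

/-- Determinant of three covectors. -/
def dd (a b c : Fin 3 → ℝ) : ℝ :=
  a 0 * (b 1 * c 2 - b 2 * c 1) + a 1 * (b 2 * c 0 - b 0 * c 2) + a 2 * (b 0 * c 1 - b 1 * c 0)

/-- Cross product. -/
def cr (a b : Fin 3 → ℝ) : E3 :=
  !₂[a 1 * b 2 - a 2 * b 1, a 2 * b 0 - a 0 * b 2, a 0 * b 1 - a 1 * b 0]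

lemma cr0 (a b : Fin 3 → ℝ) : (cr a b) 0 = a 1 * b 2 - a 2 * b 1 := by simp [cr]
lemma cr1 (a b : Fin 3 → ℝ) : (cr a b) 1 = a 2 * b 0 - a 0 * b 2 := by simp [cr]
lemma cr2 (a b : Fin 3 → ℝ) : (cr a b) 2 = a 0 * b 1 - a 1 * b 0 := by simp [cr]

lemma dt_cr (a b c : Fin 3 → ℝ) : dt c (cr a b) = dd a b c := by
  simp only [dt, dd, cr0, cr1, cr2]; ring
lemma dt_cr1 (a b : Fin 3 → ℝ) : dt a (cr a b) = 0 := by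
  simp only [dt, cr0, cr1, cr2]; ring
lemma dt_cr2 (a b : Fin 3 → ℝ) : dt b (cr a b) = 0 := by
  simp only [dt, cr0, cr1, cr2]; ring
lemma dd_cyc (a b c : Fin 3 → ℝ) : dd b c a = dd a b c := by unfold dd; ring
lemma dd_swap (a b c : Fin 3 → ℝ) : dd b a c = - dd a b c := by unfold dd; ring
lemma dd_12 (a c : Fin 3 → ℝ) : dd a a c = 0 := by unfold dd; ring
lemma dd_13 (a c : Fin 3 → ℝ) : dd a c a = 0 := by unfold dd; ring
lemma dd_23 (a c : Fin 3 → ℝ) : dd a c c = 0 := by unfold dd; ring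

lemma cramer (a b c : Fin 3 → ℝ) (u : E3) :
    dd a b c • u = dt a u • cr b c + dt b u • cr c a + dt c u • cr a b := by
  ext i
  fin_cases i <;> simp [dd, dt, cr] <;> ring

lemma dd_ker {a b c : Fin 3 → ℝ} (h : dd a b c ≠ 0) {u : E3} (ha : dt a u = 0) (hb : dt b u = 0)
    (hc : dt c u = 0) : u = 0 := by
  have := cramer a b c u
  rw [ha, hb, hc] at this
  simp only [zero_smul, add_zero] at this
  exact (smul_eq_zero.1 this).resolve_left h

lemma dd_line {a b c : Fin 3 → ℝ} (h : dd a b c ≠ 0) {u : E3} (ha : dt a u = 0) (hb : dt b u = 0) :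
    ∃ s : ℝ, u = s • cr a b := by
  have := cramer a b c u
  rw [ha, hb] at this
  simp only [zero_smul, zero_add] at this
  refine ⟨(dd a b c)⁻¹ * dt c u, ?_⟩
  rw [mul_smul, ← this, smul_smul, inv_mul_cancel₀ h, one_smul]

lemma dd_ne_zero {a b c : Fin 3 → ℝ} (h : ∀ u : E3, dt a u = 0 → dt b u = 0 → dt c u = 0 → u = 0) :
    dd a b c ≠ 0 := by
  intro hd
  have : (Matrix.of ![a, b, c]).det = 0 := by
    rw [Matrix.det_fin_three]; simp; unfold dd at hd; linarith
  obtain ⟨v, hv, hm⟩ := Matrix.exists_mulVec_eq_zero_iff.2 this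
  apply hv
  have e : ∀ d : Fin 3 → ℝ, dt d (WithLp.toLp 2 v) = d ⬝ᵥ v := by
    intro d; simp [dt, dotProduct, Fin.sum_univ_three]
  have := h (WithLp.toLp 2 v) (by rw [e]; exact congrFun hm 0) (by rw [e]; exact congrFun hm 1) 
    (by rw [e]; exact congrFun hm 2)
  have h2 := congrArg (fun x : E3 => x.ofLp) this
  simpa using h2

lemma dt_self_pos {u : E3} (h : u ≠ 0) : 0 < dt u.ofLp u := by
  unfold dt
  by_contra hn
  apply h
  have h0 : u 0 = 0 := by nlinarith [mul_self_nonneg (u 0), mul_self_nonneg (u 1), mul_self_nonneg (u 2)]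
  have h1 : u 1 = 0 := by nlinarith [mul_self_nonneg (u 0), mul_self_nonneg (u 1), mul_self_nonneg (u 2)]
  have h2 : u 2 = 0 := by nlinarith [mul_self_nonneg (u 0), mul_self_nonneg (u 1), mul_self_nonneg (u 2)]
  ext i; fin_cases i <;> simpa

/-- A simple polytope given by inequalities. -/
structure SPoly (ι : Type) where
  P : Set E3
  n : ι → Fin 3 → ℝ
  c : ι → ℝ
  fin : Finite ι
  hP : ∀ x, x ∈ P ↔ ∀ i, dt (n i) x ≤ c i
  cpt : IsCompact P
  ne : ∀ i, ∃ x ∈ P, dt (n i) x = c i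
  nonempty : P.Nonempty
  ver : ∀ v ∈ P, (∀ u, (∀ i, dt (n i) v = c i → dt (n i) u = 0) → u = 0) →
    {i | dt (n i) v = c i}.ncard = 3

namespace SPoly
variable {ι : Type} (S : SPoly ι)

def A (x : E3) : Set ι := {i | dt (S.n i) x = S.c i}
def IsV (v : E3) : Prop := v ∈ S.P ∧ ∀ u, (∀ i, i ∈ S.A v → dt (S.n i) u = 0) → u = 0
/-- Signed volume of the normals. -/
def o (i j k : ι) : ℝ := dd (S.n i) (S.n j) (S.n k)
def u (i j : ι) : E3 := cr (S.n i) (S.n j)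

lemma o_cyc (i j k : ι) : S.o j k i = S.o i j k := dd_cyc _ _ _
lemma o_swap (i j k : ι) : S.o j i k = - S.o i j k := dd_swap _ _ _
lemma o_ne {i j k : ι} (h : S.o i j k ≠ 0) : i ≠ j ∧ j ≠ k ∧ i ≠ k := by
  refine ⟨?_, ?_, ?_⟩ <;> rintro rfl <;> apply h
  · exact dd_12 _ _
  · exact dd_23 _ _
  · exact dd_13 _ _
lemma mem_A {x : E3} {i : ι} : i ∈ S.A x ↔ dt (S.n i) x = S.c i := Iff.rfl

lemma ncardA {v : E3} (h : S.IsV v) : (S.A v).ncard = 3 := S.ver v h.1 h.2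

lemma vert_of {v : E3} (h : S.IsV v) {i j k : ι} (hi : i ∈ S.A v) (hj : j ∈ S.A v) (hk : k ∈ S.A v)
    (hij : i ≠ j) (hjk : j ≠ k) (hik : i ≠ k) : S.A v = {i, j, k} ∧ S.o i j k ≠ 0 := by
  have := S.fin
  have e : S.A v = {i, j, k} := by
    symm
    apply Set.eq_of_subset_of_ncard_le
    · rintro _ (rfl | rfl | rfl) <;> assumption
    · rw [S.ncardA h, Set.ncard_eq_three.2 ⟨i, j, k, hij, hik, hjk, rfl⟩]
    · exact Set.toFinite _
  refine ⟨e, dd_ne_zero ?_⟩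
  intro u h1 h2 h3
  apply h.2
  rw [e]
  rintro l (rfl | rfl | rfl) <;> assumption

lemma vert {v : E3} (h : S.IsV v) : ∃ i j k, i ≠ j ∧ j ≠ k ∧ i ≠ k ∧ S.A v = {i, j, k} ∧ 0 < S.o i j k := by
  obtain ⟨i, j, k, hij, hik, hjk, e⟩ := Set.ncard_eq_three.1 (S.ncardA h)
  have := (S.vert_of h (i := i) (j := j) (k := k) (by simp [e]) (by simp [e]) (by simp [e]) hij hjk hik).2
  rcases lt_or_gt_of_ne this with h1 | h1
  · exact ⟨j, i, k, hij.symm, hik, hjk, by rw [e]; ext; simp; tauto, by rw [o_swap]; linarith⟩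
  · exact ⟨i, j, k, hij, hjk, hik, e, h1⟩

lemma move {x : E3} (hx : x ∈ S.P) {u : E3} (hu : ∀ i ∈ S.A x, dt (S.n i) u ≤ 0) :
    ∃ t : ℝ, 0 < t ∧ x + t • u ∈ S.P ∧ S.A (x + t • u) = {i | i ∈ S.A x ∧ dt (S.n i) u = 0} := by
  have := S.fin
  have h1 : ∀ i, ∀ᶠ t : ℝ in nhdsWithin 0 (Ioi 0), i ∉ S.A x → dt (S.n i) (x + t • u) < S.c i := by
    intro i
    by_cases hi : i ∈ S.A x
    · simp [hi]
    · have hc : Continuous (fun t : ℝ => dt (S.n i) (x + t • u)) := by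
        have := dt_cont (S.n i); fun_prop
      have h0 : dt (S.n i) (x + (0:ℝ) • u) < S.c i := by
        simp only [zero_smul, add_zero]
        exact lt_of_le_of_ne ((S.hP x).1 hx i) hi
      have := (hc.continuousAt.eventually (Iio_mem_nhds h0)).filter_mono
        (nhdsWithin_le_nhds : nhdsWithin (0:ℝ) (Ioi 0) ≤ nhds 0)
      filter_upwards [this] with t ht _
      exact ht
  have h2 := Filter.eventually_all.2 h1
  obtain ⟨t, ht, ht0⟩ := (h2.and (self_mem_nhdsWithin)).exists
  have ht0 : 0 < t := ht0
  refine ⟨t, ht0, ?_, ?_⟩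
  · rw [S.hP]
    intro i
    by_cases hi : i ∈ S.A x
    · rw [dt_add, dt_smul, hi]; nlinarith [hu i hi]
    · exact (ht i hi).le
  · ext i
    simp only [mem_A, mem_ofPred_eq]
    by_cases hi : i ∈ S.A x
    · rw [dt_add, dt_smul, hi]
      constructor
      · intro h
        refine ⟨rfl, ?_⟩
        have : t * dt (S.n i) u = 0 := by linarith
        exact (mul_eq_zero.1 this).resolve_left ht0.ne'
      · rintro ⟨-, h⟩; rw [h]; ring
    · constructor
      · intro h; exact absurd h (ht i hi).ne
      · intro h; exact absurd h.1 hi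

lemma face_cpt (T : Set ι) : IsCompact {x | x ∈ S.P ∧ T ⊆ S.A x} := by
  have : {x | x ∈ S.P ∧ T ⊆ S.A x} = S.P ∩ ⋂ i ∈ T, {x | dt (S.n i) x = S.c i} := by
    ext x; simp [Set.subset_def, mem_A]
  rw [this]
  apply S.cpt.inter_right
  apply isClosed_biInter
  intro i _
  exact isClosed_eq (dt_cont _) continuous_const

lemma exV {x : E3} (hx : x ∈ S.P) : ∃ v, S.IsV v ∧ S.A x ⊆ S.A v := by
  obtain ⟨v, hv⟩ := (S.face_cpt (S.A x)).extremePoints_nonempty ⟨x, hx, subset_rfl⟩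
  have hvE := hv.1
  rw [mem_extremePoints_iff_left] at hv
  refine ⟨v, ⟨hvE.1, ?_⟩, hvE.2⟩
  intro u hu
  by_contra hu0
  obtain ⟨t, ht, h1, h2⟩ := S.move hvE.1 (u := u) (fun i hi => (hu i hi).le)
  obtain ⟨s, hs, h3, h4⟩ := S.move hvE.1 (u := -u) (fun i hi => by
    have := hu i hi
    rw [show -u = (-1:ℝ) • u by simp, dt_smul, this]; simp)
  have e := hv.2 (v + t • u) ⟨h1, fun i hi => by
      rw [h2]; exact ⟨hvE.2 hi, hu i (hvE.2 hi)⟩⟩ 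
    (v + s • (-u)) ⟨h3, fun i hi => by
      rw [h4]; refine ⟨hvE.2 hi, ?_⟩
      rw [show -u = (-1:ℝ) • u by simp, dt_smul, hu i (hvE.2 hi)]; simp⟩ ?_
  · have : t • u = 0 := by simpa using e
    rcases smul_eq_zero.1 this with h | h
    · exact ht.ne' h
    · exact hu0 h
  · have hp : s + t ≠ 0 := by positivity
    refine ⟨s / (s + t), t / (s + t), by positivity, by positivity, by field_simp, ?_⟩
    have e : (s / (s + t)) • (v + t • u) + (t / (s + t)) • (v + s • -u) = 
      (s / (s + t) + t / (s + t)) • v := by module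
    rw [e]; rw [show s / (s + t) + t / (s + t) = 1 by field_simp, one_smul]

lemma three {x : E3} (hx : x ∈ S.P) {i j k : ι} (hi : i ∈ S.A x) (hj : j ∈ S.A x) (hk : k ∈ S.A x)
    (hij : i ≠ j) (hjk : j ≠ k) (hik : i ≠ k) : S.IsV x := by
  obtain ⟨v, hv, hs⟩ := S.exV hx
  have := (S.vert_of hv (hs hi) (hs hj) (hs hk) hij hjk hik).2
  refine ⟨hx, fun u hu => dd_ker this (hu i hi) (hu j hj) (hu k hk)⟩

lemma V_unique {v x : E3} (hv : S.IsV v) (h : S.A v ⊆ S.A x) : x = v := by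
  have := hv.2 (x - v) (fun i hi => by rw [dt_sub, h hi, hi]; ring)
  exact sub_eq_zero.1 this

lemma V_fin : {v | S.IsV v}.Finite := by
  have := S.fin
  apply Set.Finite.of_finite_image (f := S.A) (Set.toFinite _)
  intro v hv w hw h
  exact (S.V_unique hv h.le).symm

def Adj (i j : ι) : Prop := i ≠ j ∧ ∃ x ∈ S.P, i ∈ S.A x ∧ j ∈ S.A x

lemma Adj.symm {S : SPoly ι} {i j : ι} (h : S.Adj i j) : S.Adj j i :=
  ⟨h.1.symm, h.2.imp fun x hx => ⟨hx.1, hx.2.2, hx.2.1⟩⟩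

lemma adj_V {i j : ι} (h : S.Adj i j) : ∃ v k, S.IsV v ∧ S.A v = {i, j, k} ∧ S.o i j k ≠ 0 := by
  obtain ⟨hij, x, hx, hi, hj⟩ := h
  obtain ⟨v, hv, hs⟩ := S.exV hx
  have : ∃ k ∈ S.A v, k ≠ i ∧ k ≠ j := by
    by_contra hn
    push Not at hn
    have h1 : S.A v ⊆ {i, j} := by
      intro k hk
      by_cases h : k = i
      · simp [h]
      · simp [hn k hk h]
    have h2 := Set.ncard_le_ncard h1
    have h3 : ({i, j} : Set ι).ncard ≤ 2 := (Set.ncard_insert_le i {j}).trans (by rw [Set.ncard_singleton])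
    rw [S.ncardA hv] at h2; omega
  obtain ⟨k, hk, hki, hkj⟩ := this
  obtain ⟨h1, h2⟩ := S.vert_of hv (hs hi) (hs hj) hk hij hkj.symm hki.symm
  exact ⟨v, k, hv, h1, h2⟩

lemma edgept {i j : ι} (h : S.Adj i j) : ∃ m ∈ S.P, S.A m = {i, j} := by
  obtain ⟨v, k, hv, hA, ho⟩ := S.adj_V h
  have hne := S.o_ne ho
  obtain ⟨t, ht, h1, h2⟩ := S.move hv.1 (u := (-(S.o i j k)⁻¹) • S.u i j) (by
    rw [hA]
    rintro l (rfl | rfl | rfl)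
    · rw [dt_smul, u, dt_cr1]; simp
    · rw [dt_smul, u, dt_cr2]; simp
    · rw [dt_smul, u, dt_cr]
      change -(S.o i j l)⁻¹ * S.o i j l ≤ 0
      rw [neg_mul, inv_mul_cancel₀ ho]; norm_num)
  refine ⟨_, h1, ?_⟩
  rw [h2, hA]
  ext l
  simp only [mem_insert_iff, mem_singleton_iff, mem_ofPred_eq]
  constructor
  · rintro ⟨rfl | rfl | rfl, h⟩
    · simp
    · simp
    · rw [dt_smul, u, dt_cr] at h
      change -(S.o i j l)⁻¹ * S.o i j l = 0 at h
      rw [neg_mul, inv_mul_cancel₀ ho] at h; norm_num at h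
  · rintro (rfl | rfl)
    · refine ⟨by simp, ?_⟩
      rw [dt_smul, u, dt_cr1]; simp
    · refine ⟨by simp, ?_⟩
      rw [dt_smul, u, dt_cr2]; simp

/-- Every facet has a vertex with two other facets. -/
lemma fac_V (i : ι) : ∃ v j k, S.IsV v ∧ S.A v = {i, j, k} ∧ S.o i j k ≠ 0 := by
  obtain ⟨x, hx, hi⟩ := S.ne i
  obtain ⟨v, hv, hs⟩ := S.exV hx
  have hiv : i ∈ S.A v := hs hi
  obtain ⟨a, b, c, hab, hbc, hac, e, ho⟩ := S.vert hv
  rw [e] at hiv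
  rcases hiv with rfl | rfl | rfl
  · exact ⟨v, b, c, hv, e, ho.ne'⟩
  · exact ⟨v, c, a, hv, by rw [e]; ext; simp; tauto, by rw [o_cyc]; exact ho.ne'⟩
  · exact ⟨v, a, b, hv, by rw [e]; ext; simp; tauto, by rw [← o_cyc]; exact ho.ne'⟩

lemma adj_of_V {v : E3} (hv : v ∈ S.P) {i j : ι} (hi : i ∈ S.A v) (hj : j ∈ S.A v) (h : i ≠ j) : S.Adj i j :=
  ⟨h, v, hv, hi, hj⟩

lemma facetpt (i : ι) : ∃ m ∈ S.P, S.A m = {i} := by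
  obtain ⟨v, j, k, hv, hA, ho⟩ := S.fac_V i
  have hne := S.o_ne ho
  obtain ⟨x, hx, hAx⟩ := S.edgept (S.adj_of_V hv.1 (i := i) (j := j) (by simp [hA]) (by simp [hA]) hne.1)
  obtain ⟨y, hy, hAy⟩ := S.edgept (S.adj_of_V hv.1 (i := i) (j := k) (by simp [hA]) (by simp [hA]) hne.2.2)
  have e : ∀ l, dt (S.n l) ((1/2 : ℝ) • x + (1/2 : ℝ) • y) = (dt (S.n l) x + dt (S.n l) y) / 2 := by
    intro l; rw [dt_add, dt_smul, dt_smul]; ring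
  have hx' := (S.hP x).1 hx
  have hy' := (S.hP y).1 hy
  refine ⟨(1/2 : ℝ) • x + (1/2 : ℝ) • y, ?_, ?_⟩
  · rw [S.hP]; intro l; rw [e]; linarith [hx' l, hy' l]
  · ext l
    rw [mem_A, e]
    constructor
    · intro h
      have h1 : l ∈ S.A x := by rw [mem_A]; linarith [hx' l, hy' l]
      have h2 : l ∈ S.A y := by rw [mem_A]; linarith [hx' l, hy' l]
      rw [hAx] at h1; rw [hAy] at h2
      rcases h1 with h1 | h1
      · exact h1
      · rcases h2 with h2 | h2
        · exact h2
        · exact absurd (h1.symm.trans h2) hne.2.1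
    · intro h
      rw [mem_singleton_iff.1 h]
      have h1 : i ∈ S.A x := by rw [hAx]; simp
      have h2 : i ∈ S.A y := by rw [hAy]; simp
      rw [mem_A] at h1 h2; linarith

lemma nx_ex {i j : ι} (h : S.Adj i j) : ∃ k v, S.IsV v ∧ S.A v = {i, j, k} ∧ 0 < S.o i j k := by
  obtain ⟨v0, k0, hv0, hA0, ho0⟩ := S.adj_V h
  have hu0 : S.u i j ≠ 0 := by
    intro h0
    apply ho0
    have := dt_cr (S.n i) (S.n j) (S.n k0)
    change _ = S.o i j k0 at this
    rw [← this]
    change dt _ (S.u i j) = 0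
    rw [h0, dt_zero]
  obtain ⟨v, ⟨hvP, hvA⟩, hmax⟩ := (S.face_cpt {i, j}).exists_isMaxOn 
    ⟨v0, hv0.1, by rw [hA0]; intro l; simp; tauto⟩ (dt_cont (S.u i j).ofLp).continuousOn
  have hi : i ∈ S.A v := hvA (by simp)
  have hj : j ∈ S.A v := hvA (by simp)
  have hex : ∃ k ∈ S.A v, 0 < dt (S.n k) (S.u i j) := by
    by_contra hn
    push Not at hn
    obtain ⟨t, ht, h1, h2⟩ := S.move hvP hn
    have := hmax (a := v + t • S.u i j) ⟨h1, by
      rw [h2]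
      rintro l (rfl | rfl)
      · exact ⟨hi, dt_cr1 _ _⟩
      · exact ⟨hj, dt_cr2 _ _⟩⟩
    simp only [mem_ofPred_eq] at this
    rw [dt_add, dt_smul] at this
    have := dt_self_pos hu0
    nlinarith
  obtain ⟨k, hk, hpos⟩ := hex
  have ho : 0 < S.o i j k := by
    have := dt_cr (S.n i) (S.n j) (S.n k)
    change dt _ (S.u i j) = S.o i j k at this
    linarith
  have hne := S.o_ne ho.ne'
  have hv := S.three hvP hi hj hk hne.1 hne.2.1 hne.2.2
  exact ⟨k, v, hv, (S.vert_of hv hi hj hk hne.1 hne.2.1 hne.2.2).1, ho⟩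

lemma nx_unique {i j k k' : ι} {x x' : E3} (hx : x ∈ S.P) (hx' : x' ∈ S.P)
    (hi : i ∈ S.A x) (hj : j ∈ S.A x) (hk : k ∈ S.A x) 
    (hi' : i ∈ S.A x') (hj' : j ∈ S.A x') (hk' : k' ∈ S.A x') 
    (ho : 0 < S.o i j k) (ho' : 0 < S.o i j k') : k = k' ∧ x = x' := by
  obtain ⟨s, hs⟩ := dd_line (u := x' - x) ho.ne' (by rw [dt_sub, hi, hi']; ring) (by rw [dt_sub, hj, hj']; ring)
  have e1 : dt (S.n k) (x' - x) = s * S.o i j k := by rw [hs, dt_smul, dt_cr]; rfl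
  have e2 : dt (S.n k') (x' - x) = s * S.o i j k' := by rw [hs, dt_smul, dt_cr]; rfl
  rw [dt_sub, hk] at e1
  rw [dt_sub, hk'] at e2
  have h1 := (S.hP x').1 hx' k
  have h2 := (S.hP x).1 hx k'
  have s0 : s = 0 := by
    apply le_antisymm <;> by_contra hn <;> push Not at hn <;> nlinarith
  have hxx : x = x' := by
    rw [s0, zero_smul] at hs; exact (sub_eq_zero.1 hs).symm
  refine ⟨?_, hxx⟩
  subst hxx
  have hne := S.o_ne ho.ne'
  have hne' := S.o_ne ho'.ne'
  have := (S.vert_of (S.three hx hi hj hk hne.1 hne.2.1 hne.2.2) hi hj hk hne.1 hne.2.1 hne.2.2).1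
  rw [this] at hk'
  rcases hk' with h | h | h
  · exact absurd h.symm hne'.2.2
  · exact absurd h.symm hne'.2.1
  · exact h.symm

end SPoly
end

section
namespace SPoly
variable {ι : Type} (S : SPoly ι)

lemma other {w : E3} (hw : S.IsV w) {i j k : ι} (hA : S.A w = {i, j, k}) (ho : 0 < S.o i j k) :
    ∃ (w' : E3) (s : ℝ), S.IsV w' ∧ 0 < s ∧ w' = w - s • S.u j k ∧ j ∈ S.A w' ∧ k ∈ S.A w' := by
  have hne := S.o_ne ho.ne'
  have hi : i ∈ S.A w := by simp [hA]
  have hj : j ∈ S.A w := by simp [hA]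
  have hk : k ∈ S.A w := by simp [hA]
  obtain ⟨l, w', hw', hA', ho'⟩ := S.nx_ex (S.adj_of_V hw.1 hk hj hne.2.1.symm)
  have hne' := S.o_ne ho'.ne'
  have hj' : j ∈ S.A w' := by simp [hA']
  have hk' : k ∈ S.A w' := by simp [hA']
  have hl' : l ∈ S.A w' := by simp [hA']
  have ho1 : dd (S.n j) (S.n k) (S.n i) ≠ 0 := by
    have := S.o_cyc i j k; unfold o at this; rw [this]; exact ho.ne'
  obtain ⟨s, hs⟩ := dd_line (u := w' - w) ho1 (by rw [dt_sub, hj, hj']; ring) (by rw [dt_sub, hk, hk']; ring)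
  have e1 : dt (S.n l) (w' - w) = s * S.o j k l := by rw [hs, dt_smul, dt_cr]; rfl
  rw [dt_sub, hl'] at e1
  have h2 := (S.hP w).1 hw.1 l
  have h3 : S.o j k l = - S.o k j l := S.o_swap k j l
  have hs0 : s ≠ 0 := by
    intro h0
    rw [h0, zero_smul] at hs
    have : w' = w := sub_eq_zero.1 hs
    rw [this, hA] at hl'
    rcases hl' with h | h | h
    · have h5 : S.o j k i = S.o i j k := S.o_cyc i j k
      rw [h] at h3 ho'; linarith
    · exact hne'.2.1 h.symm
    · exact hne'.2.2 h.symm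
  have : s < 0 := by
    by_contra hn
    have : 0 < s := lt_of_le_of_ne (not_lt.1 hn) hs0.symm
    nlinarith
  refine ⟨w', -s, hw', by linarith, ?_, hj', hk'⟩
  rw [neg_smul, sub_neg_eq_add]
  change _ = w + s • cr (S.n j) (S.n k)
  rw [← hs]; abel

lemma closure (T : Set ι) (W : Set E3) (hWV : ∀ w ∈ W, S.IsV w ∧ T ⊆ S.A w) (hne : W.Nonempty)
    (hcl : ∀ w ∈ W, ∀ w', S.IsV w' → T ⊆ S.A w' →
      (∃ a b, a ≠ b ∧ a ∈ S.A w ∧ b ∈ S.A w ∧ a ∈ S.A w' ∧ b ∈ S.A w') → w' ∈ W)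
    {w' : E3} (hw' : S.IsV w') (hT : T ⊆ S.A w') : w' ∈ W := by
  obtain ⟨a, b, c, hab, hbc, hac, e, ho⟩ := S.vert hw'
  have ha' : a ∈ S.A w' := by simp [e]
  have hb' : b ∈ S.A w' := by simp [e]
  have hc' : c ∈ S.A w' := by simp [e]
  set g : Fin 3 → ℝ := S.n a + S.n b + S.n c with hg
  obtain ⟨w, hwW, hmax⟩ := Set.exists_max_image W (dt g) 
    (S.V_fin.subset fun w hw => (hWV w hw).1) hne
  obtain ⟨hw, hTw⟩ := hWV w hwW
  obtain ⟨i, j, k, hij, hjk, hik, e2, ho2⟩ := S.vert hw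
  have key : ∀ i j k, S.A w = {i, j, k} → 0 < S.o i j k →
      dt (S.n i) (w' - w) * dt g (S.u j k) ≤ 0 := by
    intro i j k e2 ho2
    have hne := S.o_ne ho2.ne'
    have hi : i ∈ S.A w := by simp [e2]
    have hj : j ∈ S.A w := by simp [e2]
    have hk : k ∈ S.A w := by simp [e2]
    by_cases hiT : i ∈ T
    · rw [dt_sub, hT hiT, hi]; simp
    · obtain ⟨w2, s, hw2, hs, hw2e, hj2, hk2⟩ := S.other hw e2 ho2
      have : w2 ∈ W := by
        refine hcl w hwW w2 hw2 ?_ ⟨j, k, hne.2.1, hj, hk, hj2, hk2⟩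
        intro l hl
        have := hTw hl
        rw [e2] at this
        rcases this with h | h | h
        · rw [h] at hl; exact absurd hl hiT
        · rw [h]; exact hj2
        · rw [h]; exact hk2
      have h1 := hmax w2 this
      rw [hw2e, dt_sub, dt_smul] at h1
      have h2 : 0 ≤ dt g (S.u j k) := by
        by_contra hn
        push Not at hn
        nlinarith
      have h3 := (S.hP w').1 hw'.1 i
      rw [dt_sub, hi]
      nlinarith
  have h1 := key i j k e2 ho2
  have h2 := key j k i (by rw [e2]; ext; simp; tauto) (by rw [o_cyc]; exact ho2)
  have h3 := key k i j (by rw [e2]; ext; simp; tauto) (by rw [← o_cyc]; exact ho2)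
  have h4 := congrArg (dt g) (cramer (S.n i) (S.n j) (S.n k) (w' - w))
  simp only [dt_add, dt_smul] at h4
  have h5 : dt g (w' - w) ≤ 0 := by
    by_contra hn
    push Not at hn
    have : 0 < dd (S.n i) (S.n j) (S.n k) * dt g (w' - w) := mul_pos ho2 hn
    change _ = _ * dt g (S.u j k) + _ * dt g (S.u k i) + _ * dt g (S.u i j) at h4
    linarith
  rw [dt_sub, hg, dt_addl, dt_addl, dt_addl, dt_addl, ha', hb', hc'] at h5
  have q := (S.hP w).1 hw.1
  have : w = w' := by
    apply S.V_unique hw'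
    rw [e]
    rintro l (rfl | rfl | rfl)
    · rw [mem_A]; linarith [q l, q b, q c]
    · rw [mem_A]; linarith [q a, q l, q c]
    · rw [mem_A]; linarith [q a, q b, q l]
  rw [← this]; exact hwW

/-- Darts. -/
abbrev Dart : Type := {p : ι × ι // S.Adj p.1 p.2}

variable {S}
def nx (d : S.Dart) : ι := (S.nx_ex d.2).choose
def vtx (d : S.Dart) : E3 := (S.nx_ex d.2).choose_spec.choose
lemma vtx_spec (d : S.Dart) : S.IsV (vtx d) ∧ S.A (vtx d) = {d.1.1, d.1.2, nx d} ∧ 0 < S.o d.1.1 d.1.2 (nx d) :=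
  (S.nx_ex d.2).choose_spec.choose_spec
lemma vtx_V (d : S.Dart) : S.IsV (vtx d) := (vtx_spec d).1
lemma vtx1 (d : S.Dart) : d.1.1 ∈ S.A (vtx d) := by rw [(vtx_spec d).2.1]; simp
lemma vtx2 (d : S.Dart) : d.1.2 ∈ S.A (vtx d) := by rw [(vtx_spec d).2.1]; simp
lemma vtx3 (d : S.Dart) : nx d ∈ S.A (vtx d) := by rw [(vtx_spec d).2.1]; simp
lemma nx_ne (d : S.Dart) : d.1.1 ≠ nx d ∧ d.1.2 ≠ nx d := by
  have := S.o_ne (vtx_spec d).2.2.ne'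
  exact ⟨this.2.2, this.2.1⟩
lemma nx_eq (d : S.Dart) {x : E3} {k : ι} (hx : x ∈ S.P) (h1 : d.1.1 ∈ S.A x) (h2 : d.1.2 ∈ S.A x)
    (h3 : k ∈ S.A x) (ho : 0 < S.o d.1.1 d.1.2 k) : nx d = k ∧ vtx d = x :=
  S.nx_unique (vtx_V d).1 hx (vtx1 d) (vtx2 d) (vtx3 d) h1 h2 h3 (vtx_spec d).2.2 ho

def sw (d : S.Dart) : S.Dart := ⟨(d.1.2, d.1.1), d.2.symm⟩
def rot (d : S.Dart) : S.Dart := ⟨(d.1.1, nx d), S.adj_of_V (vtx_V d).1 (vtx1 d) (vtx3 d) (nx_ne d).1⟩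
def rot' (d : S.Dart) : S.Dart := 
  ⟨(d.1.1, nx (sw d)), S.adj_of_V (vtx_V (sw d)).1 (vtx2 (sw d)) (vtx3 (sw d)) (nx_ne (sw d)).2⟩

lemma dart_ext {d e : S.Dart} (h1 : d.1.1 = e.1.1) (h2 : d.1.2 = e.1.2) : d = e :=
  Subtype.ext (Prod.ext h1 h2)

lemma nx_rot' (d : S.Dart) : nx (rot' d) = d.1.2 ∧ vtx (rot' d) = vtx (sw d) := by
  apply nx_eq (rot' d) (vtx_V (sw d)).1 (vtx2 (sw d)) (vtx3 (sw d)) (vtx1 (sw d))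
  change 0 < S.o d.1.1 (nx (sw d)) d.1.2
  rw [S.o_cyc]
  exact (vtx_spec (sw d)).2.2
lemma nx_swrot (d : S.Dart) : nx (sw (rot d)) = d.1.2 ∧ vtx (sw (rot d)) = vtx d := by
  apply nx_eq (sw (rot d)) (vtx_V d).1 (vtx3 d) (vtx1 d) (vtx2 d)
  change 0 < S.o (nx d) d.1.1 d.1.2
  rw [← S.o_cyc]
  exact (vtx_spec d).2.2

def rotE : Equiv.Perm S.Dart where
  toFun := rot
  invFun := rot'
  left_inv d := dart_ext rfl (nx_swrot d).1
  right_inv d := dart_ext rfl (nx_rot' d).1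

lemma rotE_apply (d : S.Dart) : rotE d = rot d := rfl
lemma rotE_inv (d : S.Dart) : rotE⁻¹ d = rot' d := rfl

lemma rotE_fst (k : ℤ) (d : S.Dart) : ((rotE ^ k) d).1.1 = d.1.1 := by
  induction k using Int.induction_on generalizing d with
  | zero => simp
  | succ i ih => rw [zpow_add_one, Equiv.Perm.mul_apply, ih]; rfl
  | pred i ih => rw [zpow_sub_one, Equiv.Perm.mul_apply, ih]; rfl

lemma third {w : E3} (hw : S.IsV w) {i j l : ι} (hi : i ∈ S.A w) (hj : j ∈ S.A w) (hl : l ∈ S.A w)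
    (hij : i ≠ j) (hil : i ≠ l) (hjl : j ≠ l) (d : S.Dart) (hd : d.1 = (i, j)) :
    (rot d).1 = (i, l) ∨ (rot' d).1 = (i, l) := by
  obtain ⟨e, ho⟩ := S.vert_of hw hi hj hl hij hjl hil
  obtain ⟨⟨i', j'⟩, hadj⟩ := d
  cases hd
  rcases lt_or_gt_of_ne ho with h | h
  · right
    have := (nx_eq (sw ⟨(i, j), hadj⟩) hw.1 hj hi hl (by change 0 < S.o j i l; rw [o_swap]; linarith)).1
    unfold rot'
    change (i, _) = (i, l)
    rw [this]
  · left
    have := (nx_eq ⟨(i, j), hadj⟩ hw.1 hi hj hl h).1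
    unfold rot
    change (i, _) = (i, l)
    rw [this]

lemma rot_trans (d d' : S.Dart) (h : d.1.1 = d'.1.1) : ∃ k : ℤ, (rotE ^ k) d = d' := by
  obtain ⟨⟨i, j0⟩, hd⟩ := d
  obtain ⟨⟨i', j1⟩, hd'⟩ := d'
  change i = i' at h
  subst h
  set X : Set ι := {j | ∃ k : ℤ, ((rotE ^ k) (⟨(i, j0), hd⟩ : S.Dart)).1 = (i, j)} with hX
  have hstep : ∀ w j l, S.IsV w → i ∈ S.A w → j ∈ S.A w → l ∈ S.A w → i ≠ j → i ≠ l → j ∈ X → l ∈ X := by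
    intro w j l hw hi hj hl hij hil hjX
    by_cases hjl : j = l
    · rw [← hjl]; exact hjX
    · obtain ⟨k, hk⟩ := hjX
      rcases third hw hi hj hl hij hil hjl _ hk with h | h
      · refine ⟨1 + k, ?_⟩
        rw [zpow_add, Equiv.Perm.mul_apply, zpow_one]; exact h
      · refine ⟨-1 + k, ?_⟩
        rw [zpow_add, Equiv.Perm.mul_apply, zpow_neg_one]; exact h
  have hj0 : j0 ∈ X := ⟨0, by simp⟩
  have hmem := S.closure {i} {w | S.IsV w ∧ i ∈ S.A w ∧ ∃ j ∈ X, i ≠ j ∧ j ∈ S.A w} 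
    (fun w hw => ⟨hw.1, by rintro l rfl; exact hw.2.1⟩)
    ⟨vtx ⟨(i, j0), hd⟩, vtx_V _, vtx1 _, j0, hj0, hd.1, vtx2 (⟨(i, j0), hd⟩ : S.Dart)⟩ 
    (by
      rintro w ⟨hw, hiw, j, hjX, hij, hjw⟩ w' hw' hT ⟨a, b, hab, ha, hb, ha', hb'⟩
      have hiw' : i ∈ S.A w' := hT rfl
      refine ⟨hw', hiw', ?_⟩
      by_cases hia : i = a
      · have hib : i ≠ b := fun h => hab (hia.symm.trans h)
        exact ⟨b, hstep w j b hw hiw hjw hb hij hib hjX, hib, hb'⟩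
      · exact ⟨a, hstep w j a hw hiw hjw ha hij hia hjX, hia, ha'⟩)
    (vtx_V ⟨(i, j1), hd'⟩) (by rintro l rfl; exact vtx1 _)
  obtain ⟨hw, hiw, j, hjX, hij, hjw⟩ := hmem
  obtain ⟨k, hk⟩ := hstep _ j j1 hw hiw hjw (vtx2 (⟨(i, j1), hd'⟩ : S.Dart)) hij hd'.1 hjX
  exact ⟨k, Subtype.ext hk⟩

lemma all_conn (X : Set ι) (hX : X.Nonempty) (hcl : ∀ i j, S.Adj i j → i ∈ X → j ∈ X) (i : ι) : i ∈ X := by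
  obtain ⟨i0, hi0⟩ := hX
  obtain ⟨v, j, k, hv, hA, -⟩ := S.fac_V i
  obtain ⟨v0, j0, k0, hv0, hA0, -⟩ := S.fac_V i0
  have hmem := S.closure ∅ {w | S.IsV w ∧ ∃ j ∈ X, j ∈ S.A w} (fun w hw => ⟨hw.1, by simp⟩)
    ⟨v0, hv0, i0, hi0, by simp [hA0]⟩
    (by
      rintro w ⟨hw, j, hjX, hjw⟩ w' hw' hT ⟨a, b, hab, ha, hb, ha', hb'⟩
      refine ⟨hw', a, ?_, ha'⟩
      by_cases hja : j = a
      · rw [← hja]; exact hjX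
      · exact hcl j a (S.adj_of_V hw.1 hjw ha hja) hjX) hv (by simp)
  obtain ⟨-, l, hlX, hl⟩ := hmem
  by_cases hli : l = i
  · rw [← hli]; exact hlX
  · exact hcl l i (S.adj_of_V hv.1 hl (by simp [hA]) hli) hlX

variable (S) in
/-- Number of neighbours. -/
def deg (i : ι) : ℕ := {j | S.Adj i j}.ncard

instance dartFin : Finite S.Dart := by
  have := S.fin
  exact Subtype.finite

lemma deg_eq (i : ι) : {d : S.Dart | d.1.1 = i}.ncard = S.deg i := by
  unfold deg
  rw [← Set.ncard_image_of_injOn (f := fun d : S.Dart => d.1.2)]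
  · congr 1
    ext j
    constructor
    · rintro ⟨d, rfl, rfl⟩; exact d.2
    · intro h; exact ⟨⟨(i, j), h⟩, rfl, rfl⟩
  · intro d hd e he h
    exact dart_ext (hd.trans he.symm) h

lemma rot_per (k : ℤ) (d : S.Dart) : (rotE ^ k) d = d ↔ (S.deg d.1.1 : ℤ) ∣ k := by
  have hfin := Set.toFinite {e : S.Dart | e.1.1 = d.1.1}
  have hc : (rotE (S := S)).IsCycleOn (hfin.toFinset : Set S.Dart) := by
    rw [Set.Finite.coe_toFinset]
    refine ⟨⟨fun e he => he, (rotE (S := S)).injective.injOn, ?_⟩, ?_⟩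
    · intro e he
      exact ⟨rotE.symm e, he, by simp⟩
    · intro e he e' he'
      exact rot_trans e e' (he.trans he'.symm)
  rw [hc.zpow_apply_eq (by simp), ← deg_eq, Set.ncard_eq_toFinset_card _ hfin]

variable (S) in
def toCMap (h56 : ∀ i, S.deg i = 5 ∨ S.deg i = 6) (hp : ∃ i, S.deg i = 5) : CMap S.Dart ι where
  r := rotE
  a := sw
  f d := d.1.1
  N := S.deg
  aa d := rfl
  ara d := dart_ext rfl (nx_rot' d).1.symm
  fr d := rfl
  per := rot_per
  trans := rot_trans
  surj i := by
    obtain ⟨v, j, k, hv, hA, ho⟩ := S.fac_V i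
    exact ⟨⟨(i, j), S.adj_of_V hv.1 (by simp [hA]) (by simp [hA]) (S.o_ne ho).1⟩, rfl⟩
  ne d := d.2.1.symm
  uniq d d' := dart_ext
  conn X hX h F := all_conn X hX (fun i j hij hi => h ⟨(i, j), hij⟩ hi) F
  N56 := h56
  pent := hp

end SPoly
end

section
namespace SPoly
variable {ι : Type} {S : SPoly ι}

def tau (d : S.Dart) : S.Dart := ⟨(d.1.2, nx d), S.adj_of_V (vtx_V d).1 (vtx2 d) (vtx3 d) (nx_ne d).2⟩

lemma nx_tau (d : S.Dart) : nx (tau d) = d.1.1 ∧ vtx (tau d) = vtx d := by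
  apply nx_eq (tau d) (vtx_V d).1 (vtx2 d) (vtx3 d) (vtx1 d)
  change 0 < S.o d.1.2 (nx d) d.1.1
  rw [S.o_cyc]
  exact (vtx_spec d).2.2

lemma tau3 (d : S.Dart) : tau (tau (tau d)) = d := by
  apply dart_ext
  · exact (nx_tau d).1
  · exact (nx_tau (tau d)).1

def tauE : Equiv.Perm S.Dart where
  toFun := tau
  invFun d := tau (tau d)
  left_inv := tau3
  right_inv := tau3

lemma tau_fst (d : S.Dart) : (tau d).1.1 = d.1.2 := rfl
lemma tau2_fst (d : S.Dart) : (tau (tau d)).1.1 = nx d := rfl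
lemma tau2_snd (d : S.Dart) : (tau (tau d)).1.2 = d.1.1 := (nx_tau d).1

lemma corner_unique {d d' : S.Dart} (h : d.1.1 = d'.1.1) (hv : vtx d = vtx d') : d = d' := by
  apply dart_ext h
  have h1 := vtx2 d'
  rw [← hv, (vtx_spec d).2.1] at h1
  rcases h1 with h1 | h1 | h1
  · exact absurd (h.symm.trans h1.symm) d'.2.1
  · exact h1.symm
  · exfalso
    have h2 := vtx3 d'
    rw [← hv, (vtx_spec d).2.1] at h2
    rcases h2 with h2 | h2 | h2
    · exact (nx_ne d').1 (h.symm.trans h2.symm)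
    · have h3 := (vtx_spec d').2.2
      have h4 := (vtx_spec d).2.2
      rw [h2, h1, ← h] at h3
      have h5 := S.o_swap d.1.1 (nx d) d.1.2
      have h6 := S.o_cyc d.1.1 d.1.2 (nx d)
      have h7 := S.o_cyc d.1.1 (nx d) d.1.2
      have h8 := S.o_swap d.1.2 (nx d) d.1.1
      linarith
    · exact (nx_ne d').2 (h1.trans h2.symm)

lemma corner_ex {w : E3} (hw : S.IsV w) {i : ι} (hi : i ∈ S.A w) : ∃ d : S.Dart, d.1.1 = i ∧ vtx d = w := by
  obtain ⟨a, b, c, hab, hbc, hac, e, ho⟩ := S.vert hw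
  have ha : a ∈ S.A w := by simp [e]
  have hb : b ∈ S.A w := by simp [e]
  have hc : c ∈ S.A w := by simp [e]
  have h := (nx_eq (⟨(a, b), S.adj_of_V hw.1 ha hb hab⟩ : S.Dart) hw.1 ha hb hc ho)
  rw [e] at hi
  rcases hi with rfl | rfl | rfl
  · exact ⟨_, rfl, h.2⟩
  · exact ⟨tau ⟨(a, i), S.adj_of_V hw.1 ha hb hab⟩, rfl, (nx_tau _).2.trans h.2⟩
  · exact ⟨tau (tau ⟨(a, b), S.adj_of_V hw.1 ha hb hab⟩), h.1, (nx_tau _).2.trans ((nx_tau _).2.trans h.2)⟩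

def gs (g : Fin 3 → ℝ) (d : S.Dart) : ℝ := dt g (S.u d.1.1 d.1.2)

lemma cram (g : Fin 3 → ℝ) (d : S.Dart) (y : E3) :
    S.o d.1.1 d.1.2 (nx d) * (dt g y - dt g (vtx d)) =
      (dt (S.n d.1.1) y - S.c d.1.1) * gs g (tau d) + (dt (S.n d.1.2) y - S.c d.1.2) * gs g (tau (tau d))
      + (dt (S.n (nx d)) y - S.c (nx d)) * gs g d := by
  have h4 := congrArg (dt g) (cramer (S.n d.1.1) (S.n d.1.2) (S.n (nx d)) (y - vtx d))
  simp only [dt_add, dt_smul, dt_sub] at h4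
  rw [vtx1 d, vtx2 d, vtx3 d] at h4
  have e3 : gs g (tau (tau d)) = dt g (S.u (nx d) d.1.1) := by
    unfold gs; rw [tau2_fst, tau2_snd]
  rw [e3]
  exact h4

lemma top_lt {g : Fin 3 → ℝ} {d : S.Dart} (h1 : 0 < gs g d) (h2 : 0 < gs g (tau (tau d)))
    {y : E3} (hy : y ∈ S.P) (h3 : d.1.1 ∈ S.A y ∨ 0 < gs g (tau d)) (hne : y ≠ vtx d) : 
    dt g y < dt g (vtx d) := by
  by_contra hn
  push Not at hn
  have hc := cram g d y
  have ho := (vtx_spec d).2.2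
  have q := (S.hP y).1 hy
  have q1 := q d.1.1
  have q2 := q d.1.2
  have q3 := q (nx d)
  have hnn : 0 ≤ S.o d.1.1 d.1.2 (nx d) * (dt g y - dt g (vtx d)) := 
    mul_nonneg ho.le (by linarith)
  have t1 : (dt (S.n d.1.1) y - S.c d.1.1) * gs g (tau d) ≤ 0 := by
    rcases h3 with h3 | h3
    · rw [h3]; simp
    · exact mul_nonpos_of_nonpos_of_nonneg (by linarith) h3.le
  have t2 : (dt (S.n d.1.2) y - S.c d.1.2) * gs g (tau (tau d)) ≤ 0 := 
    mul_nonpos_of_nonpos_of_nonneg (by linarith) h2.le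
  have t3 : (dt (S.n (nx d)) y - S.c (nx d)) * gs g d ≤ 0 := 
    mul_nonpos_of_nonpos_of_nonneg (by linarith) h1.le
  have z1 : (dt (S.n d.1.1) y - S.c d.1.1) * gs g (tau d) = 0 := by linarith
  have z2 : (dt (S.n d.1.2) y - S.c d.1.2) * gs g (tau (tau d)) = 0 := by linarith
  have z3 : (dt (S.n (nx d)) y - S.c (nx d)) * gs g d = 0 := by linarith
  apply hne
  apply S.V_unique (vtx_V d)
  rw [(vtx_spec d).2.1]
  rintro l (rfl | rfl | rfl)
  · rcases h3 with h3 | h3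
    · exact h3
    · exact sub_eq_zero.1 ((mul_eq_zero.1 z1).resolve_right h3.ne')
  · exact sub_eq_zero.1 ((mul_eq_zero.1 z2).resolve_right h2.ne')
  · exact sub_eq_zero.1 ((mul_eq_zero.1 z3).resolve_right h1.ne')

/-- Opposite vertex of the edge through `d`. -/
lemma other' (d : S.Dart) : ∃ (w : E3) (s : ℝ), S.IsV w ∧ 0 < s ∧ w = vtx d - s • S.u d.1.1 d.1.2 ∧ 
    d.1.1 ∈ S.A w ∧ d.1.2 ∈ S.A w := by
  refine S.other (vtx_V d) (i := nx d) (j := d.1.1) (k := d.1.2) ?_ ?_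
  · rw [(vtx_spec d).2.1]; ext; simp; tauto
  · rw [← S.o_cyc]; exact (vtx_spec d).2.2

lemma gs_pos {g : Fin 3 → ℝ} (hg : ∀ d : S.Dart, gs g d ≠ 0) (d : S.Dart)
    (h : ∀ w, S.IsV w → d.1.1 ∈ S.A w → d.1.2 ∈ S.A w → dt g w ≤ dt g (vtx d)) : 0 < gs g d := by
  obtain ⟨w, s, hw, hs, e, h1, h2⟩ := other' d
  have h3 := h w hw h1 h2
  rw [e, dt_sub, dt_smul] at h3
  change dt g (vtx d) - s * gs g d ≤ _ at h3
  refine lt_of_le_of_ne ?_ (hg d).symm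
  by_contra hn
  push Not at hn
  nlinarith

def Mx (g : Fin 3 → ℝ) (d : S.Dart) : Prop := 0 < gs g d ∧ 0 < gs g (tau (tau d))
def Al (g : Fin 3 → ℝ) (d : S.Dart) : Prop := 0 < gs g d ∧ 0 < gs g (tau d) ∧ 0 < gs g (tau (tau d))

lemma Mx_ex {g : Fin 3 → ℝ} (hg : ∀ d : S.Dart, gs g d ≠ 0) (i : ι) : ∃ d : S.Dart, d.1.1 = i ∧ Mx g d := by
  obtain ⟨v, j, k, hv, hA, -⟩ := S.fac_V i
  obtain ⟨w, ⟨hw, hiw⟩, hmax⟩ := Set.exists_max_image {w | S.IsV w ∧ i ∈ S.A w} (dt g)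
    (S.V_fin.subset fun w hw => hw.1) ⟨v, hv, by simp [hA]⟩
  obtain ⟨d, rfl, rfl⟩ := corner_ex hw hiw
  refine ⟨d, rfl, gs_pos hg d fun w h1 h2 _ => hmax w ⟨h1, h2⟩, gs_pos hg _ fun w h1 _ h2 => ?_⟩
  rw [(nx_tau _).2, (nx_tau _).2]
  rw [tau2_snd] at h2
  exact hmax w ⟨h1, h2⟩

lemma Mx_unique {g : Fin 3 → ℝ} {d d' : S.Dart} (h : Mx g d) (h' : Mx g d') (e : d.1.1 = d'.1.1) : d = d' := by
  apply corner_unique e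
  by_contra hne
  have h1 := top_lt h.1 h.2 (vtx_V d').1 (Or.inl (e ▸ vtx1 d')) (Ne.symm hne)
  have h2 := top_lt h'.1 h'.2 (vtx_V d).1 (Or.inl (e ▸ vtx1 d)) hne
  linarith

lemma Al_ex [Nonempty S.Dart] {g : Fin 3 → ℝ} (hg : ∀ d : S.Dart, gs g d ≠ 0) : ∃ d : S.Dart, Al g d := by
  obtain ⟨d, -, hmax⟩ := Set.exists_max_image (univ : Set S.Dart) (fun d => dt g (vtx d)) (Set.toFinite _) univ_nonempty
  have key : ∀ d' : S.Dart, vtx d' = vtx d → 0 < gs g d' := by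
    intro d' h
    apply gs_pos hg
    intro w hw h1 _
    obtain ⟨e, -, rfl⟩ := corner_ex hw h1
    rw [h]
    exact hmax e trivial
  exact ⟨d, key d rfl, key _ (nx_tau d).2, key _ ((nx_tau _).2.trans (nx_tau d).2)⟩

lemma Al_tau {g : Fin 3 → ℝ} {d : S.Dart} (h : Al g d) : Al g (tau d) :=
  ⟨h.2.1, h.2.2, by rw [tau3]; exact h.1⟩

lemma vtx_fib {d d' : S.Dart} (h : vtx d' = vtx d) : d' = d ∨ d' = tau d ∨ d' = tau (tau d) := by
  have h1 := vtx1 d'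
  rw [h, (vtx_spec d).2.1] at h1
  rcases h1 with h1 | h1 | h1
  · left; exact corner_unique h1 h
  · right; left; exact corner_unique h1 (h.trans (nx_tau d).2.symm)
  · right; right; exact corner_unique h1 (h.trans ((nx_tau _).2.trans (nx_tau d).2).symm)

lemma Al_iff {g : Fin 3 → ℝ} {d d' : S.Dart} (h : Al g d) : 
    Al g d' ↔ d' = d ∨ d' = tau d ∨ d' = tau (tau d) := by
  constructor
  · intro h'
    apply vtx_fib
    by_contra hne
    have h1 := top_lt h.1 h.2.2 (vtx_V d').1 (Or.inr h.2.1) hne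
    have h2 := top_lt h'.1 h'.2.2 (vtx_V d).1 (Or.inr h'.2.1) (Ne.symm hne)
    linarith
  · rintro (rfl | rfl | rfl)
    · exact h
    · exact Al_tau h
    · exact Al_tau (Al_tau h)

lemma tau_ne (d : S.Dart) : tau d ≠ d := fun h => d.2.1 (congrArg (fun d : S.Dart => d.1.1) h).symm
lemma tau2_ne (d : S.Dart) : tau (tau d) ≠ d := fun h => (nx_ne d).1 (congrArg (fun d : S.Dart => d.1.1) h).symm

open Classical in
lemma Mx_card [Fintype S.Dart] [Fintype ι] {g : Fin 3 → ℝ} (hg : ∀ d : S.Dart, gs g d ≠ 0) :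
    ∑ d : S.Dart, (if Mx g d then 1 else 0) = Fintype.card ι := by
  rw [Finset.sum_boole, ← Finset.card_univ]
  simp only [Nat.cast_id]
  apply Finset.card_bij (fun d _ => d.1.1)
  · simp
  · intro d hd d' hd' h
    simp only [Finset.mem_filter, Finset.mem_univ, true_and] at hd hd'
    exact Mx_unique hd hd' h
  · intro i _
    obtain ⟨d, h1, h2⟩ := Mx_ex hg i
    exact ⟨d, by simpa using h2, h1⟩

open Classical in
lemma Al_card [Fintype S.Dart] [Nonempty S.Dart] {g : Fin 3 → ℝ} (hg : ∀ d : S.Dart, gs g d ≠ 0) :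
    ∑ d : S.Dart, (if Al g d then 1 else 0) = 3 := by
  rw [Finset.sum_boole]
  simp only [Nat.cast_id]
  obtain ⟨d, hd⟩ := Al_ex hg
  rw [Finset.card_eq_three]
  refine ⟨d, tau d, tau (tau d), (tau_ne d).symm, (tau2_ne d).symm, (tau_ne _).symm, ?_⟩
  ext d'
  simp [Al_iff hd]

lemma gs_neg (g : Fin 3 → ℝ) (d : S.Dart) : gs (-g) d = - gs g d := by
  simp [gs, dt]; ring

lemma gen_ex (S : SPoly ι) : ∃ g : Fin 3 → ℝ, ∀ d : S.Dart, gs g d ≠ 0 := by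
  obtain ⟨f, hf⟩ := Module.exists_dual_forall_apply_ne_zero (K := ℝ) (fun d : S.Dart => S.u d.1.1 d.1.2) (by
    intro d h0
    have ho := (vtx_spec d).2.2
    have := dt_cr (S.n d.1.1) (S.n d.1.2) (S.n (nx d))
    change dt _ (S.u d.1.1 d.1.2) = S.o _ _ _ at this
    change S.u d.1.1 d.1.2 = 0 at h0
    rw [h0, dt_zero] at this
    linarith)
  refine ⟨fun i => f (EuclideanSpace.single i 1), fun d => ?_⟩
  have e : ∀ x : E3, dt (fun i => f (EuclideanSpace.single i 1)) x = f x := by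
    intro x
    have : x = x 0 • EuclideanSpace.single (0 : Fin 3) (1:ℝ) + x 1 • EuclideanSpace.single (1 : Fin 3) (1:ℝ)
      + x 2 • EuclideanSpace.single (2 : Fin 3) (1:ℝ) := by
      ext i; fin_cases i <;> simp
    conv_rhs => rw [this]
    simp only [map_add, map_smul, smul_eq_mul, dt]
    ring
  unfold gs
  rw [e]
  exact hf d

open Classical in
theorem euler [Fintype S.Dart] [Fintype ι] [Nonempty S.Dart] : 6 * Fintype.card ι = Fintype.card S.Dart + 12 := by
  obtain ⟨g, hg⟩ := gen_ex S
  have hg' : ∀ d : S.Dart, gs (-g) d ≠ 0 := fun d => by rw [gs_neg]; exact neg_ne_zero.2 (hg d)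
  have key : ∀ d : S.Dart, ((if Mx g d then 1 else 0) + (if Mx g (tau d) then 1 else 0) + (if Mx g (tau (tau d)) then 1 else 0))
     + ((if Mx (-g) d then 1 else 0) + (if Mx (-g) (tau d) then 1 else 0) + (if Mx (-g) (tau (tau d)) then 1 else 0)) 
     = 1 + 2 * (if Al g d then 1 else 0) + 2 * (if Al (-g) d then 1 else 0) := by
    intro d
    simp only [Mx, Al, tau3, gs_neg, neg_pos]
    rcases lt_or_gt_of_ne (hg d) with h1 | h1 <;> rcases lt_or_gt_of_ne (hg (tau d)) with h2 | h2 <;>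
      rcases lt_or_gt_of_ne (hg (tau (tau d))) with h3 | h3 <;> simp [h1, h2, h3, h1.not_gt, h2.not_gt, h3.not_gt]
  have hs := Finset.sum_congr (rfl : (Finset.univ : Finset S.Dart) = Finset.univ) (fun d _ => key d)
  simp only [Finset.sum_add_distrib, ← Finset.mul_sum] at hs
  have r1 : ∀ F : S.Dart → ℕ, ∑ d, F (tau d) = ∑ d, F d := fun F => Equiv.sum_comp (tauE (S := S)) F
  rw [r1 (fun d => if Mx g d then 1 else 0), r1 (fun d => if Mx (-g) d then 1 else 0), 
    r1 (fun d => if Mx g (tau d) then 1 else 0), r1 (fun d => if Mx (-g) (tau d) then 1 else 0),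
    r1 (fun d => if Mx g d then 1 else 0), r1 (fun d => if Mx (-g) d then 1 else 0),
    Mx_card hg, Mx_card hg', Al_card hg, Al_card hg'] at hs
  simp only [Finset.sum_const, Finset.card_univ, smul_eq_mul, mul_one] at hs
  omega

theorem twelve (S : SPoly ι) (h56 : ∀ i, S.deg i = 5 ∨ S.deg i = 6) : {i | S.deg i = 5}.ncard = 12 := by
  classical
  have := S.fin
  have := Fintype.ofFinite ι
  have := Fintype.ofFinite S.Dart
  have : Nonempty S.Dart := by
    obtain ⟨x, hx⟩ := S.nonempty
    obtain ⟨v, hv, -⟩ := S.exV hx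
    obtain ⟨a, b, c, hab, hbc, hac, e, ho⟩ := S.vert hv
    exact ⟨⟨(a, b), S.adj_of_V hv.1 (by simp [e]) (by simp [e]) hab⟩⟩
  have h1 := euler (S := S)
  have h2 : Fintype.card S.Dart = ∑ i, S.deg i := by
    rw [← Finset.card_univ, Finset.card_eq_sum_card_fiberwise (f := fun d : S.Dart => d.1.1) (t := Finset.univ) (by simp [Set.MapsTo])]
    apply Finset.sum_congr rfl
    intro i _
    rw [← deg_eq, Set.ncard_eq_toFinset_card']
    congr 1
    ext; simp
  have h3 : ∑ i, (S.deg i + if S.deg i = 5 then 1 else 0) = ∑ i : ι, 6 := by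
    apply Finset.sum_congr rfl
    intro i _
    rcases h56 i with h | h <;> simp [h]
  rw [Finset.sum_add_distrib, Finset.sum_boole, Finset.sum_const, Finset.card_univ] at h3
  rw [Set.ncard_eq_toFinset_card']
  have : (Set.toFinset {i | S.deg i = 5}) = (Finset.univ.filter fun i => S.deg i = 5) := by ext; simp
  rw [this]
  simp only [Nat.cast_id, smul_eq_mul] at h3
  omega

end SPoly
end

section
/-- The type of facets of `P`. -/
abbrev Fac (P : Set E3) : Type := {F : Set E3 // IsFacetOf F P}

/-- Presentation of `P` by facet inequalities. -/
structure Geo (P : Set E3) where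
  S : SPoly (Fac P)
  hS : S.P = P
  hA : ∀ (i : Fac P) x, x ∈ P → (i ∈ S.A x ↔ x ∈ i.1)
  hinterior : ∀ x ∈ interior P, S.A x = ∅
  d3 : setDim P = 3

lemma dt_fun (f : E3 →L[ℝ] ℝ) (x : E3) : dt (fun i => f (EuclideanSpace.single i 1)) x = f x := by
  have : x = x 0 • EuclideanSpace.single (0 : Fin 3) (1:ℝ) + x 1 • EuclideanSpace.single (1 : Fin 3) (1:ℝ)
      + x 2 • EuclideanSpace.single (2 : Fin 3) (1:ℝ) := by
    ext i; fin_cases i <;> simp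
  conv_rhs => rw [this]
  simp only [map_add, map_smul, smul_eq_mul, dt]
  ring

lemma same_side {F : Set E3} (hF2 : setDim F = 2) {f f' : E3 →L[ℝ] ℝ} {c c' : ℝ} (hf : f ≠ 0)
    (h : ∀ x ∈ F, f x = c) (h' : ∀ x ∈ F, f' x = c') {p z : E3} (hp : p ∈ F) (hz : f z < c) (hz' : f' z < c')
    {x : E3} (hx : c' < f' x) : c < f x := by
  have hG : (c' - f' z) • f - (c - f z) • f' = 0 := by
    by_contra hne
    have e1 : vectorSpan ℝ F = LinearMap.ker f.toLinearMap := by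
      apply Submodule.eq_of_le_of_finrank_eq (vspan_le_ker h)
      rw [finrank_ker_le hf]; exact hF2
    have e2 : vectorSpan ℝ F = LinearMap.ker ((c' - f' z) • f - (c - f z) • f').toLinearMap := by
      apply Submodule.eq_of_le_of_finrank_eq 
        (vspan_le_ker (c := (c' - f' z) * c - (c - f z) * c') ?_)
      · rw [finrank_ker_le hne]; exact hF2
      · intro x hx; simp [h x hx, h' x hx]
    have h3 : z - p ∈ LinearMap.ker ((c' - f' z) • f - (c - f z) • f').toLinearMap := by
      simp [h p hp, h' p hp]; ring
    rw [← e2, e1] at h3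
    simp [h p hp] at h3
    linarith
  have h1 := congrArg (fun g : E3 →L[ℝ] ℝ => g (x - p)) hG
  simp [h p hp, h' p hp] at h1
  by_contra hn
  push Not at hn
  have h2 : 0 < (c - f z) * (f' x - c') := mul_pos (by linarith) (by linarith)
  have h3 : (c' - f' z) * (f x - c) ≤ 0 := mul_nonpos_of_nonneg_of_nonpos (by linarith) (by linarith)
  linarith

lemma vertex_of_span {P : Set E3} {ι : Type} {n : ι → Fin 3 → ℝ} {c : ι → ℝ} 
    (hP : ∀ x, x ∈ P ↔ ∀ i, dt (n i) x ≤ c i) {v : E3} (hv : v ∈ P) 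
    (h : ∀ u, (∀ i, dt (n i) v = c i → dt (n i) u = 0) → u = 0) : IsVertexOf v P := by
  refine ⟨singleton_nonempty _, isClosed_singleton, convex_singleton _, ⟨by simpa using hv, ?_⟩⟩
  intro x hx y hy z hz hseg
  rw [mem_singleton_iff] at hz
  subst hz
  rw [mem_singleton_iff, ← sub_eq_zero]
  apply h
  intro i hi
  obtain ⟨a, b, ha, hb, hab, e⟩ := hseg
  have hx' := (hP x).1 hx i
  have hy' := (hP y).1 hy i
  rw [dt_sub, hi]
  have e2 : a * dt (n i) x + b * dt (n i) y = c i := by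
    rw [← dt_smul, ← dt_smul, ← dt_add, e, hi]
  have e3 : b = 1 - a := by linarith
  rw [e3] at e2 hb
  nlinarith

theorem geo_ex {P : Set E3} (h : IsSimplePolytope3 P) : Nonempty (Geo P) := by
  obtain ⟨⟨V, hV⟩, hd, hs⟩ := h
  have hex : ∀ F : Fac P, ∃ (f : E3 →L[ℝ] ℝ) (c : ℝ), f ≠ 0 ∧
    (∀ x ∈ P, f x ≤ c) ∧ F.1 = P ∩ {x | f x = c} ∧ ∀ x ∈ interior P, f x < c := fun F => facet_exposed hV hd F.2
  choose f c hf hle he hi using hex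
  obtain ⟨z, hz⟩ := P_int hV hd
  have hzP := interior_subset hz
  have hPiff : ∀ x, x ∈ P ↔ ∀ i : Fac P, dt (fun k => f i (EuclideanSpace.single k 1)) x ≤ c i := by
    intro x
    simp only [dt_fun]
    refine ⟨fun hx i => hle i x hx, fun hx => ?_⟩
    by_contra hxP
    obtain ⟨F, f', c', hF, hle', he', hlt⟩ := facet_sep hV hd hxP
    have hFe := he ⟨F, hF⟩
    change F = _ at hFe
    obtain ⟨p, hp⟩ := hF.1.1
    have hz1 := hi ⟨F, hF⟩ z hz
    have hz' : f' z < c' := by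
      refine lt_of_le_of_ne (hle' z hzP) fun hzc => ?_
      have : z ∈ F := by rw [he']; exact ⟨hzP, hzc⟩
      rw [hFe] at this
      exact hz1.ne this.2
    have := same_side hF.2 (hf ⟨F, hF⟩) (c := c ⟨F, hF⟩) (c' := c') (f' := f')
      (fun x hx => by rw [hFe] at hx; exact hx.2) (fun x hx => by rw [he'] at hx; exact hx.2) hp hz1 hz' hlt
    exact absurd (hx ⟨F, hF⟩) (not_le.2 this)
  have hA : ∀ (i : Fac P) x, x ∈ P → (dt (fun k => f i (EuclideanSpace.single k 1)) x = c i ↔ x ∈ i.1) := by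
    intro i x hx
    rw [dt_fun, he i]
    exact ⟨fun h => ⟨hx, h⟩, fun h => h.2⟩
  refine ⟨⟨⟨P, fun i k => f i (EuclideanSpace.single k 1), c, ?_, hPiff, P_cpt hV, ?_, ⟨z, hzP⟩, ?_⟩, rfl, hA, ?_, hd⟩⟩
  · exact (facets_finite hV hd).to_subtype
  · intro i
    obtain ⟨x, hx⟩ := i.2.1.1
    have hxP : x ∈ P := i.2.1.2.2.2.subset hx
    exact ⟨x, hxP, (hA i x hxP).2 hx⟩
  · intro v hv hu
    have := hs v (vertex_of_span hPiff hv hu)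
    refine Eq.trans ?_ this
    refine (Set.ncard_image_of_injective _ (Subtype.val_injective (p := fun F => IsFacetOf F P))).symm.trans ?_
    congr 1
    ext F
    constructor
    · rintro ⟨i, hi, rfl⟩
      exact ⟨i.2, (hA i v hv).1 hi⟩
    · rintro ⟨hF, hvF⟩
      exact ⟨⟨F, hF⟩, (hA ⟨F, hF⟩ v hv).2 hvF, rfl⟩
  · intro x hx
    ext i
    simp only [SPoly.mem_A, mem_empty_iff_false, iff_false]
    rw [dt_fun]
    exact (hi i x hx).ne

namespace SPoly
variable {ι : Type} (S : SPoly ι)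

lemma A_mid {x y : E3} (hx : x ∈ S.P) (hy : y ∈ S.P) {a b : ℝ} (ha : 0 < a) (hb : 0 < b) (hab : a + b = 1) :
    a • x + b • y ∈ S.P ∧ S.A (a • x + b • y) = S.A x ∩ S.A y := by
  have hx' := (S.hP x).1 hx
  have hy' := (S.hP y).1 hy
  have e : ∀ i, dt (S.n i) (a • x + b • y) - S.c i = a * (dt (S.n i) x - S.c i) + b * (dt (S.n i) y - S.c i) := by
    intro i; rw [dt_add, dt_smul, dt_smul]; linear_combination (S.c i) * hab
  have t1 : ∀ i, a * (dt (S.n i) x - S.c i) ≤ 0 := fun i => mul_nonpos_of_nonneg_of_nonpos ha.le (by linarith [hx' i])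
  have t2 : ∀ i, b * (dt (S.n i) y - S.c i) ≤ 0 := fun i => mul_nonpos_of_nonneg_of_nonpos hb.le (by linarith [hy' i])
  constructor
  · rw [S.hP]; intro i; linarith [e i, t1 i, t2 i]
  · ext i
    simp only [mem_inter_iff, mem_A]
    constructor
    · intro h
      have h0 := e i
      rw [h, sub_self] at h0
      have z1 : a * (dt (S.n i) x - S.c i) = 0 := by linarith [t1 i, t2 i]
      have z2 : b * (dt (S.n i) y - S.c i) = 0 := by linarith [t1 i, t2 i]
      exact ⟨sub_eq_zero.1 ((mul_eq_zero.1 z1).resolve_left ha.ne'), sub_eq_zero.1 ((mul_eq_zero.1 z2).resolve_left hb.ne')⟩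
    · rintro ⟨h1, h2⟩
      have h0 := e i
      rw [h1, h2] at h0
      linarith

lemma face_eq {E : Set E3} (h : IsFaceOf E S.P) : ∃ x ∈ E, E = {y | y ∈ S.P ∧ S.A x ⊆ S.A y} := by
  have := S.fin
  obtain ⟨hne, -, hcv, hex⟩ := h
  have hwf := WellFounded.has_min (r := fun x y : E3 => (S.A x).ncard < (S.A y).ncard) (measure fun x => (S.A x).ncard).wf E hne
  obtain ⟨x, hx, hmin⟩ := hwf
  refine ⟨x, hx, ?_⟩
  have hxP := hex.subset hx
  ext y
  constructor
  · intro hy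
    have hyP := hex.subset hy
    refine ⟨hyP, ?_⟩
    have hm := S.A_mid hxP hyP (a := 1/2) (b := 1/2) (by norm_num) (by norm_num) (by norm_num)
    have hmE := hcv hx hy (a := 1/2) (b := 1/2) (by norm_num) (by norm_num) (by norm_num)
    have h1 := hmin _ hmE
    rw [hm.2, not_lt] at h1
    have := Set.eq_of_subset_of_ncard_le (inter_subset_left (s := S.A x) (t := S.A y)) h1 (Set.toFinite _)
    rw [← this]; exact inter_subset_right
  · rintro ⟨hyP, hA⟩
    obtain ⟨t, ht, h1, -⟩ := S.move hxP (u := x - y) (fun i hi => by rw [dt_sub, hi, hA hi]; simp)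
    exact hex.left_mem_of_mem_openSegment hyP h1 hx (mem_openSeg_extend ht)

lemma V_iff {v : E3} : IsVertexOf v S.P ↔ S.IsV v := by
  constructor
  · intro h
    have hv : v ∈ S.P := h.2.2.2.subset rfl
    refine ⟨hv, fun u hu => ?_⟩
    obtain ⟨t, ht, h1, -⟩ := S.move hv (u := u) (fun i hi => (hu i hi).le)
    obtain ⟨x, hx, e⟩ := S.face_eq h
    rw [mem_singleton_iff] at hx
    subst hx
    have : x + t • u ∈ ({x} : Set E3) := by
      rw [e]
      refine ⟨h1, fun i hi => ?_⟩
      rw [mem_A, dt_add, dt_smul, hu i hi, hi]; ring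
    have h2 : t • u = 0 := by simpa using this
    exact (smul_eq_zero.1 h2).resolve_left ht.ne'
  · intro h
    exact vertex_of_span S.hP h.1 h.2

lemma seg_eq {i j : ι} (hij : i ≠ j) {v w : E3} (hv : S.IsV v) (hw : S.IsV w) (hvw : v ≠ w) (hi : i ∈ S.A v) 
    (hj : j ∈ S.A v) (hi' : i ∈ S.A w) (hj' : j ∈ S.A w) : 
    {x | x ∈ S.P ∧ i ∈ S.A x ∧ j ∈ S.A x} = segment ℝ v w := by
  have third : ∀ v : E3, S.IsV v → i ∈ S.A v → j ∈ S.A v → ∃ k ∈ S.A v, S.o i j k ≠ 0 ∧ S.A v = {i, j, k} := by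
    intro v hv hi hj
    have : ∃ k ∈ S.A v, k ≠ i ∧ k ≠ j := by
      by_contra hn
      push Not at hn
      have h1 : S.A v ⊆ {i, j} := by
        intro k hk
        by_cases h : k = i
        · simp [h]
        · simp [hn k hk h]
      have h2 := Set.ncard_le_ncard h1
      have h3 : ({i, j} : Set ι).ncard ≤ 2 := (Set.ncard_insert_le i {j}).trans (by rw [Set.ncard_singleton])
      rw [S.ncardA hv] at h2; omega
    obtain ⟨k, hk, hki, hkj⟩ := this
    obtain ⟨h1, h2⟩ := S.vert_of hv hi hj hk hij hkj.symm hki.symm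
    exact ⟨k, hk, h2, h1⟩
  obtain ⟨k, hk, ho, eA⟩ := third v hv hi hj
  obtain ⟨l, hl, ho', eA'⟩ := third w hw hi' hj'
  have hwk : dt (S.n k) w < S.c k := by
    refine lt_of_le_of_ne ((S.hP w).1 hw.1 k) fun h => hvw ?_
    symm; apply S.V_unique hv; rw [eA]; rintro m (rfl | rfl | rfl) <;> assumption
  have hvl : dt (S.n l) v < S.c l := by
    refine lt_of_le_of_ne ((S.hP v).1 hv.1 l) fun h => hvw ?_
    apply S.V_unique hw; rw [eA']; rintro m (rfl | rfl | rfl) <;> assumption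
  ext x
  constructor
  · rintro ⟨hx, hix, hjx⟩
    obtain ⟨s1, hs1⟩ := dd_line (u := w - v) ho (by rw [dt_sub, hi, hi']; ring) (by rw [dt_sub, hj, hj']; ring)
    obtain ⟨s2, hs2⟩ := dd_line (u := x - v) ho (by rw [dt_sub, hi, hix]; ring) (by rw [dt_sub, hj, hjx]; ring)
    have s10 : s1 ≠ 0 := by
      rintro rfl
      rw [zero_smul] at hs1
      exact hvw (sub_eq_zero.1 hs1).symm
    have hs : x - v = (s2 / s1) • (w - v) := by
      rw [hs1, hs2, smul_smul, div_mul_cancel₀ _ s10]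
    generalize s2 / s1 = s at hs
    have e1 : ∀ m, dt (S.n m) x - dt (S.n m) v = s * (dt (S.n m) w - dt (S.n m) v) := by
      intro m; rw [← dt_sub, hs, dt_smul, dt_sub]
    have qx := (S.hP x).1 hx
    have h0 : 0 ≤ s := by
      have := e1 k
      rw [hk] at this
      have := qx k
      by_contra hn
      push Not at hn
      nlinarith
    have h1 : s ≤ 1 := by
      have := e1 l
      rw [hl] at this
      have := qx l
      by_contra hn
      push Not at hn
      nlinarith
    refine ⟨1 - s, s, by linarith, h0, by ring, ?_⟩
    have : x = v + s • (w - v) := by rw [← hs]; abel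
    rw [this]; module
  · rintro ⟨a, b, ha, hb, hab, rfl⟩
    refine ⟨?_, ?_, ?_⟩
    · rw [S.hP]; intro m
      rw [dt_add, dt_smul, dt_smul]
      have h1 := (S.hP v).1 hv.1 m
      have h2 := (S.hP w).1 hw.1 m
      have h3 : b = 1 - a := by linarith
      rw [h3] at hb ⊢
      nlinarith
    · rw [mem_A, dt_add, dt_smul, dt_smul, hi, hi']; linear_combination (S.c i) * hab
    · rw [mem_A, dt_add, dt_smul, dt_smul, hj, hj']; linear_combination (S.c j) * hab

end SPoly

namespace Geo
variable {P : Set E3} (G : Geo P)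

lemma hA' {i : Fac P} {x : E3} : x ∈ i.1 ↔ x ∈ P ∧ i ∈ G.S.A x := by
  constructor
  · intro h
    have : x ∈ P := i.2.1.2.2.2.subset h
    exact ⟨this, (G.hA i x this).2 h⟩
  · rintro ⟨h1, h2⟩; exact (G.hA i x h1).1 h2

lemma adj_iff {i j : Fac P} : G.S.Adj i j ↔ i ≠ j ∧ (i.1 ∩ j.1).Nonempty := by
  unfold SPoly.Adj
  rw [G.hS]
  constructor
  · rintro ⟨h, x, hx, h1, h2⟩
    exact ⟨h, x, G.hA'.2 ⟨hx, h1⟩, G.hA'.2 ⟨hx, h2⟩⟩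
  · rintro ⟨h, x, h1, h2⟩
    have := G.hA'.1 h1
    exact ⟨h, x, this.1, this.2, (G.hA'.1 h2).2⟩

lemma inter_eq (i j : Fac P) : i.1 ∩ j.1 = {x | x ∈ G.S.P ∧ i ∈ G.S.A x ∧ j ∈ G.S.A x} := by
  ext x
  rw [mem_inter_iff, G.hA', G.hA', mem_ofPred_eq, G.hS]
  tauto

lemma vert_iff {v : E3} : IsVertexOf v P ↔ G.S.IsV v := by
  rw [← G.S.V_iff, G.hS]

lemma edge_of_adj {i j : Fac P} (h : G.S.Adj i j) : IsEdgeOf (i.1 ∩ j.1) P := by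
  refine ⟨⟨(G.adj_iff.1 h).2, i.2.1.2.1.inter j.2.1.2.1, i.2.1.2.2.1.inter j.2.1.2.2.1, 
    i.2.1.2.2.2.inter j.2.1.2.2.2⟩, ?_⟩
  set d : G.S.Dart := ⟨(i, j), h⟩ with hd
  obtain ⟨w, s, hw, hs, e, h1, h2⟩ := SPoly.other' d
  have ho := (SPoly.vtx_spec d).2.2
  have hv := (SPoly.vtx_V d).1
  have hu0 : G.S.u i j ≠ 0 := by
    intro h0
    have := dt_cr (G.S.n i) (G.S.n j) (G.S.n (SPoly.nx d))
    change dt _ (G.S.u i j) = G.S.o _ _ _ at this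
    rw [h0, dt_zero] at this
    change 0 < G.S.o i j _ at ho
    linarith
  have hsp : vectorSpan ℝ (i.1 ∩ j.1) = Submodule.span ℝ {G.S.u i j} := by
    rw [G.inter_eq]
    apply le_antisymm
    · apply Submodule.span_le.2
      rintro _ ⟨x, ⟨-, hx1, hx2⟩, y, ⟨-, hy1, hy2⟩, rfl⟩
      obtain ⟨s, hs⟩ := dd_line (u := x - y) ho.ne' (by rw [dt_sub, hx1, hy1]; ring) (by rw [dt_sub, hx2, hy2]; ring)
      change x - y ∈ _
      rw [hs]
      exact Submodule.smul_mem _ _ (Submodule.mem_span_singleton_self _)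
    · rw [Submodule.span_singleton_le_iff_mem]
      have := vsub_mem_vectorSpan ℝ (s := {x | x ∈ G.S.P ∧ i ∈ G.S.A x ∧ j ∈ G.S.A x}) 
        (p₁ := SPoly.vtx d) (p₂ := w) ⟨hv, SPoly.vtx1 d, SPoly.vtx2 d⟩ ⟨hw.1, h1, h2⟩
      have e2 : SPoly.vtx d -ᵥ w = s • G.S.u i j := by
        rw [e]; change SPoly.vtx d - (SPoly.vtx d - s • G.S.u i j) = _; abel
      rw [e2] at this
      exact (Submodule.smul_mem_iff _ hs.ne').1 this
  unfold setDim
  rw [hsp, finrank_span_singleton hu0]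

lemma edge_iff {e : Set E3} : IsEdgeOf e P ↔ ∃ i j, G.S.Adj i j ∧ e = i.1 ∩ j.1 := by
  constructor
  · rintro ⟨hf, hd⟩
    have hf' : IsFaceOf e G.S.P := by rw [G.hS]; exact hf
    obtain ⟨x, hx, he⟩ := G.S.face_eq hf'
    have hxP : x ∈ G.S.P := hf'.2.2.2.subset hx
    by_cases h0 : G.S.A x = ∅
    · exfalso
      have : e = P := by rw [he, h0]; ext; simp [G.hS]
      rw [this, G.d3] at hd; norm_num at hd
    obtain ⟨i, hi⟩ := Set.nonempty_iff_ne_empty.2 h0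
    by_cases h1 : G.S.A x = {i}
    · exfalso
      have : e = i.1 := by
        rw [he, h1]; ext y
        rw [G.hA', mem_ofPred_eq, G.hS, singleton_subset_iff]
      rw [this, i.2.2] at hd; norm_num at hd
    have : ∃ j ∈ G.S.A x, j ≠ i := by
      by_contra hn
      push Not at hn
      exact h1 (Set.eq_singleton_iff_unique_mem.2 ⟨hi, hn⟩)
    obtain ⟨j, hj, hji⟩ := this
    by_cases h2 : G.S.A x = {i, j}
    · refine ⟨i, j, G.S.adj_of_V hxP hi hj hji.symm, ?_⟩
      rw [he, h2, G.inter_eq]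
      ext y
      simp [Set.insert_subset_iff]
    · exfalso
      have : ∃ k ∈ G.S.A x, k ≠ i ∧ k ≠ j := by
        by_contra hn
        push Not at hn
        apply h2
        ext k
        constructor
        · intro hk
          by_cases h : k = i
          · simp [h]
          · simp [hn k hk h]
        · rintro (rfl | rfl) <;> assumption
      obtain ⟨k, hk, hki, hkj⟩ := this
      have hV := G.S.three hxP hi hj hk hji.symm hkj.symm hki.symm
      have : e = {x} := by
        rw [he]; ext y
        constructor
        · rintro ⟨-, h⟩; exact G.S.V_unique hV h
        · rintro rfl; exact ⟨hxP, subset_rfl⟩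
      rw [this] at hd
      unfold setDim at hd
      rw [vectorSpan_singleton, finrank_bot] at hd
      norm_num at hd
  · rintro ⟨i, j, h, rfl⟩
    exact G.edge_of_adj h

lemma edge_sub {i j k : Fac P} (h : G.S.Adj i j) (hs : i.1 ∩ j.1 ⊆ k.1) : k = i ∨ k = j := by
  obtain ⟨m, hm, e⟩ := G.S.edgept h
  have h1 : m ∈ i.1 ∩ j.1 := by rw [G.inter_eq, mem_ofPred_eq, e]; exact ⟨hm, by simp, by simp⟩
  have := (G.hA'.1 (hs h1)).2
  rw [e] at this
  exact this

lemma facetEdges_eq (i : Fac P) : facetEdges P i.1 = G.S.deg i := by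
  unfold facetEdges SPoly.deg
  symm
  rw [← Set.InjOn.ncard_image (f := fun j : Fac P => i.1 ∩ j.1)]
  · congr 1
    ext e
    constructor
    · rintro ⟨j, hj, rfl⟩
      exact ⟨G.edge_of_adj hj, inter_subset_left⟩
    · rintro ⟨he, hs⟩
      obtain ⟨a, b, hab, rfl⟩ := G.edge_iff.1 he
      rcases G.edge_sub hab hs with rfl | rfl
      · exact ⟨b, hab, rfl⟩
      · exact ⟨a, hab.symm, inter_comm _ _⟩
  · intro j hj k hk h
    have : i.1 ∩ j.1 ⊆ k.1 := by
      change i.1 ∩ j.1 = i.1 ∩ k.1 at h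
      rw [h]; exact inter_subset_right
    rcases G.edge_sub hj this with h | h
    · exact absurd h.symm hk.1
    · exact h.symm

lemma seg_edge {i j : Fac P} (hij : i ≠ j) {v w : E3} (hv : G.S.IsV v) (hw : G.S.IsV w) (hvw : v ≠ w) (hi : i ∈ G.S.A v) 
    (hj : j ∈ G.S.A v) (hi' : i ∈ G.S.A w) (hj' : j ∈ G.S.A w) : segment ℝ v w = i.1 ∩ j.1 := by
  rw [G.inter_eq, G.S.seg_eq hij hv hw hvw hi hj hi' hj']

lemma frontier_eq : frontier P = {x | x ∈ P ∧ G.S.A x ≠ ∅} := by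
  have hcl : IsClosed P := by rw [← G.hS]; exact G.S.cpt.isClosed
  rw [hcl.frontier_eq]
  ext x
  constructor
  · rintro ⟨hx, hni⟩
    refine ⟨hx, fun h0 => hni ?_⟩
    rw [mem_interior_iff_mem_nhds]
    have := G.S.fin
    have : ∀ i, ∀ᶠ y in nhds x, dt (G.S.n i) y < G.S.c i := by
      intro i
      apply (dt_cont (G.S.n i)).continuousAt.eventually (Iio_mem_nhds _)
      refine lt_of_le_of_ne ((G.S.hP x).1 (by rw [G.hS]; exact hx) i) fun h => ?_
      have : i ∈ G.S.A x := h
      rw [h0] at this; exact this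
    filter_upwards [Filter.eventually_all.2 this] with y hy
    rw [← G.hS, G.S.hP]
    exact fun i => (hy i).le
  · rintro ⟨hx, h0⟩
    exact ⟨hx, fun hi => h0 (G.hinterior x hi)⟩

end Geo
end

section
/-- Combinatorial part of the definition of walking round a cycle. -/
def Wlk {n k : ℕ} (φ : Fin n → Fin k) : Prop :=
  (∀ i, φ (nxt i) = φ i ∨ φ (nxt i) = nxt (φ i)) ∧ Function.Surjective φ ∧
    (2 ≤ k → (Finset.univ.filter (fun i : Fin n => φ (nxt i) ≠ φ i)).card = k)

lemma nxt_ne {n : ℕ} (hn : 2 ≤ n) (i : Fin n) : nxt i ≠ i := by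
  intro h
  have := congrArg Fin.val h
  simp only [nxt] at this
  have hi := i.2
  rcases Nat.lt_or_ge (i.1 + 1) n with h1 | h1
  · rw [Nat.mod_eq_of_lt h1] at this; omega
  · have h2 : i.1 + 1 = n := by omega
    rw [h2, Nat.mod_self] at this; omega

lemma nxt_induct {k : ℕ} (hk : 0 < k) {p : Fin k → Prop} (h0 : p ⟨0, hk⟩) (hs : 2 ≤ k → ∀ i, p i → p (nxt i)) (i : Fin k) : p i := by
  obtain ⟨m, hm⟩ := i
  induction m with
  | zero => exact h0
  | succ m ih =>
    have := hs (by omega) ⟨m, by omega⟩ (ih (by omega))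
    have e : nxt (⟨m, by omega⟩ : Fin k) = ⟨m + 1, hm⟩ := by
      simp [nxt, Nat.mod_eq_of_lt hm]
    rwa [e] at this

namespace Geo
variable {P : Set E3} (G : Geo P)

lemma intr_sub {F : Fac P} {x : E3} (hx : x ∈ intrinsicInterior ℝ F.1) : x ∈ P ∧ G.S.A x = {F} := by
  have hxF : x ∈ F.1 := intrinsicInterior_subset hx
  have h1 := G.hA'.1 hxF
  refine ⟨h1.1, ?_⟩
  obtain ⟨y, hy, hAy⟩ := G.S.facetpt F
  have hyF : y ∈ F.1 := G.hA'.2 ⟨by rw [← G.hS]; exact hy, by rw [hAy]; rfl⟩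
  obtain ⟨t, ht, h2⟩ := intr_extend hx (subset_affineSpan ℝ _ hyF)
  have h3 := (G.hA'.1 h2).1
  rw [Set.eq_singleton_iff_unique_mem]
  refine ⟨h1.2, fun H hH => ?_⟩
  by_contra hne
  have h4 : dt (G.S.n H) y < G.S.c H := by
    refine lt_of_le_of_ne ((G.S.hP y).1 hy H) fun h => ?_
    have : H ∈ G.S.A y := h
    rw [hAy] at this; exact hne this
  have h5 := (G.S.hP _).1 (by rw [G.hS]; exact h3) H
  rw [dt_add, dt_smul, dt_sub, hH] at h5
  nlinarith

/-- Points whose facets all lie on one side can be joined to facet points. -/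
lemma seg_sub {F : Fac P} {x p : E3} (hx : x ∈ P) (hp : p ∈ P) (hF : F ∈ G.S.A x) (hAp : G.S.A p = {F}) 
    {z : E3} (hz : z ∈ segment ℝ x p) : z ∈ P ∧ F ∈ G.S.A z ∧ G.S.A z ⊆ G.S.A x := by
  obtain ⟨a, b, ha, hb, hab, rfl⟩ := hz
  rcases ha.eq_or_lt with rfl | ha
  · have : b = 1 := by linarith
    subst this
    simp only [zero_smul, one_smul, zero_add]
    rw [hAp]
    exact ⟨hp, rfl, by simpa using hF⟩
  rcases hb.eq_or_lt with rfl | hb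
  · have : a = 1 := by linarith
    subst this
    simp only [zero_smul, one_smul, add_zero]
    exact ⟨hx, hF, subset_rfl⟩
  have := G.S.A_mid (by rw [G.hS]; exact hx) (by rw [G.hS]; exact hp) ha hb hab
  refine ⟨(Set.ext_iff.1 G.hS _).1 this.1, ?_, ?_⟩
  · rw [this.2, hAp]; exact ⟨hF, rfl⟩
  · rw [this.2]; exact inter_subset_left

section sides
variable (X : Set (Fac P)) (B : Set E3)

/-- Component data: `B` is the complement of the boundary curve of `X`. -/
def Side : Prop := ∀ x, x ∈ B ↔ x ∈ P ∧ G.S.A x ≠ ∅ ∧ (G.S.A x ⊆ X ∨ G.S.A x ⊆ Xᶜ)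

def pt (F : Fac P) : E3 := (G.S.facetpt F).choose
lemma pt_spec (F : Fac P) : G.pt F ∈ P ∧ G.S.A (G.pt F) = {F} := by
  have := (G.S.facetpt F).choose_spec
  exact ⟨(Set.ext_iff.1 G.hS _).1 this.1, this.2⟩

variable {X B}
lemma side_one (hB : G.Side X B) {F : Fac P} {x : E3} (hx : x ∈ P) (h : G.S.A x ⊆ X ∨ G.S.A x ⊆ Xᶜ) (hF : F ∈ G.S.A x) : 
    x ∈ connectedComponentIn B (G.pt F) := by
  have hs : segment ℝ x (G.pt F) ⊆ B := by
    intro z hz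
    obtain ⟨h1, h2, h3⟩ := G.seg_sub hx (G.pt_spec F).1 hF (G.pt_spec F).2 hz
    rw [hB]
    refine ⟨h1, fun h0 => by rw [h0] at h2; exact h2, ?_⟩
    exact h.imp (fun h => h3.trans h) (fun h => h3.trans h)
  exact (convex_segment x (G.pt F)).isPreconnected.subset_connectedComponentIn (right_mem_segment _ _ _) hs (left_mem_segment _ _ _)

lemma side_intr (hB : G.Side X B) {F : Fac P} : intrinsicInterior ℝ F.1 ⊆ connectedComponentIn B (G.pt F) := by
  intro x hx
  obtain ⟨h1, h2⟩ := G.intr_sub hx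
  apply G.side_one hB h1
  · rw [h2, singleton_subset_iff, singleton_subset_iff]; exact em _
  · rw [h2]; rfl

lemma side_adj (hB : G.Side X B) {F H : Fac P} (h : G.S.Adj F H) (hs : F ∈ X ↔ H ∈ X) : 
    connectedComponentIn B (G.pt F) = connectedComponentIn B (G.pt H) := by
  obtain ⟨m, hm, e⟩ := G.S.edgept h
  rw [G.hS] at hm
  have hX : G.S.A m ⊆ X ∨ G.S.A m ⊆ Xᶜ := by
    rw [e, Set.insert_subset_iff, Set.insert_subset_iff, singleton_subset_iff, singleton_subset_iff]
    by_cases hF : F ∈ X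
    · left; exact ⟨hF, hs.1 hF⟩
    · right; exact ⟨hF, fun h => hF (hs.2 h)⟩
  have h1 := G.side_one hB hm hX (F := F) (by simp [e])
  have h2 := G.side_one hB hm hX (F := H) (by simp [e])
  rw [connectedComponentIn_eq h1, connectedComponentIn_eq h2]

lemma pt_mem (hB : G.Side X B) (F : Fac P) : G.pt F ∈ B := by
  rw [hB, (G.pt_spec F).2, singleton_subset_iff, singleton_subset_iff]
  exact ⟨(G.pt_spec F).1, by simp, em _⟩

lemma side_ne (hB : G.Side X B) {F H : Fac P} (hF : F ∈ X) (hH : H ∉ X) : 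
    connectedComponentIn B (G.pt F) ≠ connectedComponentIn B (G.pt H) := by
  have := G.S.fin
  intro heq
  have hpre : IsPreconnected (connectedComponentIn B (G.pt F)) := isPreconnected_connectedComponentIn
  have hop : ∀ Y : Set (Fac P), IsOpen {x : E3 | ∀ H ∈ Y, dt (G.S.n H) x < G.S.c H} := by
    intro Y
    have : {x : E3 | ∀ H ∈ Y, dt (G.S.n H) x < G.S.c H} = ⋂ H : Fac P, ⋂ (_ : H ∈ Y), {x : E3 | dt (G.S.n H) x < G.S.c H} := by
      ext; simp
    rw [this]
    apply isOpen_iInter_of_finite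
    intro H
    by_cases hY : H ∈ Y
    · simp only [hY, iInter_true]
      exact isOpen_lt (dt_cont _) continuous_const
    · simp [hY]
  have hin : ∀ (Y : Set (Fac P)) (x : E3), x ∈ P → G.S.A x ⊆ Yᶜ → x ∈ {x : E3 | ∀ H ∈ Y, dt (G.S.n H) x < G.S.c H} := by
    intro Y x hx hs H hH
    refine lt_of_le_of_ne ((G.S.hP x).1 (by rw [G.hS]; exact hx) H) fun h => ?_
    exact hs (show H ∈ G.S.A x from h) hH
  have hmF : G.pt F ∈ connectedComponentIn B (G.pt F) := mem_connectedComponentIn (G.pt_mem hB F)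
  have hmH : G.pt H ∈ connectedComponentIn B (G.pt F) := by rw [heq]; exact mem_connectedComponentIn (G.pt_mem hB H)
  obtain ⟨x, hx, hx1, hx2⟩ := hpre _ _ (hop X) (hop Xᶜ) (by
      intro x hx
      have := (hB x).1 (connectedComponentIn_subset _ _ hx)
      rcases this.2.2 with h | h
      · right; exact hin Xᶜ x this.1 (by rwa [compl_compl])
      · left; exact hin X x this.1 h) 
    ⟨G.pt H, hmH, hin X _ (G.pt_spec H).1 (by rw [(G.pt_spec H).2]; simpa using hH)⟩
    ⟨G.pt F, hmF, hin Xᶜ _ (G.pt_spec F).1 (by rw [(G.pt_spec F).2]; simpa using hF)⟩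
  have hxB := (hB x).1 (connectedComponentIn_subset _ _ hx)
  apply hxB.2.1
  ext J
  simp only [mem_empty_iff_false, iff_false]
  intro hJ
  by_cases hJX : J ∈ X
  · exact (hx1 J hJX).ne hJ
  · exact (hx2 J hJX).ne hJ

end sides

theorem borders_of (X : Set (Fac P)) {k₁ k₂ n : ℕ} (L₁ : Fin k₁ → Fac P) (L₂ : Fin k₂ → Fac P) (w : Fin n → E3)
    (φ1 : Fin n → Fin k₁) (φ2 : Fin n → Fin k₂) (hn : 3 ≤ n) (hk1 : 0 < k₁) (hk2 : 0 < k₂) 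
    (hX1 : ∀ i, L₁ i ∈ X) (hX2 : ∀ i, L₂ i ∉ X) (hl1 : 2 ≤ k₁ → ∀ i, G.S.Adj (L₁ i) (L₁ (nxt i)))
    (hl2 : 2 ≤ k₂ → ∀ i, G.S.Adj (L₂ i) (L₂ (nxt i))) (hinj : Function.Injective w) (hV : ∀ i, G.S.IsV (w i))
    (h1 : ∀ i, L₁ (φ1 i) ∈ G.S.A (w i)) (h2 : ∀ i, L₂ (φ2 i) ∈ G.S.A (w i)) 
    (h1' : ∀ i, L₁ (φ1 i) ∈ G.S.A (w (nxt i))) (h2' : ∀ i, L₂ (φ2 i) ∈ G.S.A (w (nxt i)))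
    (hcross : ∀ F H, F ∈ X → H ∉ X → G.S.Adj F H → ∃ i, F = L₁ (φ1 i) ∧ H = L₂ (φ2 i)) (hφ1 : Wlk φ1) (hφ2 : Wlk φ2) :
    Borders P (fun i => (L₁ i).1) (fun i => (L₂ i).1) := by
  have hne : ∀ i, L₁ (φ1 i) ≠ L₂ (φ2 i) := fun i h => hX2 (φ2 i) (h ▸ hX1 (φ1 i))
  have hseg : ∀ i, segment ℝ (w i) (w (nxt i)) = (L₁ (φ1 i)).1 ∩ (L₂ (φ2 i)).1 := by
    intro i
    exact G.seg_edge (hne i) (hV i) (hV _) (fun h => nxt_ne (by omega) i (hinj h).symm) (h1 i) (h2 i) (h1' i) (h2' i)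
  have hadj : ∀ i, G.S.Adj (L₁ (φ1 i)) (L₂ (φ2 i)) := fun i => G.S.adj_of_V (hV i).1 (h1 i) (h2 i) (hne i)
  set γ : Set E3 := ⋃ i, segment ℝ (w i) (w (nxt i)) with hγ
  have hcyc : IsSimpleEdgeCycleVia P γ w := by
    refine ⟨hn, hinj, fun i => G.vert_iff.2 (hV i), fun i => ?_, rfl⟩
    rw [hseg]; exact G.edge_of_adj (hadj i)
  have hmem : ∀ x, x ∈ γ ↔ ∃ i, x ∈ (L₁ (φ1 i)).1 ∧ x ∈ (L₂ (φ2 i)).1 := by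
    intro x
    rw [hγ, mem_iUnion]
    apply exists_congr; intro i; rw [hseg]; rfl
  have hB : G.Side X (frontier P \ γ) := by
    intro x
    rw [mem_sdiff, G.frontier_eq, hmem]
    constructor
    · rintro ⟨⟨hx, h0⟩, hnx⟩
      refine ⟨hx, h0, ?_⟩
      by_contra hcon
      push Not at hcon
      obtain ⟨c1, c2⟩ := hcon
      rw [Set.not_subset] at c1 c2
      obtain ⟨H, hH, hHX⟩ := c1
      obtain ⟨F, hF, hFX⟩ := c2
      have hFX : F ∈ X := by simpa using hFX
      obtain ⟨i, rfl, rfl⟩ := hcross F H hFX hHX (G.S.adj_of_V (by rw [G.hS]; exact hx) hF hH (fun h => hHX (h ▸ hFX)))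
      exact hnx ⟨i, G.hA'.2 ⟨hx, hF⟩, G.hA'.2 ⟨hx, hH⟩⟩
    · rintro ⟨hx, h0, h⟩
      refine ⟨⟨hx, h0⟩, ?_⟩
      rintro ⟨i, hi1, hi2⟩
      have hi1 := (G.hA'.1 hi1).2
      have hi2 := (G.hA'.1 hi2).2
      rcases h with h | h
      · exact hX2 _ (h hi2)
      · exact h hi1 (hX1 _)
  have hc1 : ∀ i, connectedComponentIn (frontier P \ γ) (G.pt (L₁ i)) = 
      connectedComponentIn (frontier P \ γ) (G.pt (L₁ ⟨0, hk1⟩)) := 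
    nxt_induct hk1 rfl (fun hk i hi => by
      rw [← hi]; exact (G.side_adj hB (hl1 hk i) (by simp [hX1])).symm)
  have hc2 : ∀ i, connectedComponentIn (frontier P \ γ) (G.pt (L₂ i)) = 
      connectedComponentIn (frontier P \ γ) (G.pt (L₂ ⟨0, hk2⟩)) := 
    nxt_induct hk2 rfl (fun hk i hi => by
      rw [← hi]; exact (G.side_adj hB (hl2 hk i) (by simp [hX2])).symm)
  refine ⟨γ, connectedComponentIn (frontier P \ γ) (G.pt (L₁ ⟨0, hk1⟩)), 
    connectedComponentIn (frontier P \ γ) (G.pt (L₂ ⟨0, hk2⟩)), ⟨_, G.pt_mem hB _, rfl⟩, ⟨_, G.pt_mem hB _, rfl⟩, 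
    G.side_ne hB (hX1 _) (hX2 _), ⟨⟨hk1, fun i => (L₁ i).2, fun hk i => G.edge_of_adj (hl1 hk i)⟩, ?_, n, w, φ1, hcyc, ?_, hφ1⟩, 
    ⟨⟨hk2, fun i => (L₂ i).2, fun hk i => G.edge_of_adj (hl2 hk i)⟩, ?_, n, w, φ2, hcyc, ?_, hφ2⟩⟩
  · intro i; rw [← hc1 i]; exact G.side_intr hB
  · intro i; rw [hseg]; exact inter_subset_left
  · intro i; rw [← hc2 i]; exact G.side_intr hB
  · intro i; rw [hseg]; exact inter_subset_right

end Geo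
end

section
namespace Geo
variable {P : Set E3} (G : Geo P) (h56 : ∀ i, G.S.deg i = 5 ∨ G.S.deg i = 6) (hp : ∃ i, G.S.deg i = 5)

/-- The combinatorial map of the polytope. -/
abbrev M : CMap G.S.Dart (Fac P) := G.S.toCMap h56 hp

lemma madj {F H : Fac P} : (G.M h56 hp).Adj F H ↔ G.S.Adj F H := by
  constructor
  · rintro ⟨d, rfl, rfl⟩; exact d.2
  · intro h; exact ⟨⟨(F, H), h⟩, rfl, rfl⟩

lemma v1 (d : G.S.Dart) (t : ℤ) : (G.M h56 hp).f d ∈ G.S.A (SPoly.vtx ((G.M h56 hp).R t d)) := by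
  have := SPoly.vtx1 ((G.M h56 hp).R t d)
  have e : ((G.M h56 hp).R t d).1.1 = (G.M h56 hp).f d := (G.M h56 hp).fR t d
  rwa [e] at this
lemma v2 (d : G.S.Dart) (t : ℤ) : (G.M h56 hp).f ((G.M h56 hp).a ((G.M h56 hp).R t d)) ∈ G.S.A (SPoly.vtx ((G.M h56 hp).R t d)) := 
  SPoly.vtx2 ((G.M h56 hp).R t d)
lemma v3 (d : G.S.Dart) (t : ℤ) : (G.M h56 hp).f ((G.M h56 hp).a ((G.M h56 hp).R (t + 1) d)) ∈ G.S.A (SPoly.vtx ((G.M h56 hp).R t d)) := by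
  have h := SPoly.vtx3 ((G.M h56 hp).R t d)
  have e : (G.M h56 hp).R (t + 1) d = (G.M h56 hp).r ((G.M h56 hp).R t d) := by
    rw [add_comm, ← (G.M h56 hp).R_add, (G.M h56 hp).R_one]
  rw [e]; exact h

lemma vinj {d : G.S.Dart} {s t : ℤ} (h : SPoly.vtx ((G.M h56 hp).R s d) = SPoly.vtx ((G.M h56 hp).R t d)) : 
    ((G.M h56 hp).N ((G.M h56 hp).f d) : ℤ) ∣ s - t := by
  have := SPoly.corner_unique (show ((G.M h56 hp).R s d).1.1 = ((G.M h56 hp).R t d).1.1 from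
    ((G.M h56 hp).fR s d).trans ((G.M h56 hp).fR t d).symm) h
  exact (G.M h56 hp).eq_iff' (by rw [this])

lemma nxt5 (j : Fin 5) : nxt j = j + 1 := by revert j; decide
lemma prv5 (j : Fin 5) : prv j = j + 4 := by revert j; decide

lemma belt_mk {B : Fin 5 → Fac P} (hB : (G.M h56 hp).AbsBelt B) : IsBelt P (fun j => (B j).1) := by
  refine ⟨by norm_num, ⟨by norm_num, fun i => (B i).2, fun _ i => ?_⟩, by norm_num, fun _ p q hpq => ?_⟩
  · rw [nxt5]; exact G.edge_of_adj ((G.madj h56 hp).1 (hB i).1)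
  · have key : ∀ p q : Fin 5, p ≠ q → q = p + 1 ∨ p = q + 1 ∨ q = p + 2 ∨ p = q + 2 := by decide
    have k2 : ∀ p : Fin 5, p + 2 ≠ p + 1 ∧ p ≠ p + 2 + 1 := by decide
    have hno : ∀ p : Fin 5, ¬ ((B p).1 ∩ (B (p + 2)).1).Nonempty := by
      intro p hh
      exact (hB p).2.2 ((G.madj h56 hp).2 (G.adj_iff.2 ⟨(hB p).2.1, hh⟩))
    have hyes : ∀ p : Fin 5, ((B p).1 ∩ (B (p + 1)).1).Nonempty := by
      intro p
      exact (G.adj_iff.1 ((G.madj h56 hp).1 (hB p).1)).2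
    rw [nxt5, nxt5]
    rcases key p q hpq with rfl | rfl | rfl | rfl
    · simp [hyes]
    · rw [inter_comm]; simp [hyes]
    · have := k2 p; simp [hno, this]
    · have := k2 q; rw [inter_comm]; simp [hno, this]

lemma belt_lift {B : Fin 5 → Set E3} (hB : IsBelt P B) : ∃ B' : Fin 5 → Fac P, (∀ j, (B' j).1 = B j) ∧ (G.M h56 hp).AbsBelt B' := by
  obtain ⟨-, ⟨-, hf, he⟩, -, hb⟩ := hB
  have hb := hb (by norm_num)
  have he := he (by norm_num)
  refine ⟨fun j => ⟨B j, hf j⟩, fun j => rfl, fun j => ?_⟩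
  have k2 : ∀ p : Fin 5, p ≠ p + 2 ∧ p + 2 ≠ p + 1 ∧ p ≠ p + 2 + 1 := by decide
  have k3 : ∀ p : Fin 5, p ≠ p + 1 ∧ p ≠ p + 1 + 1 ∧ p + 2 ≠ p ∧ p + 1 + 1 = p + 2 ∧ p ≠ p + 1 + 1 + 1 ∧ p + 1 ≠ p + 4 ∧ p + 4 + 1 = p := by decide
  have k4 : ∀ p : Fin 5, p + 1 ≠ p + 4 ∧ p + 4 ≠ p + 2 ∧ p + 1 ≠ p + 4 + 1 ∧ p + 4 ≠ p  := by decide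
  have hno : ∀ p : Fin 5, ¬ (B p ∩ B (p + 2)).Nonempty := by
    intro p hh
    rcases (hb p (p + 2) (k2 p).1).1 hh with h | h
    · exact (k2 p).2.1 (by rw [h, nxt5])
    · exact (k2 p).2.2 (by rw [nxt5] at h; exact h)
  have hne : ∀ p : Fin 5, (B p).Nonempty := fun p => (hf p).1.1
  have h2 : B j ≠ B (j + 2) := by
    intro h
    apply hno j
    rw [← h, inter_self]; exact hne j
  have h1 : B j ≠ B (j + 1) := by
    intro h
    have h3 := hno (j + 4)
    apply h3
    have h4 : ∀ p : Fin 5, p + 4 + 2 = p + 1 := by decide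
    rw [h4, ← h]
    have := (hb (j + 4) j (k4 j).2.2.2).2 (Or.inl (by rw [nxt5, (k3 j).2.2.2.2.2.2]))
    exact this
  refine ⟨(G.madj h56 hp).2 (G.adj_iff.2 ⟨fun h => h1 (congrArg Subtype.val h), ?_⟩), fun h => h2 (congrArg Subtype.val h), ?_⟩
  · exact (hb j (j + 1) (k3 j).1).2 (Or.inl (by rw [nxt5]))
  · intro h
    exact hno j (G.adj_iff.1 ((G.madj h56 hp).1 h)).2

lemma absbelt_rev {B : Fin 5 → Fac P} (hB : (G.M h56 hp).AbsBelt B) : (G.M h56 hp).AbsBelt (fun j => B (-j)) := by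
  intro j
  have e1 : ∀ j : Fin 5, -j = -(j + 1) + 1 ∧ -j = -(j+2) + 2 := by decide
  have h1 := hB (-(j + 1)); rw [← (e1 j).1] at h1
  have h2 := hB (-(j + 2)); rw [← (e1 j).2] at h2
  exact ⟨CMap.Adj.symm _ h1.1, fun h => h2.2.1 h.symm, fun h => h2.2.2 (CMap.Adj.symm _ h)⟩

/-- A loop of the neighbours of a pentagon surrounds it. -/
lemma surr_pos {d : G.S.Dart} (h5 : (G.M h56 hp).N ((G.M h56 hp).f d) = 5) {B : Fin 5 → Fac P} (hB : (G.M h56 hp).AbsBelt B)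
    (h : ∀ j : Fin 5, B j = (G.M h56 hp).f ((G.M h56 hp).a ((G.M h56 hp).R ((j : ℕ) : ℤ) d))) : 
    Surrounds P (fun j => (B j).1) ((G.M h56 hp).f d).1 := by
  refine ⟨((G.M h56 hp).f d).2, ?_⟩
  refine G.borders_of {F | F ≠ (G.M h56 hp).f d} (k₂ := 1) B (fun _ => (G.M h56 hp).f d) 
    (fun j : Fin 5 => SPoly.vtx ((G.M h56 hp).R (((j : ℕ) : ℤ) - 1) d)) id (fun _ => 0) (by norm_num) (by norm_num) (by norm_num) 
    ?_ ?_ ?_ (by norm_num) ?_ (fun i => SPoly.vtx_V _) ?_ ?_ ?_ ?_ ?_ ?_ ?_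
  · intro i
    rw [h]
    exact (CMap.Adj.ne _ ((G.M h56 hp).adj_R d _)).symm
  · intro i; simp
  · intro _ i; rw [nxt5]; exact (G.madj h56 hp).1 (hB i).1
  · intro i j hij
    have := G.vinj h56 hp hij
    rw [h5] at this
    have := i.2; have := j.2
    apply Fin.ext; push_cast at *; omega
  · intro i
    have := G.v3 h56 hp d (((i : ℕ) : ℤ) - 1)
    rw [sub_add_cancel, ← h] at this; exact this
  · intro i; exact G.v1 h56 hp d _
  · intro i
    have e : (G.M h56 hp).R (((nxt i : Fin 5) : ℕ) - 1 : ℤ) d = (G.M h56 hp).R ((i : ℕ) : ℤ) d := by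
      apply (G.M h56 hp).R_cong
      rw [h5]; have := i.2; simp only [nxt]; push_cast; omega
    have := G.v2 h56 hp d ((i : ℕ) : ℤ)
    rw [← e, e, ← h] at this
    show B i ∈ _
    beta_reduce
    rw [e]; exact this
  · intro i; exact G.v1 h56 hp d _
  · intro F H hF hH hFH
    have hH : H = (G.M h56 hp).f d := by simpa using hH
    subst hH
    obtain ⟨t, ht⟩ := (G.M h56 hp).adj_dart ((G.madj h56 hp).2 (hFH.symm))
    refine ⟨⟨(t % 5).toNat, by omega⟩, ?_, rfl⟩
    simp only [id]
    rw [h, ht]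
    congr 2
    apply (G.M h56 hp).R_cong
    rw [h5]; simp only []; omega
  · unfold Wlk; decide
  · unfold Wlk; decide

lemma surr_neg {d : G.S.Dart} (h5 : (G.M h56 hp).N ((G.M h56 hp).f d) = 5) {B : Fin 5 → Fac P} (hB : (G.M h56 hp).AbsBelt B)
    (h : ∀ j : Fin 5, B j = (G.M h56 hp).f ((G.M h56 hp).a ((G.M h56 hp).R (-((j : ℕ) : ℤ)) d))) : 
    Surrounds P (fun j => (B j).1) ((G.M h56 hp).f d).1 := by
  refine ⟨((G.M h56 hp).f d).2, ?_⟩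
  refine G.borders_of {F | F ≠ (G.M h56 hp).f d} (k₂ := 1) B (fun _ => (G.M h56 hp).f d) 
    (fun j : Fin 5 => SPoly.vtx ((G.M h56 hp).R (-((j : ℕ) : ℤ)) d)) id (fun _ => 0) (by norm_num) (by norm_num) (by norm_num) 
    ?_ ?_ ?_ (by norm_num) ?_ (fun i => SPoly.vtx_V _) ?_ ?_ ?_ ?_ ?_ ?_ ?_
  · intro i
    rw [h]
    exact (CMap.Adj.ne _ ((G.M h56 hp).adj_R d _)).symm
  · intro i; simp
  · intro _ i; rw [nxt5]; exact (G.madj h56 hp).1 (hB i).1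
  · intro i j hij
    have := G.vinj h56 hp hij
    rw [h5] at this
    have := i.2; have := j.2
    apply Fin.ext; push_cast at *; omega
  · intro i
    have := G.v2 h56 hp d (-((i : ℕ) : ℤ))
    rw [← h] at this; exact this
  · intro i; exact G.v1 h56 hp d _
  · intro i
    have e : (G.M h56 hp).R (-((nxt i : Fin 5) : ℕ) : ℤ) d = (G.M h56 hp).R (-((i : ℕ) : ℤ) - 1) d := by
      apply (G.M h56 hp).R_cong
      rw [h5]; have := i.2; simp only [nxt]; push_cast; omega
    have := G.v3 h56 hp d (-((i : ℕ) : ℤ) - 1)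
    rw [sub_add_cancel, ← h] at this
    show B i ∈ _
    beta_reduce
    rw [e]; exact this
  · intro i; exact G.v1 h56 hp d _
  · intro F H hF hH hFH
    have hH : H = (G.M h56 hp).f d := by simpa using hH
    subst hH
    obtain ⟨t, ht⟩ := (G.M h56 hp).adj_dart ((G.madj h56 hp).2 (hFH.symm))
    refine ⟨⟨((-t) % 5).toNat, by omega⟩, ?_, rfl⟩
    simp only [id]
    rw [h, ht]
    congr 2
    apply (G.M h56 hp).R_cong
    rw [h5]; simp only []; omega
  · unfold Wlk; decide
  · unfold Wlk; decide

end Geo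
end

section
def ph1 (m : Fin 10) : Fin 5 := ⟨(m.1 + 1) / 2 % 5, by omega⟩
def ph2 (m : Fin 10) : Fin 5 := ⟨m.1 / 2, by omega⟩
lemma wlk1 : Wlk ph1 := by unfold Wlk; decide
lemma wlk2 : Wlk ph2 := by unfold Wlk; decide

namespace Geo
variable {P : Set E3} (G : Geo P) (h56 : ∀ i, G.S.deg i = 5 ∨ G.S.deg i = 6) (hp : ∃ i, G.S.deg i = 5)

section tube
variable {G h56 hp} (T : (G.M h56 hp).Tube)

/-- The vertices of the cycle separating two consecutive rings. -/
def W (i m : ℕ) : E3 := SPoly.vtx ((G.M h56 hp).R (1 + ((m % 2 : ℕ) : ℤ)) (T.x i ((m / 2 : ℕ) : ℤ)))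

lemma W_per {i : ℕ} (hi : i ≤ T.K) : W T i 10 = W T i 0 := by
  unfold W
  rw [T.xper hi (j := ((10 / 2 : ℕ) : ℤ)) (j' := ((0 / 2 : ℕ) : ℤ)) (by norm_num)]

lemma W_even (i j : ℕ) : W T i (2 * j) = SPoly.vtx ((G.M h56 hp).R 1 (T.x i (j : ℤ))) := by
  unfold W
  rw [show 2 * j % 2 = 0 by omega, show 2 * j / 2 = j by omega]; norm_num
lemma W_odd (i j : ℕ) : W T i (2 * j + 1) = SPoly.vtx ((G.M h56 hp).R 2 (T.x i (j : ℤ))) := by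
  unfold W
  rw [show (2 * j + 1) % 2 = 1 by omega, show (2 * j + 1) / 2 = j by omega]; norm_num

lemma W_mem {i : ℕ} (hi : i < T.K) (m : ℕ) : 
    T.Q i (((m + 1) / 2 : ℕ) : ℤ) ∈ G.S.A (W T i m) ∧ T.Q (i + 1) ((m / 2 : ℕ) : ℤ) ∈ G.S.A (W T i m) ∧ 
    T.Q i (((m + 1) / 2 : ℕ) : ℤ) ∈ G.S.A (W T i (m + 1)) ∧ T.Q (i + 1) ((m / 2 : ℕ) : ℤ) ∈ G.S.A (W T i (m + 1)) ∧ 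
    T.Q i ((m / 2 : ℕ) : ℤ) ∈ G.S.A (W T i m) := by
  rcases Nat.even_or_odd' m with ⟨j, rfl | rfl⟩
  · rw [W_even, W_odd, show (2 * j + 1) / 2 = j by omega, show 2 * j / 2 = j by omega]
    refine ⟨G.v1 h56 hp _ 1, ?_, G.v1 h56 hp _ 2, ?_, G.v1 h56 hp _ 1⟩
    · rw [← T.nb2]; exact G.v3 h56 hp _ 1
    · rw [← T.nb2]; exact G.v2 h56 hp _ 2
  · rw [W_odd, show 2 * j + 1 + 1 = 2 * (j + 1) by ring, W_even, show 2 * (j + 1) / 2 = j + 1 by omega, 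
      show (2 * j + 1) / 2 = j by omega]
    push_cast
    refine ⟨?_, ?_, G.v1 h56 hp _ 1, ?_, G.v1 h56 hp _ 2⟩
    · rw [← T.nb3 hi]; exact G.v3 h56 hp _ 2
    · rw [← T.nb2]; exact G.v2 h56 hp _ 2
    · have := T.nb1 hi ((j : ℤ) + 1)
      rw [add_sub_cancel_right] at this
      rw [← this]; exact G.v2 h56 hp _ 1

lemma W_V (i m : ℕ) : G.S.IsV (W T i m) := SPoly.vtx_V _

lemma Q_cross {i : ℕ} (hi : i < T.K) {j j' : ℤ} (h : (G.M h56 hp).Adj (T.Q i j) (T.Q (i + 1) j')) : 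
    (5 : ℤ) ∣ j - j' ∨ (5 : ℤ) ∣ j - j' - 1 := by
  obtain ⟨l, ⟨h1, h2⟩ | ⟨h1, h2⟩⟩ := T.cross hi h (Or.inr ⟨i, le_rfl, j, rfl⟩) (T.Q_not_low (by omega) (by omega) _)
  all_goals
    have h1 := (T.Qeq (by omega) (by omega) h1).2
    have h2 := (T.Qeq (by omega) (by omega) h2).2
    omega

lemma W_inj {i : ℕ} (hi : i < T.K) {m m' : ℕ} (hm : m < 10) (hm' : m' < 10) (h : W T i m = W T i m') : m = m' := by
  have a1 := (W_mem T hi m).2.2.2.2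
  have a2 := (W_mem T hi m).2.1
  have b1 := (W_mem T hi m').2.2.2.2
  have b2 := (W_mem T hi m').2.1
  rw [← h] at b1 b2
  have hne : ∀ j j', T.Q i j ≠ T.Q (i + 1) j' := fun j j' he => by
    have := (T.Qeq (by omega) (by omega) he).1; omega
  have c1 := Q_cross T hi ((G.madj h56 hp).2 (G.S.adj_of_V (W_V T i m).1 a1 b2 (hne _ _)))
  have c2 := Q_cross T hi ((G.madj h56 hp).2 (G.S.adj_of_V (W_V T i m).1 b1 a2 (hne _ _)))
  have e : m / 2 = m' / 2 := by omega
  unfold W at h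
  rw [e] at h
  have := G.vinj h56 hp h
  rcases (G.M h56 hp).N56 ((G.M h56 hp).f (T.x i ((m' / 2 : ℕ) : ℤ))) with h5 | h5 <;> rw [h5] at this <;> push_cast at this <;> omega

/-- The facets of a ring. -/
def rg (i : ℕ) (j : Fin 5) : Set E3 := (T.Q i ((j : ℕ) : ℤ)).1

lemma ring_borders {i : ℕ} (hi : i < T.K) : Borders P (rg T i) (rg T (i + 1)) := by
  have hb1 := T.ring_belt (i := i) (by omega)
  have hb2 := T.ring_belt (i := i + 1) (by omega)
  have hW : ∀ m : Fin 10, W T i (nxt m : Fin 10).1 = W T i (m.1 + 1) := by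
    intro m
    have := m.2
    simp only [nxt]
    rcases Nat.lt_or_ge (m.1 + 1) 10 with h | h
    · rw [Nat.mod_eq_of_lt h]
    · have h : m.1 + 1 = 10 := by omega
      rw [h, Nat.mod_self, W_per T (by omega)]
  have hQ : ∀ m : ℕ, T.Q i (((m + 1) / 2 % 5 : ℕ) : ℤ) = T.Q i (((m + 1) / 2 : ℕ) : ℤ) := fun m => T.Qper (by omega) (by push_cast; omega)
  refine G.borders_of (T.low i) (fun j : Fin 5 => T.Q i ((j : ℕ) : ℤ)) (fun j : Fin 5 => T.Q (i + 1) ((j : ℕ) : ℤ)) 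
    (fun m : Fin 10 => W T i m.1) (fun m => ⟨(m.1 + 1) / 2 % 5, by omega⟩) (fun m => ⟨m.1 / 2, by omega⟩) (by norm_num) (by norm_num) 
    (by norm_num) (fun j => Or.inr ⟨i, le_rfl, _, rfl⟩) (fun j => T.Q_not_low (by omega) (by omega) _) ?_ ?_ ?_ 
    (fun m => W_V T _ _) ?_ ?_ ?_ ?_ ?_ ?_ ?_
  · intro _ j; rw [nxt5]; exact (G.madj h56 hp).1 (hb1 j).1
  · intro _ j; rw [nxt5]; exact (G.madj h56 hp).1 (hb2 j).1
  · intro m m' h; exact Fin.ext (W_inj T hi m.2 m'.2 h)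
  · intro m
    simp only [hQ]
    exact (W_mem T hi m).1
  · intro m
    exact (W_mem T hi m).2.1
  · intro m
    simp only [hQ, hW]
    exact (W_mem T hi m).2.2.1
  · intro m
    simp only [hW]
    exact (W_mem T hi m).2.2.2.1
  · intro F H hF hH hFH
    obtain ⟨j, ⟨rfl, rfl⟩ | ⟨rfl, rfl⟩⟩ := T.cross hi ((G.madj h56 hp).2 hFH) hF hH
    · refine ⟨⟨2 * (j % 5).toNat, by omega⟩, T.Qper (by omega) ?_, T.Qper (by omega) ?_⟩ <;> simp only [] <;> omega
    · refine ⟨⟨2 * (j % 5).toNat + 1, by omega⟩, T.Qper (by omega) ?_, T.Qper (by omega) ?_⟩ <;> simp only [] <;> omega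
  · exact wlk1
  · exact wlk2

lemma cap0 : IsCapOf P T.F0.1 (rg T 0) := by
  refine ⟨T.F0.2, ?_, fun i => ?_, G.belt_mk h56 hp (T.ring_belt (by omega)), ?_⟩
  · rw [G.facetEdges_eq]; exact T.NF0
  · unfold rg; rw [G.facetEdges_eq]; exact T.N0 _
  · exact G.surr_pos h56 hp T.NF0 (T.ring_belt (by omega)) (fun j => (T.nbF0 _).symm)

lemma cap1 : IsCapOf P T.F1.1 (rg T T.K) := by
  refine ⟨T.F1.2, ?_, fun i => ?_, G.belt_mk h56 hp (T.ring_belt le_rfl), ?_⟩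
  · rw [G.facetEdges_eq]; exact T.NF1
  · unfold rg; rw [G.facetEdges_eq]; exact T.NK _
  · exact G.surr_neg h56 hp T.NF1 (T.ring_belt le_rfl) (fun j => (T.nbF1 _).symm)

lemma familyI : FamilyI P (T.K - 1) := by
  have hK := T.hK
  refine ⟨T.F0.1, T.F1.1, rg T 0, rg T T.K, fun i => rg T (i + 1), cap0 T, cap1 T, ?_, ?_, ?_, ?_, ?_⟩
  · intro i hi
    refine ⟨G.belt_mk h56 hp (T.ring_belt (by omega)), fun j => ?_⟩
    unfold rg; rw [G.facetEdges_eq]; exact T.N6 _ (by omega) (by omega) _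
  · intro i hi; exact ring_borders T (by omega)
  · intro h
    refine ⟨ring_borders T (by omega), ?_⟩
    have := ring_borders T (i := T.K - 1) (by omega)
    rw [Nat.sub_add_cancel (by omega)] at this
    show Borders P (rg T (T.K - 1 - 1 + 1)) _
    rwa [Nat.sub_add_cancel (by omega)]
  · intro h
    have h1 : T.K = 0 + 1 := by omega
    rw [h1]
    exact ring_borders T (by omega)
  · ext F
    constructor
    · intro hF
      have key : ∀ i ≤ T.K, ∀ j : ℤ, (T.Q i j).1 ∈ range (rg T i) := by
        intro i hi j
        refine ⟨⟨(j % 5).toNat, by omega⟩, ?_⟩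
        unfold rg
        congr 1
        apply T.Qper hi
        simp only []; omega
      rcases T.exh ⟨F, hF⟩ with h | h | ⟨i, hi, j, h⟩
      · have : F = T.F0.1 := congrArg Subtype.val h
        simp [this]
      · have : F = T.F1.1 := congrArg Subtype.val h
        simp [this]
      · have h2 : F = (T.Q i j).1 := congrArg Subtype.val h
        have h3 := key i hi j
        rw [← h2] at h3
        rcases Nat.eq_zero_or_pos i with rfl | h0
        · exact Or.inl (Or.inl (Or.inr h3))
        rcases hi.eq_or_lt with rfl | h1
        · exact Or.inl (Or.inr h3)
        · right
          refine mem_biUnion (x := i - 1) (by rw [mem_Iio]; omega) ?_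
          show F ∈ range (rg T (i - 1 + 1))
          rwa [Nat.sub_add_cancel h0]
    · rintro ((((h | h) | ⟨j, rfl⟩) | ⟨j, rfl⟩) | h)
      · rw [h]; exact T.F0.2
      · rw [h]; exact T.F1.2
      · exact (T.Q _ _).2
      · exact (T.Q _ _).2
      · obtain ⟨i, hi, j, rfl⟩ := mem_iUnion₂.1 h
        exact (T.Q _ _).2

end tube

lemma count_eq : fiveBeltCount P = (G.M h56 hp).BS.ncard := by
  unfold fiveBeltCount
  rw [← Set.ncard_image_of_injective (f := fun S : Set (Fac P) => Subtype.val '' S) _ (Set.image_injective.2 Subtype.val_injective)]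
  congr 1
  ext S
  constructor
  · rintro ⟨B, hB, rfl⟩
    obtain ⟨B', h1, h2⟩ := G.belt_lift h56 hp hB
    refine ⟨range B', ⟨B', h2, rfl⟩, ?_⟩
    show Subtype.val '' range B' = _
    rw [← range_comp]; congr 1; ext1 j; exact h1 j
  · rintro ⟨S', ⟨B, hB, rfl⟩, rfl⟩
    refine ⟨_, G.belt_mk h56 hp hB, ?_⟩
    show Subtype.val '' range B = _
    rw [← range_comp]; rfl

lemma opp {x : Fin 5 → G.S.Dart} {B : Fin 5 → Fac P} (hB : (G.M h56 hp).AbsBelt B) 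
    (hx : ∀ j, (G.M h56 hp).f (x j) = B j ∧ x (j + 1) = (G.M h56 hp).a ((G.M h56 hp).R 3 (x j)) ∧ (G.M h56 hp).N (B j) = 6) (j : Fin 5) : 
    OppositeEdges P (B j).1 ((B j).1 ∩ (B (nxt j)).1) ((B j).1 ∩ (B (prv j)).1) := by
  rw [nxt5, prv5]
  have k1 : ∀ j : Fin 5, j + 4 + 1 = j ∧ j + 4 + 2 = j + 1 := by decide
  have h1 := (G.madj h56 hp).1 (hB j).1
  have h4 := hB (j + 4)
  rw [(k1 j).1, (k1 j).2] at h4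
  have h2 := (SPoly.Adj.symm ((G.madj h56 hp).1 h4.1))
  have hdis : ∀ p, p ∈ (B (j + 1)).1 → p ∈ (B (j + 4)).1 → False := by
    intro p p1 p2
    exact h4.2.2 ((G.madj h56 hp).2 (G.adj_iff.2 ⟨h4.2.1, p, p2, p1⟩))
  have n3 : B (j + 1) = (G.M h56 hp).f ((G.M h56 hp).a ((G.M h56 hp).R 3 (x j))) := by
    rw [← (hx j).2.1, (hx _).1]
  have n0 : B (j + 4) = (G.M h56 hp).f ((G.M h56 hp).a ((G.M h56 hp).R 0 (x j))) := by
    have := (hx (j + 4)).2.1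
    rw [(k1 j).1] at this
    rw [CMap.R_zero, this, CMap.aa, CMap.fR, (hx _).1]
  refine ⟨G.edge_of_adj h1, G.edge_of_adj h2, inter_subset_left, inter_subset_left, ?_, ?_⟩
  · ext p
    simp only [mem_inter_iff, mem_empty_iff_false, iff_false]
    rintro ⟨⟨_, p1⟩, _, p2⟩
    exact hdis p p1 p2
  · intro e'' he hs ⟨p, hp1, hp2⟩ hne
    obtain ⟨H, hH, rfl⟩ : ∃ H, G.S.Adj (B j) H ∧ e'' = (B j).1 ∩ H.1 := by
      obtain ⟨F, H, hFH, rfl⟩ := G.edge_iff.1 he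
      rcases G.edge_sub hFH hs with h | h
      · exact ⟨H, h ▸ hFH, by rw [h]⟩
      · exact ⟨F, h ▸ hFH.symm, by rw [h, inter_comm]⟩
    rw [Set.eq_empty_iff_forall_notMem]
    rintro q ⟨⟨_, q1⟩, _, q2⟩
    have hne1 : H ≠ B (j + 1) := by rintro rfl; exact hne rfl
    have hne2 : H ≠ B (j + 4) := by rintro rfl; exact hdis p hp2.2 hp1.2
    have A1 : (G.M h56 hp).Adj H (B (j + 1)) := (G.madj h56 hp).2 (G.adj_iff.2 ⟨hne1, p, hp1.2, hp2.2⟩)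
    have A2 : (G.M h56 hp).Adj H (B (j + 4)) := (G.madj h56 hp).2 (G.adj_iff.2 ⟨hne2, q, q1, q2⟩)
    obtain ⟨t, ht⟩ := (G.M h56 hp).adj_dart (d := x j) (by rw [(hx j).1]; exact (G.madj h56 hp).2 hH)
    rw [ht, n3] at A1
    rw [ht, n0] at A2
    have A1 := (G.M h56 hp).adj3' A1
    have A2 := (G.M h56 hp).adj3' A2
    rw [(hx j).1, (hx j).2.2] at A1 A2
    push_cast at A1 A2
    omega

lemma cap_of_straight {x : Fin 5 → G.S.Dart} {B : Fin 5 → Fac P} 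
    (hx : ∀ j, (G.M h56 hp).f (x j) = B j ∧ x (j + 1) = (G.M h56 hp).a ((G.M h56 hp).R 3 (x j)) ∧ (G.M h56 hp).N (B j) = 6) : 
    ∃ F, (G.M h56 hp).IsCap F := by
  refine (G.M h56 hp).cap_of_tube (x0 := fun j => x ⟨(j % 5).toNat, by omega⟩) ?_ ?_ ?_
  · intro j
    have := (hx ⟨(j % 5).toNat, by omega⟩).2.1
    rw [← this]
    congr 1
    apply Fin.ext
    rw [Fin.val_add]
    simp only []
    norm_num
    omega
  · intro j
    have : (j + 5) % 5 = j % 5 := by omega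
    simp only [this]
  · intro j
    rw [(hx _).1, (hx _).2.2]

lemma cap_lift {F : Set E3} {L : Fin 5 → Set E3} (h : IsCapOf P F L) : ∃ F, (G.M h56 hp).IsCap F := by
  obtain ⟨hF, h5, hL5, hb, -, γ, C1, C2, ⟨c1, -, rfl⟩, ⟨c2, -, rfl⟩, hC, ⟨-, hi1, n1, v1, φ1, hc1, hs1, -, hsur, -⟩, 
    ⟨-, hi2, n2, v2, φ2, hc2, hs2, -⟩⟩ := h
  obtain ⟨B, hB1, hB⟩ := G.belt_lift h56 hp hb
  have hγ : γ ⊆ F := by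
    rw [hc2.2.2.2.2]
    exact iUnion_subset hs2
  have hadj : ∀ i, G.S.Adj ⟨F, hF⟩ (B i) := by
    intro i
    rw [G.adj_iff]
    constructor
    · intro h
      have e : F = L i := by rw [← hB1, ← h]
      obtain ⟨y, hy⟩ : (intrinsicInterior ℝ F).Nonempty := Set.Nonempty.intrinsicInterior hF.1.2.2.1 hF.1.1
      have y1 := hi1 i (e ▸ hy)
      have y2 := hi2 0 hy
      exact hC ((connectedComponentIn_eq y1).trans (connectedComponentIn_eq y2).symm)
    · obtain ⟨m, rfl⟩ := hsur i
      refine ⟨v1 m, ?_, ?_⟩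
      · apply hγ
        rw [hc1.2.2.2.2]
        exact mem_iUnion.2 ⟨m, left_mem_segment _ _ _⟩
      · rw [hB1]; exact hs1 m (left_mem_segment _ _ _)
  have hN : G.S.deg ⟨F, hF⟩ = 5 := by rw [← G.facetEdges_eq]; exact h5
  have hinj : Function.Injective B := by
    intro p q hpq
    by_contra hne
    have key : ∀ p q : Fin 5, p ≠ q → q = p + 1 ∨ p = q + 1 ∨ q = p + 2 ∨ p = q + 2 := by decide
    rcases key p q hne with rfl | rfl | rfl | rfl
    · exact CMap.Adj.ne _ (hB p).1 hpq
    · exact CMap.Adj.ne _ (hB q).1 hpq.symm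
    · exact (hB p).2.1 hpq
    · exact (hB q).2.1 hpq.symm
  refine ⟨⟨F, hF⟩, hN, fun H hH => ?_⟩
  have := G.S.fin
  have hr : range B = {j | G.S.Adj ⟨F, hF⟩ j} := by
    apply Set.eq_of_subset_of_ncard_le
    · rintro _ ⟨i, rfl⟩; exact hadj i
    · have h1 : (range B).ncard = 5 := by
        rw [← image_univ, Set.ncard_image_of_injective _ hinj, Set.ncard_univ, Nat.card_fin]
      rw [h1]; exact hN.le
    · exact Set.toFinite _
  have hm : H ∈ range B := by rw [hr]; exact (G.madj h56 hp).1 hH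
  obtain ⟨i, rfl⟩ := hm
  show G.S.deg (B i) = 5
  rw [← G.facetEdges_eq, hB1]; exact hL5 i

end Geo

theorem five_belt_aux (P : Set E3) (hP : IsFullerene P) :
    ({F | IsFacetOf F P ∧ facetEdges P F = 5}.ncard = 12 ∧
      ∀ F : Set E3, IsFacetOf F P → facetEdges P F = 5 →
        ∃ B : Fin 5 → Set E3, IsBelt P B ∧ Surrounds P B F) ∧
    (∀ B : Fin 5 → Set E3, IsBelt P B → (¬ ∃ F : Set E3, Surrounds P B F) →
      (∀ j, facetEdges P (B j) = 6 ∧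
        OppositeEdges P (B j) (B j ∩ B (nxt j)) (B j ∩ B (prv j))) ∧
      ∃ k : ℕ, 1 ≤ k ∧ FamilyI P k ∧ fiveBeltCount P = 12 + k) ∧
    ((∃ (F₀ : Set E3) (L : Fin 5 → Set E3) (γ C C' : Set E3),
        IsCapOf P F₀ L ∧ IsCompOf C (frontier P \ γ) ∧ IsCompOf C' (frontier P \ γ) ∧
        C ≠ C' ∧ WalksRound P γ C L ∧ F₀ ∩ γ = ∅ ∧
        ∀ i, edgesInCommon P (L i) γ = 2) →
      ∃ k : ℕ, FamilyI P k) := by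
  obtain ⟨G⟩ := geo_ex hP.1
  have h56 : ∀ i, G.S.deg i = 5 ∨ G.S.deg i = 6 := by
    intro i
    rw [← G.facetEdges_eq]; exact hP.2 i.1 i.2
  have h12 := G.S.twelve h56
  have hp : ∃ i, G.S.deg i = 5 := by
    by_contra hno
    push Not at hno
    have : {i | G.S.deg i = 5} = ∅ := by
      ext i; simpa using hno i
    rw [this, ncard_empty] at h12
    omega
  have := G.S.fin
  refine ⟨⟨?_, ?_⟩, ?_, ?_⟩
  · rw [← h12, ← Set.ncard_image_of_injective _ (Subtype.val_injective (p := fun F : Set E3 => IsFacetOf F P))]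
    congr 1
    ext F
    constructor
    · rintro ⟨h1, h2⟩
      exact ⟨⟨F, h1⟩, by show G.S.deg _ = 5; rw [← G.facetEdges_eq]; exact h2, rfl⟩
    · rintro ⟨i, hi, rfl⟩
      exact ⟨i.2, by rw [G.facetEdges_eq]; exact hi⟩
  · intro F hF h5
    obtain ⟨d, hd⟩ := (G.M h56 hp).surj ⟨F, hF⟩
    have hN : (G.M h56 hp).N ((G.M h56 hp).f d) = 5 := by
      rw [hd]; show G.S.deg _ = 5; rw [← G.facetEdges_eq]; exact h5
    have hb := (G.M h56 hp).pent_belt hN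
    refine ⟨_, G.belt_mk h56 hp hb, ?_⟩
    have := G.surr_pos h56 hp hN hb (fun j => rfl)
    rw [hd] at this
    exact this
  · intro B hB hno
    obtain ⟨B', hB', hA⟩ := G.belt_lift h56 hp hB
    obtain rfl : (fun j => (B' j).1) = B := funext hB'
    rcases (G.M h56 hp).belt_class hA with ⟨d, hN, h | h⟩ | ⟨x, hx⟩
    · exact absurd ⟨_, G.surr_pos h56 hp hN hA h⟩ hno
    · exact absurd ⟨_, G.surr_neg h56 hp hN hA h⟩ hno
    · refine ⟨fun j => ⟨?_, G.opp h56 hp hA hx j⟩, ?_⟩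
      · rw [G.facetEdges_eq]; exact (hx j).2.2
      · obtain ⟨F, hF⟩ := G.cap_of_straight h56 hp hx
        obtain ⟨T, -⟩ := (G.M h56 hp).tube_of_cap hF
        obtain ⟨i, hi1, hi2, -⟩ := T.hex_ring (hx 0).2.2
        refine ⟨T.K - 1, by omega, Geo.familyI T, ?_⟩
        rw [G.count_eq h56 hp, T.count]
        congr 1
  · rintro ⟨F, L, -, -, -, hcap, -⟩
    obtain ⟨F, hF⟩ := G.cap_lift h56 hp hcap
    obtain ⟨T, -⟩ := (G.M h56 hp).tube_of_cap hF
    exact ⟨_, Geo.familyI T⟩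
end

/-- The 5-belt theorem for fullerenes: (1) the 12 pentagonal facets are each surrounded
by a 5-belt; (2) any 5-belt not surrounding a facet consists of hexagons meeting their
neighbors along opposite edges, the fullerene is a nanotube of Family I with `k ≥ 1`
hexagonal belts, and there are exactly `12 + k` five-belts; (3) if the fullerene
contains a cap whose outer boundary is met by each of the five surrounding pentagons in
two edges, then it has the Family I structure for some `k ≥ 0`. -/
theorem five_belt_theorem (P : Set E3) (hP : IsFullerene P) :
    ({F | IsFacetOf F P ∧ facetEdges P F = 5}.ncard = 12 ∧
      ∀ F : Set E3, IsFacetOf F P → facetEdges P F = 5 →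
        ∃ B : Fin 5 → Set E3, IsBelt P B ∧ Surrounds P B F) ∧
    (∀ B : Fin 5 → Set E3, IsBelt P B → (¬ ∃ F : Set E3, Surrounds P B F) →
      (∀ j, facetEdges P (B j) = 6 ∧
        OppositeEdges P (B j) (B j ∩ B (nxt j)) (B j ∩ B (prv j))) ∧
      ∃ k : ℕ, 1 ≤ k ∧ FamilyI P k ∧ fiveBeltCount P = 12 + k) ∧
    ((∃ (F₀ : Set E3) (L : Fin 5 → Set E3) (γ C C' : Set E3),
        IsCapOf P F₀ L ∧ IsCompOf C (frontier P \ γ) ∧ IsCompOf C' (frontier P \ γ) ∧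
        C ≠ C' ∧ WalksRound P γ C L ∧ F₀ ∩ γ = ∅ ∧
        ∀ i, edgesInCommon P (L i) γ = 2) →
      ∃ k : ℕ, FamilyI P k) := by
  exact five_belt_aux P hP
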